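/- Let (φ_t)_{t∈ℝ} be a Lipschitz continuous flow on a compact metric space M and φ: M → ℝ a continuous function. Suppose there exist ε > 0 and δ > 0 with ε ≥ 1000 L_X δ such that the flow is almost expansive at scale ε, and there exists a collection of orbit segments 𝒟 ⊂ M × ℝ⁺ admitting a decomposition (𝒫, 𝒢, 𝒮) with the following properties: (I) 𝒢 has tail (W)-specification at scale δ; (II) φ has the Bowen property at scale ε on 𝒢; (III) P(𝒟^c ∪ [𝒫] ∪ [𝒮], φ, δ, ε) < P(φ). Then there exists a unique equilibrium state for the potential φ. -/

import Mathlib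

/-!
Common definitions: continuous/Lipschitz flows on metric spaces, invariant measures,
measure-theoretic (Kolmogorov–Sinai) entropy, topological pressure via the variational
principle, equilibrium states, orbit-segment collections, the Bowen property,
tail (W)-specification, almost expansivity, decompositions, Climenhaga–Thompson
two-scale pressure, and empirical measures.
-/

open MeasureTheory Filter Set
open scoped ENNReal NNReal

section AbstractFlow

variable {M : Type*} [MetricSpace M]

/-- A (continuous) flow: jointly continuous, identity at time `0`, additive group law. -/
def IsCtsFlow (φ : ℝ → M → M) : Prop :=
  Continuous (fun q : ℝ × M => φ q.1 q.2) ∧ (∀ x, φ 0 x = x) ∧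
    ∀ s t x, φ (s + t) x = φ s (φ t x)

/-- A Lipschitz continuous flow: a flow whose time-`t` maps for `t ∈ [0,1]` are
uniformly Lipschitz. -/
def IsLipschitzFlow (φ : ℝ → M → M) : Prop :=
  IsCtsFlow φ ∧ ∃ K : ℝ≥0, ∀ t ∈ Set.Icc (0 : ℝ) 1, LipschitzWith K (φ t)

/-- The (best) Lipschitz constant of a map. -/
noncomputable def lipConst (f : M → M) : ℝ :=
  sInf {K : ℝ | 0 ≤ K ∧ LipschitzWith (Real.toNNReal K) f}

/-- `L_X = max (1, max_{t ∈ [0,1]} Lip(φ_t))`. -/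
noncomputable def flowLipBound (φ : ℝ → M → M) : ℝ :=
  max 1 (sSup {l : ℝ | ∃ t ∈ Set.Icc (0 : ℝ) 1, l = lipConst (φ t)})

/-- Invariance of a measure under every time-`t` map of the flow. -/
def flowInvariant [MeasurableSpace M] (φ : ℝ → M → M) (μ : Measure M) : Prop :=
  ∀ t : ℝ, Measure.map (φ t) μ = μ

/-- The bi-infinite Bowen ball `Γ_ε(x)`. -/
def biBowenBall (φ : ℝ → M → M) (ε : ℝ) (x : M) : Set M :=
  {y | ∀ t : ℝ, dist (φ t x) (φ t y) ≤ ε}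

/-- The set `Exp_ε` of expansive points at scale `ε`. -/
def expansivePoints (φ : ℝ → M → M) (ε : ℝ) : Set M :=
  {x | ∃ s > 0, biBowenBall φ ε x ⊆ (fun u => φ u x) '' Set.Icc (-s) s}

/-- The flow is almost expansive at scale `ε` if `Exp_ε` has full measure for every
invariant probability measure. -/
def AlmostExpansive [MeasurableSpace M] (φ : ℝ → M → M) (ε : ℝ) : Prop :=
  ∀ μ : Measure M, IsProbabilityMeasure μ → flowInvariant φ μ →
    μ (expansivePoints φ ε) = 1

/-- Almost expansive at scale `ε` relative to the invariant measures supported in `Λ`. -/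
def AlmostExpansiveOn [MeasurableSpace M] (φ : ℝ → M → M) (Λ : Set M) (ε : ℝ) : Prop :=
  ∀ μ : Measure M, IsProbabilityMeasure μ → flowInvariant φ μ → μ Λᶜ = 0 →
    μ (expansivePoints φ ε) = 1

/-- Entropy of a finite partition. -/
noncomputable def partEntropy [MeasurableSpace M] (μ : Measure M) (P : Finset (Set M)) : ℝ :=
  ∑ A ∈ P, -((μ A).toReal * Real.log (μ A).toReal)

/-- A finite measurable partition of the space. -/
def IsMeasPartition [MeasurableSpace M] (P : Finset (Set M)) : Prop :=
  (∀ A ∈ P, MeasurableSet A) ∧ (∀ A ∈ P, ∀ B ∈ P, A ≠ B → A ∩ B = ∅) ∧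
    ⋃₀ (P : Set (Set M)) = Set.univ

/-- Common refinement of two finite partitions. -/
noncomputable def pJoin (P Q : Finset (Set M)) : Finset (Set M) :=
  letI := Classical.decEq (Set M)
  Finset.image₂ (fun A B => A ∩ B) P Q

/-- Preimage of a finite partition under a map. -/
noncomputable def preimgPart (T : M → M) (P : Finset (Set M)) : Finset (Set M) :=
  letI := Classical.decEq (Set M)
  P.image (fun A => T ⁻¹' A)

/-- The dynamical refinement `P ∨ T⁻¹P ∨ ⋯ ∨ T⁻ⁿP`. -/
noncomputable def dynRefine (T : M → M) (P : Finset (Set M)) : ℕ → Finset (Set M)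
  | 0 => P
  | n + 1 => pJoin P (preimgPart T (dynRefine T P n))

/-- Entropy of `T` relative to a partition (the subadditive limit, as an infimum). -/
noncomputable def entropyOfPartition [MeasurableSpace M] (μ : Measure M) (T : M → M)
    (P : Finset (Set M)) : ℝ :=
  ⨅ n : ℕ, partEntropy μ (dynRefine T P n) / (n + 1)

/-- Kolmogorov–Sinai measure-theoretic entropy `h_μ(T)`. -/
noncomputable def metricEntropy [MeasurableSpace M] (μ : Measure M) (T : M → M) : ℝ :=
  sSup {h : ℝ | ∃ P : Finset (Set M), IsMeasPartition P ∧ h = entropyOfPartition μ T P}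

/-- Invariant probability measures of the flow giving full weight to `Λ`. -/
def InvariantProbOn [MeasurableSpace M] (φ : ℝ → M → M) (Λ : Set M) (μ : Measure M) : Prop :=
  IsProbabilityMeasure μ ∧ flowInvariant φ μ ∧ μ Λᶜ = 0

/-- Topological pressure of the flow on `Λ`, defined through the variational principle:
`P(φ) = sup_μ (h_μ(φ_1) + ∫ φ dμ)` over invariant probability measures supported in `Λ`. -/
noncomputable def pressureOn [MeasurableSpace M] (φ : ℝ → M → M) (Λ : Set M)
    (pot : M → ℝ) : ℝ :=
  sSup {r : ℝ | ∃ μ : Measure M, InvariantProbOn φ Λ μ ∧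
    r = metricEntropy μ (φ 1) + ∫ y, pot y ∂μ}

/-- An equilibrium state for `pot` on `Λ`: an invariant probability measure supported in `Λ`
attaining the supremum in the variational principle. -/
def IsEquilibriumOn [MeasurableSpace M] (φ : ℝ → M → M) (Λ : Set M) (pot : M → ℝ)
    (μ : Measure M) : Prop :=
  InvariantProbOn φ Λ μ ∧
    metricEntropy μ (φ 1) + ∫ y, pot y ∂μ = pressureOn φ Λ pot

/-- The (forward) Bowen ball of an orbit segment `(x, t)` at scale `ε`. -/
def bowenBallSeg (φ : ℝ → M → M) (ε t : ℝ) (x : M) : Set M :=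
  {y | ∀ s ∈ Set.Icc (0 : ℝ) t, dist (φ s x) (φ s y) ≤ ε}

/-- The Bowen property at scale `ε` on a collection `G` of orbit segments. -/
def HasBowenProperty (φ : ℝ → M → M) (pot : M → ℝ) (ε : ℝ) (G : Set (M × ℝ)) : Prop :=
  ∃ K > 0, ∀ q ∈ G, ∀ y ∈ bowenBallSeg φ ε q.2 q.1,
    |∫ s in (0 : ℝ)..q.2, (pot (φ s q.1) - pot (φ s y))| ≤ K

/-- Tail (W)-specification at scale `δ`: there is `T > 0` such that any finite family of
orbit segments in `G` of length at least `T` is `δ`-shadowed by a single orbit, with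
transition times bounded by `T`. -/
def HasTailSpecification (φ : ℝ → M → M) (G : Set (M × ℝ)) (δ : ℝ) : Prop :=
  ∃ T > 0, ∀ (k : ℕ) (x : Fin k → M) (t : Fin k → ℝ),
    (∀ i, (x i, t i) ∈ G) → (∀ i, T ≤ t i) →
    ∃ (y : M) (τ : Fin k → ℝ), (∀ i, τ i ∈ Set.Icc (0 : ℝ) T) ∧
      ∀ i : Fin k, ∀ u ∈ Set.Icc (0 : ℝ) (t i),
        dist (φ ((∑ j ∈ Finset.Iio i, (t j + τ j)) + u) y) (φ u (x i)) ≤ δ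

/-- A decomposition `(Pc, 𝒢, 𝒮)` of a collection `D` of orbit segments, with transition
functions `p, g, s`. -/
def IsDecomposition (φ : ℝ → M → M) (D P G S : Set (M × ℝ)) (p g s : M × ℝ → ℝ) : Prop :=
  ∀ q ∈ D, 0 ≤ p q ∧ 0 ≤ g q ∧ 0 ≤ s q ∧ q.2 = p q + g q + s q ∧
    (q.1, p q) ∈ P ∧ (φ (p q) q.1, g q) ∈ G ∧ (φ (p q + g q) q.1, s q) ∈ S

/-- Birkhoff integral of `pot` along the orbit segment `(x, t)`. -/
noncomputable def birkhoff (φ : ℝ → M → M) (pot : M → ℝ) (x : M) (t : ℝ) : ℝ :=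
  ∫ s in (0 : ℝ)..t, pot (φ s x)

/-- Climenhaga–Thompson weight: `exp` of the supremum of the Birkhoff integral over the
`δ`-Bowen ball of `(x,t)`. -/
noncomputable def ctWeight (φ : ℝ → M → M) (pot : M → ℝ) (δ : ℝ) (x : M) (t : ℝ) : ℝ :=
  Real.exp (sSup ((fun y => birkhoff φ pot y t) '' bowenBallSeg φ δ t x))

/-- A `(t, ε)`-separated set. -/
def IsSeparated (φ : ℝ → M → M) (ε t : ℝ) (E : Finset M) : Prop :=
  ∀ x ∈ E, ∀ y ∈ E, x ≠ y → ∃ s ∈ Set.Icc (0 : ℝ) t, ε < dist (φ s x) (φ s y)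

/-- Climenhaga–Thompson partition sum over `(t, ε)`-separated sets of initial points of
segments of length `t` in the collection `𝒞`. -/
noncomputable def partitionSum (φ : ℝ → M → M) (pot : M → ℝ) (𝒞 : Set (M × ℝ))
    (δ ε t : ℝ) : ℝ :=
  sSup {r : ℝ | ∃ E : Finset M, (↑E : Set M) ⊆ {x : M | (x, t) ∈ 𝒞} ∧
    IsSeparated φ ε t E ∧ r = ∑ x ∈ E, ctWeight φ pot δ x t}

/-- The two-scale Climenhaga–Thompson pressure `P(𝒞, pot, δ, ε)`. -/
noncomputable def ctPressure (φ : ℝ → M → M) (pot : M → ℝ) (𝒞 : Set (M × ℝ))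
    (δ ε : ℝ) : ℝ :=
  Filter.limsup (fun t : ℝ => Real.log (partitionSum φ pot 𝒞 δ ε t) / t) Filter.atTop

/-- The integer-time discretization `[Pc]` of a collection of orbit segments, as in
Climenhaga–Thompson. -/
def discretize (φ : ℝ → M → M) (P : Set (M × ℝ)) : Set (M × ℝ) :=
  {q | ∃ n : ℕ, q.2 = (n : ℝ) ∧ ∃ a ∈ Set.Ico (0 : ℝ) 1, ∃ b ∈ Set.Ico (0 : ℝ) 1,
    (φ (-a) q.1, (n : ℝ) + a + b) ∈ P}

/-- The complement `𝒟^c` of a collection of orbit segments inside `M × ℝ⁺`. -/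
def segComplement (D : Set (M × ℝ)) : Set (M × ℝ) :=
  {q : M × ℝ | 0 ≤ q.2 ∧ q ∉ D}

/-- The empirical measure `(1/t) ∫₀ᵗ δ_{φ_s x} ds` of the orbit segment `(x, t)`. -/
noncomputable def empiricalMeasure [MeasurableSpace M] (φ : ℝ → M → M) (x : M)
    (t : ℝ) : Measure M :=
  (ENNReal.ofReal t)⁻¹ • Measure.map (fun s => φ s x) (volume.restrict (Set.Icc (0 : ℝ) t))

/-- `μ` is a (weak*) limit point of convex combinations of empirical measures of orbit
segments in `𝒞` whose lengths tend to infinity. -/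
def IsEmpiricalLimit [MeasurableSpace M] (φ : ℝ → M → M) (𝒞 : Set (M × ℝ))
    (μ : Measure M) : Prop :=
  ∃ (ν : ℕ → Measure M) (T : ℕ → ℝ), Tendsto T atTop atTop ∧
    (∀ k : ℕ, ∃ (m : ℕ) (c : Fin m → ℝ≥0∞) (x : Fin m → M) (t : Fin m → ℝ),
      (∑ i, c i) = 1 ∧ (∀ i, (x i, t i) ∈ 𝒞 ∧ T k ≤ t i) ∧
      ν k = ∑ i, c i • empiricalMeasure φ (x i) (t i)) ∧
    ∀ f : C(M, ℝ), Tendsto (fun k => ∫ y, f y ∂(ν k)) atTop (nhds (∫ y, f y ∂μ))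

end AbstractFlow


namespace CT

section FlowBasics
variable {M : Type*} [MetricSpace M]

/-- Closeness of two orbits on a time window. -/
def dclose (φ : ℝ → M → M) (a b θ : ℝ) (x y : M) : Prop :=
  ∀ s ∈ Set.Icc a b, dist (φ s x) (φ s y) ≤ θ

theorem dclose.symm {φ : ℝ → M → M} {a b θ : ℝ} {x y : M} (h : dclose φ a b θ x y) :
    dclose φ a b θ y x := fun s hs => by rw [dist_comm]; exact h s hs

theorem dclose.mono {φ : ℝ → M → M} {a b a' b' θ θ' : ℝ} {x y : M} (h : dclose φ a b θ x y)
    (ha : a ≤ a') (hb : b' ≤ b) (hθ : θ ≤ θ') : dclose φ a' b' θ' x y :=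
  fun s hs => (h s ⟨ha.trans hs.1, hs.2.trans hb⟩).trans hθ

theorem dclose.trans {φ : ℝ → M → M} {a b θ θ' : ℝ} {x y z : M} (h : dclose φ a b θ x y)
    (h' : dclose φ a b θ' y z) : dclose φ a b (θ + θ') x z :=
  fun s hs => (dist_triangle _ _ _).trans (add_le_add (h s hs) (h' s hs))

theorem dclose.refl {φ : ℝ → M → M} {a b θ : ℝ} (hθ : 0 ≤ θ) (x : M) : dclose φ a b θ x x :=
  fun s _ => by simpa using hθ

theorem dclose.glue {φ : ℝ → M → M} {a b c θ : ℝ} {x y : M} (h : dclose φ a b θ x y)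
    (h' : dclose φ b c θ x y) : dclose φ a c θ x y := fun s hs => by
  rcases le_total s b with hb | hb
  · exact h s ⟨hs.1, hb⟩
  · exact h' s ⟨hb, hs.2⟩

variable {φ : ℝ → M → M}

theorem flow_add (hφ : IsCtsFlow φ) (s t : ℝ) (x : M) : φ (s + t) x = φ s (φ t x) := hφ.2.2 s t x

theorem flow_zero (hφ : IsCtsFlow φ) (x : M) : φ 0 x = x := hφ.2.1 x

theorem flow_cont (hφ : IsCtsFlow φ) (t : ℝ) : Continuous (φ t) :=
  hφ.1.comp (Continuous.prodMk continuous_const continuous_id)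

theorem flow_cont_left (hφ : IsCtsFlow φ) (x : M) : Continuous (fun t => φ t x) :=
  hφ.1.comp (Continuous.prodMk continuous_id continuous_const)

theorem dclose_shift (hφ : IsCtsFlow φ) {a b θ r : ℝ} {x y : M} :
    dclose φ a b θ (φ r x) (φ r y) ↔ dclose φ (a + r) (b + r) θ x y := by
  constructor
  · intro h s hs
    have := h (s - r) ⟨by linarith [hs.1], by linarith [hs.2]⟩
    rwa [← flow_add hφ, ← flow_add hφ, sub_add_cancel] at this
  · intro h s hs
    have := h (s + r) ⟨by linarith [hs.1], by linarith [hs.2]⟩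
    rwa [flow_add hφ, flow_add hφ] at this

/-- The flow as a homeomorphism. -/
def flowHomeo (hφ : IsCtsFlow φ) (t : ℝ) : M ≃ₜ M where
  toFun := φ t
  invFun := φ (-t)
  left_inv x := by rw [← flow_add hφ, neg_add_cancel, flow_zero hφ]
  right_inv x := by rw [← flow_add hφ, add_neg_cancel, flow_zero hφ]
  continuous_toFun := flow_cont hφ t
  continuous_invFun := flow_cont hφ (-t)

theorem flow_iter (hφ : IsCtsFlow φ) (t : ℝ) (n : ℕ) (x : M) : (φ t)^[n] x = φ (n * t) x := by
  induction n generalizing x with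
  | zero => simp [flow_zero hφ]
  | succ n ih =>
    rw [Function.iterate_succ_apply, ih, ← flow_add hφ]; congr 1; push_cast; ring

variable [CompactSpace M]

/-- For short times the flow moves points little. -/
theorem exists_small_time (hφ : IsCtsFlow φ) {θ : ℝ} (hθ : 0 < θ) :
    ∃ ζ > 0, ∀ u : ℝ, |u| ≤ ζ → ∀ x : M, dist (φ u x) x ≤ θ := by
  have hc : ∀ x ∈ (Set.univ : Set M), ∀ᶠ q : ℝ × M in nhds 0 ×ˢ nhds x, dist (φ q.1 q.2) q.2 < θ := by
    intro x _
    rw [← nhds_prod_eq]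
    have : Continuous (fun q : ℝ × M => dist (φ q.1 q.2) q.2) := hφ.1.dist continuous_snd
    refine this.continuousAt.eventually_lt continuousAt_const ?_
    simpa [flow_zero hφ] using hθ
  have := isCompact_univ.eventually_forall_of_forall_eventually
    (x₀ := (0 : ℝ)) (P := fun u x => dist (φ u x) x < θ) (by
      intro x hx; have := hc x hx; rwa [nhds_prod_eq])
  obtain ⟨r, hr, hr'⟩ := Metric.eventually_nhds_iff.1 this
  refine ⟨r / 2, by positivity, fun u hu x => (hr' (by simpa using hu.trans_lt (by linarith)) x trivial).le⟩

/-- Initially close points remain close for a fixed time. -/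
theorem exists_dist_dclose (hφ : IsCtsFlow φ) {θ L : ℝ} (hθ : 0 < θ) :
    ∃ ρ > 0, ∀ x y : M, dist x y ≤ ρ → dclose φ 0 L θ x y := by
  have huc : UniformContinuousOn (fun q : ℝ × M => φ q.1 q.2) (Icc 0 L ×ˢ univ) :=
    (isCompact_Icc.prod isCompact_univ).uniformContinuousOn_of_continuous hφ.1.continuousOn
  rw [Metric.uniformContinuousOn_iff] at huc
  obtain ⟨r, hr, h⟩ := huc θ hθ
  refine ⟨r / 2, by positivity, fun x y hxy s hs => ?_⟩
  have := h (s, x) ⟨hs, trivial⟩ (s, y) ⟨hs, trivial⟩ (by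
    rw [Prod.dist_eq]; simp; linarith)
  exact this.le

/-- Finite measurable labellings with small fibers. -/
theorem exists_cells_dist [MeasurableSpace M] [BorelSpace M] {ρ : ℝ} (hρ : 0 < ρ) :
    ∃ (k : ℕ) (c : M → Fin k), Measurable c ∧ ∀ x y, c x = c y → dist x y ≤ ρ := by
  obtain ⟨t, ht⟩ := isCompact_univ.elim_finite_subcover (fun x : M => Metric.ball x (ρ/2))
    (fun x => Metric.isOpen_ball) (fun x _ => mem_iUnion.2 ⟨x, Metric.mem_ball_self (by positivity)⟩)
  classical
  let e := t.equivFin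
  have hex : ∀ x : M, ∃ n : ℕ, ∃ h : n < t.card, x ∈ Metric.ball (e.symm ⟨n, h⟩ : M) (ρ/2) := by
    intro x
    have := ht (mem_univ x)
    simp only [mem_iUnion] at this
    obtain ⟨i, hi, hx⟩ := this
    exact ⟨e ⟨i, hi⟩, (e ⟨i, hi⟩).2, by simpa using hx⟩
  refine ⟨t.card, fun x => ⟨Nat.find (hex x), (Nat.find_spec (hex x)).1⟩, ?_, ?_⟩
  · have : Measurable (fun x => Nat.find (hex x)) := by
      refine measurable_find hex ?_
      intro n
      by_cases h : n < t.card
      · have : {x : M | ∃ h : n < t.card, x ∈ Metric.ball (e.symm ⟨n, h⟩ : M) (ρ/2)} =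
          Metric.ball (e.symm ⟨n, h⟩ : M) (ρ/2) := by ext x; simp [h]
        rw [this]; exact Metric.isOpen_ball.measurableSet
      · simp [h]
    refine measurable_to_countable' fun i => ?_
    have h2 := this (measurableSet_singleton (i : ℕ))
    convert h2 using 1
    ext x; simp [Fin.ext_iff]
  · intro x y hxy
    have hxy' : Nat.find (hex x) = Nat.find (hex y) := by simpa using hxy
    obtain ⟨h1, hx⟩ := Nat.find_spec (hex x)
    obtain ⟨h2, hy⟩ := Nat.find_spec (hex y)
    have hc : (e.symm ⟨_, h1⟩ : M) = (e.symm ⟨_, h2⟩ : M) := by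
      congr 3
    rw [Metric.mem_ball] at hx hy
    rw [← hc] at hy
    have := dist_triangle_right x y (e.symm ⟨_, h1⟩ : M)
    linarith

/-- Finite measurable labellings with dynamically small fibers. -/
theorem exists_cells (hφ : IsCtsFlow φ) [MeasurableSpace M] [BorelSpace M] {θ : ℝ} (L : ℝ) (hθ : 0 < θ) :
    ∃ (k : ℕ) (c : M → Fin k), Measurable c ∧ ∀ x y, c x = c y → dclose φ 0 L θ x y := by
  obtain ⟨ρ, hρ, h⟩ := exists_dist_dclose hφ (L := L) hθ
  obtain ⟨k, c, hc, h'⟩ := exists_cells_dist (M := M) hρ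
  exact ⟨k, c, hc, fun x y hxy => h x y (h' x y hxy)⟩

end FlowBasics

section Labels
variable {M : Type*} [MetricSpace M]

/-- `W` can be labelled by `k` labels such that points with the same label are `θ`-close on
the time window. -/
def Lab (φ : ℝ → M → M) (θ : ℝ) (W : Set M) (a b : ℝ) (k : ℕ) : Prop :=
  ∃ c : M → Fin k, ∀ y ∈ W, ∀ y' ∈ W, c y = c y' → dclose φ a b θ y y'

theorem Lab.glue {φ : ℝ → M → M} {θ : ℝ} {W : Set M} {a b c : ℝ} {k l : ℕ}
    (h1 : Lab φ θ W a b k) (h2 : Lab φ θ W b c l) : Lab φ θ W a c (k * l) := by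
  obtain ⟨f, hf⟩ := h1
  obtain ⟨g, hg⟩ := h2
  refine ⟨fun y => finProdFinEquiv (f y, g y), fun y hy y' hy' h => ?_⟩
  have := finProdFinEquiv.injective h
  rw [Prod.mk.injEq] at this
  exact (hf y hy y' hy' this.1).glue (hg y hy y' hy' this.2)

theorem Lab.mono {φ : ℝ → M → M} {θ : ℝ} {W W' : Set M} {a b a' b' : ℝ} {k : ℕ}
    (h1 : Lab φ θ W a b k) (hW : W' ⊆ W) (ha : a ≤ a') (hb : b' ≤ b) : Lab φ θ W' a' b' k := by
  obtain ⟨f, hf⟩ := h1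
  exact ⟨f, fun y hy y' hy' h => (hf y (hW hy) y' (hW hy') h).mono ha hb le_rfl⟩

theorem Lab.mono_card {φ : ℝ → M → M} {θ : ℝ} {W : Set M} {a b : ℝ} {k l : ℕ}
    (h1 : Lab φ θ W a b k) (hkl : k ≤ l) : Lab φ θ W a b l := by
  obtain ⟨f, hf⟩ := h1
  exact ⟨fun y => Fin.castLE hkl (f y), fun y hy y' hy' h =>
    hf y hy y' hy' (Fin.castLE_injective hkl h)⟩

/-- separated sets on a window -/
def Sep (φ : ℝ → M → M) (a b θ : ℝ) (E : Finset M) : Prop :=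
  ∀ x ∈ E, ∀ y ∈ E, dclose φ a b θ x y → x = y

theorem Sep.subset {φ : ℝ → M → M} {a b θ : ℝ} {E F : Finset M} (h : Sep φ a b θ E) (hF : F ⊆ E) :
    Sep φ a b θ F := fun x hx y hy hxy => h x (hF hx) y (hF hy) hxy

theorem Sep.mono {φ : ℝ → M → M} {a b a' b' θ θ' : ℝ} {E : Finset M} (h : Sep φ a b θ E)
    (ha : a' ≤ a) (hb : b ≤ b') (hθ : θ' ≤ θ) : Sep φ a' b' θ' E :=
  fun x hx y hy hxy => h x hx y hy (hxy.mono ha hb hθ)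

theorem sep_iff {φ : ℝ → M → M} {t θ : ℝ} {E : Finset M} :
    Sep φ 0 t θ E ↔ IsSeparated φ θ t E := by
  constructor
  · intro h x hx y hy hxy
    by_contra hc
    push Not at hc
    exact hxy (h x hx y hy hc)
  · intro h x hx y hy hxy
    by_contra hc
    obtain ⟨s, hs, h1⟩ := h x hx y hy hc
    exact absurd (hxy s hs) (not_le.2 h1)

theorem Lab.card_le {φ : ℝ → M → M} {θ : ℝ} {W : Set M} {a b : ℝ} {k : ℕ}
    (h1 : Lab φ θ W a b k) {E : Finset M} (hE : Sep φ a b θ E) (hW : (E : Set M) ⊆ W) :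
    E.card ≤ k := by
  obtain ⟨f, hf⟩ := h1
  have := Finset.card_le_card_of_injOn f (s := E) (t := Finset.univ) (fun _ _ => Finset.mem_univ _)
    (fun x hx y hy hxy => hE x hx y hy (hf x (hW hx) y (hW hy) hxy))
  simpa using this

/-- Greedy selection of a separated subset, with weights. -/
theorem greedy {α : Type*} (R : α → α → Prop) (hsymm : ∀ x y, R x y → R y x)
    (hrefl : ∀ x, R x x) (w : α → ℝ) (X : Finset α) :
    ∃ E ⊆ X, (∀ x ∈ E, ∀ y ∈ E, R x y → x = y) ∧
      ∃ r : α → α, ∀ x ∈ X, r x ∈ E ∧ R x (r x) ∧ w x ≤ w (r x) := by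
  classical
  induction X using Finset.strongInduction with
  | H X ih =>
    rcases X.eq_empty_or_nonempty with rfl | hne
    · exact ⟨∅, by simp, by simp, id, by simp⟩
    obtain ⟨m, hm, hmax⟩ := X.exists_max_image w hne
    obtain ⟨E, hE, hsep, r, hr⟩ := ih (X.filter (fun x => ¬ R x m))
      (Finset.filter_ssubset.2 ⟨m, hm, by simpa using hrefl m⟩)
    refine ⟨insert m E, ?_, ?_, fun x => if R x m then m else r x, ?_⟩
    · intro x hx
      rcases Finset.mem_insert.1 hx with rfl | hx
      · exact hm
      · exact (Finset.mem_filter.1 (hE hx)).1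
    · intro x hx y hy hxy
      rcases Finset.mem_insert.1 hx with h | h <;> rcases Finset.mem_insert.1 hy with h' | h'
      · rw [h, h']
      · rw [h] at hxy
        exact absurd (hsymm _ _ hxy) (Finset.mem_filter.1 (hE h')).2
      · rw [h'] at hxy
        exact absurd hxy (Finset.mem_filter.1 (hE h)).2
      · exact hsep x h y h' hxy
    · intro x hx
      by_cases h : R x m
      · simp only [h, if_true]
        exact ⟨Finset.mem_insert_self _ _, trivial, hmax x hx⟩
      · simp only [h, if_false]
        obtain ⟨h1, h2, h3⟩ := hr x (Finset.mem_filter.2 ⟨hx, h⟩)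
        exact ⟨Finset.mem_insert_of_mem h1, h2, h3⟩

variable {φ : ℝ → M → M} [CompactSpace M]

/-- exponential bound for the number of labels of the whole space -/
theorem exists_lab_pow (hφ : IsCtsFlow φ) {θ : ℝ} (hθ : 0 < θ) :
    ∃ k : ℕ, 1 ≤ k ∧ ∀ (n : ℕ) (a : ℝ), Lab φ θ univ a (a + n) (k ^ (n + 1)) := by
  letI : MeasurableSpace M := borel M
  haveI : BorelSpace M := ⟨rfl⟩
  obtain ⟨k, c, -, h⟩ := exists_cells hφ 1 hθ
  have h1 : ∀ a : ℝ, Lab φ θ univ a (a + 1) (k + 1) := fun a =>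
    Lab.mono_card ⟨fun y => c (φ a y), fun y _ y' _ hc => by
      have := (dclose_shift hφ).1 (h _ _ hc)
      exact this.mono (by linarith) (by linarith) le_rfl⟩ (Nat.le_succ k)
  refine ⟨k + 1, by omega, fun n a => ?_⟩
  induction n with
  | zero => simpa using (h1 a).mono subset_rfl le_rfl (by linarith)
  | succ n ih =>
    have := ih.glue (h1 (a + n))
    rw [← pow_succ] at this
    refine this.mono subset_rfl le_rfl (by push_cast; linarith)

end Labels

section Birkhoff
variable {M : Type*} [MetricSpace M] [CompactSpace M] {φ : ℝ → M → M}
  {pot : M → ℝ}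

theorem birkhoff_integrable (hφ : IsCtsFlow φ) (hpot : Continuous pot) (x : M) (a b : ℝ) :
    IntervalIntegrable (fun s => pot (φ s x)) volume a b :=
  (hpot.comp (flow_cont_left hφ x)).intervalIntegrable a b

theorem birkhoff_add (hφ : IsCtsFlow φ) (hpot : Continuous pot) (x : M) (a b : ℝ) :
    birkhoff φ pot x (a + b) = birkhoff φ pot x a + birkhoff φ pot (φ a x) b := by
  unfold birkhoff
  rw [← intervalIntegral.integral_add_adjacent_intervals (birkhoff_integrable hφ hpot x 0 a)
    (birkhoff_integrable hφ hpot x a (a+b))]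
  congr 1
  have : ∀ s, φ s (φ a x) = φ (s + a) x := fun s => (flow_add hφ s a x).symm
  simp only [this]
  rw [intervalIntegral.integral_comp_add_right (fun s => pot (φ s x))]
  simp [add_comm]

theorem birkhoff_zero (x : M) : birkhoff φ pot x 0 = 0 := by simp [birkhoff]

theorem exists_pot_bound (hpot : Continuous pot) : ∃ B > 0, ∀ x, |pot x| ≤ B := by
  obtain ⟨B, hB⟩ := isCompact_univ.exists_bound_of_continuousOn hpot.continuousOn
  exact ⟨max B 1, by positivity, fun x => (hB x trivial).trans (le_max_left _ _)⟩

theorem birkhoff_bound {B : ℝ} (hB : ∀ x, |pot x| ≤ B) (x : M) (t : ℝ) :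
    |birkhoff φ pot x t| ≤ B * |t| := by
  have := intervalIntegral.norm_integral_le_of_norm_le_const (a := 0) (b := t)
    (f := fun s => pot (φ s x)) (C := B) (fun s _ => by simpa using hB _)
  simpa [birkhoff] using this

theorem birkhoff_sub (hφ : IsCtsFlow φ) (hpot : Continuous pot) (x y : M) (t : ℝ) :
    birkhoff φ pot x t - birkhoff φ pot y t = ∫ s in (0:ℝ)..t, (pot (φ s x) - pot (φ s y)) := by
  rw [intervalIntegral.integral_sub (birkhoff_integrable hφ hpot x 0 t)
    (birkhoff_integrable hφ hpot y 0 t)]; rfl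

theorem birkhoff_close (hφ : IsCtsFlow φ) (hpot : Continuous pot) {η θ : ℝ} (hη : ∀ x y : M, dist x y ≤ θ → |pot x - pot y| ≤ η) {x y : M}
    {t : ℝ} (ht : 0 ≤ t) (h : dclose φ 0 t θ x y) :
    |birkhoff φ pot x t - birkhoff φ pot y t| ≤ η * t := by
  rw [birkhoff_sub hφ hpot]
  have := intervalIntegral.norm_integral_le_of_norm_le_const (a := 0) (b := t)
    (f := fun s => pot (φ s x) - pot (φ s y)) (C := η) (fun s hs => by
      rw [uIoc_of_le ht] at hs
      exact hη _ _ (h s ⟨hs.1.le, hs.2⟩))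
  simpa [abs_of_nonneg ht] using this

theorem exists_pot_mod (hpot : Continuous pot) {η : ℝ} (hη : 0 < η) :
    ∃ θ > 0, ∀ x y : M, dist x y ≤ θ → |pot x - pot y| ≤ η := by
  have := CompactSpace.uniformContinuous_of_continuous hpot
  rw [Metric.uniformContinuous_iff] at this
  obtain ⟨r, hr, h⟩ := this η hη
  exact ⟨r / 2, by positivity, fun x y hxy => (h (by linarith)).le⟩

theorem birkhoff_continuous (hφ : IsCtsFlow φ) (hpot : Continuous pot) (t : ℝ) : Continuous (fun x => birkhoff φ pot x t) := by
  unfold birkhoff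
  refine intervalIntegral.continuous_parametric_intervalIntegral_of_continuous' ?_ 0 t
  exact hpot.comp (hφ.1.comp continuous_swap)

end Birkhoff

end CT


set_option linter.all false

namespace CT

section Entropy

theorem negMulLog_le {x y : ℝ} (hx : 0 ≤ x) (hy : 0 ≤ y) (h : y = 0 → x = 0) :
    Real.negMulLog x ≤ -x * Real.log y + y - x := by
  rcases hx.eq_or_lt with rfl | hx
  · simpa using hy
  have hy : 0 < y := lt_of_le_of_ne hy (fun h' => hx.ne' (h h'.symm))
  have h1 : Real.log (y / x) ≤ y / x - 1 := Real.log_le_sub_one_of_pos (by positivity)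
  rw [Real.log_div hy.ne' hx.ne'] at h1
  have h2 := mul_le_mul_of_nonneg_left h1 hx.le
  have h3 : x * (y / x - 1) = y - x := by field_simp
  rw [h3] at h2
  rw [Real.negMulLog]; linarith

/-- Gibbs inequality. -/
theorem gibbs {ι : Type*} [Fintype ι] (p q : ι → ℝ) (hp : ∀ i, 0 ≤ p i) (hq : ∀ i, 0 ≤ q i)
    (h0 : ∀ i, q i = 0 → p i = 0) (hs : ∑ i, q i ≤ ∑ i, p i) :
    ∑ i, Real.negMulLog (p i) ≤ ∑ i, -p i * Real.log (q i) := by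
  have := Finset.sum_le_sum (fun i (_ : i ∈ Finset.univ) => negMulLog_le (hp i) (hq i) (h0 i))
  rw [Finset.sum_sub_distrib, Finset.sum_add_distrib] at this
  linarith

variable {M : Type*} [MeasurableSpace M]

/-- measurable fibers -/
def Lm {ι : Type*} (f : M → ι) : Prop := ∀ i, MeasurableSet (f ⁻¹' {i})

/-- entropy of a labelling -/
noncomputable def Hm {ι : Type*} [Fintype ι] (μ : Measure M) (f : M → ι) : ℝ :=
  ∑ i, Real.negMulLog (μ.real (f ⁻¹' {i}))

theorem Lm.meas {ι : Type*} [Finite ι] {f : M → ι} (hf : Lm f) (A : Set ι) :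
    MeasurableSet (f ⁻¹' A) := by
  have : f ⁻¹' A = ⋃ i ∈ A, f ⁻¹' {i} := by ext; simp
  rw [this]
  exact MeasurableSet.biUnion (Set.to_countable A) fun i _ => hf i

theorem Lm.comp_left {ι κ : Type*} [Finite ι] {f : M → ι} (hf : Lm f) (h : ι → κ) :
    Lm (fun x => h (f x)) := fun i => hf.meas (h ⁻¹' {i})

theorem Lm.comp_right {ι : Type*} {f : M → ι} (hf : Lm f) {T : M → M} (hT : Measurable T) :
    Lm (fun x => f (T x)) := fun i => hT (hf i)

theorem Lm.pair {ι κ : Type*} {f : M → ι} {g : M → κ} (hf : Lm f) (hg : Lm g) :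
    Lm (fun x => (f x, g x)) := fun i => by
  have : (fun x => (f x, g x)) ⁻¹' {i} = f ⁻¹' {i.1} ∩ g ⁻¹' {i.2} := by
    ext x; simp [Prod.ext_iff]
  rw [this]; exact (hf _).inter (hg _)

theorem Lm.pi {ι : Type*} {n : ℕ} {f : Fin n → M → ι} (hf : ∀ i, Lm (f i)) :
    Lm (fun x i => f i x) := fun v => by
  have : (fun x i => f i x) ⁻¹' {v} = ⋂ i, f i ⁻¹' {v i} := by
    ext x; simp [funext_iff]
  rw [this]; exact MeasurableSet.iInter fun i => hf i _

theorem Lm.of_measurable {ι : Type*} [MeasurableSpace ι] [MeasurableSingletonClass ι] {f : M → ι}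
    (hf : Measurable f) : Lm f := fun i => hf (measurableSet_singleton i)

theorem real_fiber_sum {ι κ : Type*} [Fintype ι] [Fintype κ] {μ : Measure M} [IsFiniteMeasure μ]
    {f : M → ι} (hf : Lm f) (A : Set M) (hA : MeasurableSet A) :
    ∑ i, μ.real (f ⁻¹' {i} ∩ A) = μ.real A := by
  rw [← measureReal_iUnion_fintype]
  · congr 1
    ext x; simp
  · intro i j hij
    refine Set.disjoint_left.2 fun x hx hx' => hij ?_
    simp at hx hx'
    rw [← hx.1, ← hx'.1]
  · intro i; exact (hf i).inter hA

theorem real_fiber_sum' {ι κ : Type*} [Fintype ι] {μ : Measure M} [IsFiniteMeasure μ]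
    {f : M → ι} {g : M → κ} (hf : Lm f) (hg : Lm g) (j : κ) :
    ∑ i, μ.real ((fun x => (f x, g x)) ⁻¹' {(i, j)}) = μ.real (g ⁻¹' {j}) := by
  rw [← real_fiber_sum (κ := ι) hf _ (hg j)]
  refine Finset.sum_congr rfl fun i _ => ?_
  congr 1
  ext x; simp

theorem real_fiber_total {ι : Type*} [Fintype ι] {μ : Measure M} [IsFiniteMeasure μ]
    {f : M → ι} (hf : Lm f) : ∑ i, μ.real (f ⁻¹' {i}) = μ.real univ := by
  rw [← real_fiber_sum (κ := ι) hf _ MeasurableSet.univ]; simp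

theorem Hm_nonneg {ι : Type*} [Fintype ι] {μ : Measure M} [IsProbabilityMeasure μ] (f : M → ι) :
    0 ≤ Hm μ f :=
  Finset.sum_nonneg fun i _ => Real.negMulLog_nonneg measureReal_nonneg measureReal_le_one

/-- injective relabelling -/
theorem Hm_inj {ι κ : Type*} [Fintype ι] [Fintype κ] {μ : Measure M} (f : M → ι) {e : ι → κ}
    (he : Function.Injective e) : Hm μ (fun x => e (f x)) = Hm μ f := by
  unfold Hm
  symm
  refine Finset.sum_of_injOn e he.injOn (by simp) ?_ ?_
  · intro j _ hj
    have : (fun x => e (f x)) ⁻¹' {j} = ∅ := by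
      ext x; simp; rintro rfl; exact hj (by simp)
    rw [this]; simp
  · intro i _
    congr 2
    ext x; simp [he.eq_iff]

/-- conditional counting bound -/
theorem Hm_count {ι κ : Type*} [Fintype ι] [Fintype κ] {μ : Measure M} [IsProbabilityMeasure μ]
    {f : M → ι} {g : M → κ} (hf : Lm f) (hg : Lm g) {N : ℕ} (hN : 1 ≤ N)
    (h : ∀ j, ∃ c : M → Fin N, ∀ x y, g x = j → g y = j → c x = c y → f x = f y) :
    Hm μ (fun x => (f x, g x)) ≤ Hm μ g + Real.log N := by
  classical
  let p : ι × κ → ℝ := fun a => μ.real ((fun x => (f x, g x)) ⁻¹' {a})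
  let r : κ → ℝ := fun j => μ.real (g ⁻¹' {j})
  let q : ι × κ → ℝ := fun a => if (∃ x, f x = a.1 ∧ g x = a.2) then r a.2 / N else 0
  have hN' : (0:ℝ) < N := by exact_mod_cast hN
  have hr : ∀ j, 0 ≤ r j := fun j => measureReal_nonneg
  have hpr : ∀ a, p a ≤ r a.2 := fun a => measureReal_mono (by intro x; simp +contextual [Prod.ext_iff])
  have hp : ∀ a, 0 ≤ p a := fun a => measureReal_nonneg
  have hne : ∀ a, ¬ (∃ x, f x = a.1 ∧ g x = a.2) → p a = 0 := by
    intro a ha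
    have : (fun x => (f x, g x)) ⁻¹' {a} = ∅ := by
      ext x; simp; intro h; exact ha ⟨x, by rw [← h], by rw [← h]⟩
    simp [p, this]
  have h0 : ∀ a, q a = 0 → p a = 0 := by
    intro a ha
    by_cases hx : ∃ x, f x = a.1 ∧ g x = a.2
    · simp only [q, hx, if_true] at ha
      have : r a.2 = 0 := by
        rcases div_eq_zero_iff.1 ha with h | h
        · exact h
        · exact absurd h hN'.ne'
      exact le_antisymm (this ▸ hpr a) (hp a)
    · exact hne a hx
  have hsp : ∑ a, p a = 1 := by
    rw [real_fiber_total (hf.pair hg)]; simp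
  have hsr : ∑ j, r j = 1 := by rw [real_fiber_total hg]; simp
  have hsq : ∑ a, q a ≤ 1 := by
    rw [Fintype.sum_prod_type_right, ← hsr]
    refine Finset.sum_le_sum fun j _ => ?_
    simp only [q]
    rw [← Finset.sum_filter, Finset.sum_const, nsmul_eq_mul]
    have hc : ((Finset.univ.filter fun i => ∃ x, f x = i ∧ g x = j).card : ℝ) ≤ N := by
      obtain ⟨c, hc⟩ := h j
      have h2 : ∀ i ∈ (Finset.univ.filter fun i => ∃ x, f x = i ∧ g x = j), ∃ x, f x = i ∧ g x = j := by
        intro i hi; simpa using hi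
      have : Nonempty M := nonempty_of_isProbabilityMeasure μ
      choose! s hs using h2
      have := Finset.card_le_card_of_injOn (fun i => c (s i)) (s := (Finset.univ.filter fun i => ∃ x, f x = i ∧ g x = j)) (t := Finset.univ) (fun _ _ => Finset.mem_univ _)
        (fun i hi i' hi' hii => by
          rw [← (hs i hi).1, ← (hs i' hi').1]
          exact hc _ _ (hs i hi).2 (hs i' hi').2 hii)
      exact_mod_cast (by simpa using this)
    calc _ ≤ (N : ℝ) * (r j / N) := mul_le_mul_of_nonneg_right hc (div_nonneg (hr j) hN'.le)
      _ = r j := by field_simp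
  have key := gibbs p q hp (fun a => by simp only [q]; split_ifs; exact div_nonneg (hr _) hN'.le; exact le_rfl) h0 (hsq.trans hsp.ge)
  have e1 : ∀ a, -p a * Real.log (q a) = -p a * Real.log (r a.2) + p a * Real.log N := by
    intro a
    by_cases hpa : p a = 0
    · simp [hpa]
    have hx : ∃ x, f x = a.1 ∧ g x = a.2 := by by_contra hx; exact hpa (hne a hx)
    simp only [q, hx, if_true]
    have : r a.2 ≠ 0 := fun h => hpa (le_antisymm (h ▸ hpr a) (hp a))
    rw [Real.log_div this hN'.ne']; ring
  simp only [e1] at key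
  rw [Finset.sum_add_distrib, ← Finset.sum_mul, hsp, one_mul] at key
  rw [Fintype.sum_prod_type_right (f := fun a : ι × κ => -p a * Real.log (r a.2))] at key
  refine key.trans (add_le_add_left (Finset.sum_le_sum fun j _ => ?_) _)
  simp only
  rw [← Finset.sum_mul, Finset.sum_neg_distrib]
  have : ∑ i, p (i, j) = r j := real_fiber_sum' hf hg j
  rw [this, Real.negMulLog]

/-- submodularity -/
theorem Hm_submod {ι κ l : Type*} [Fintype ι] [Fintype κ] [Fintype l] {μ : Measure M}
    [IsProbabilityMeasure μ] {f : M → ι} {g : M → κ} {k : M → l} (hf : Lm f) (hg : Lm g)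
    (hk : Lm k) :
    Hm μ (fun x => (f x, g x, k x)) + Hm μ k ≤ Hm μ (fun x => (f x, k x)) + Hm μ (fun x => (g x, k x)) := by
  let p : ι × κ × l → ℝ := fun a => μ.real ((fun x => (f x, g x, k x)) ⁻¹' {a})
  let pf : ι × l → ℝ := fun a => μ.real ((fun x => (f x, k x)) ⁻¹' {a})
  let pg : κ × l → ℝ := fun a => μ.real ((fun x => (g x, k x)) ⁻¹' {a})
  let r : l → ℝ := fun a => μ.real (k ⁻¹' {a})
  let q : ι × κ × l → ℝ := fun a => pf (a.1, a.2.2) * pg (a.2.1, a.2.2) / r a.2.2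
  have hp : ∀ a, 0 ≤ p a := fun a => measureReal_nonneg
  have hpf : ∀ a, 0 ≤ pf a := fun a => measureReal_nonneg
  have hpg : ∀ a, 0 ≤ pg a := fun a => measureReal_nonneg
  have hr : ∀ a, 0 ≤ r a := fun a => measureReal_nonneg
  have h1 : ∀ a, p a ≤ pf (a.1, a.2.2) := fun a => measureReal_mono (by
    intro x; simp +contextual [Prod.ext_iff])
  have h2 : ∀ a, p a ≤ pg (a.2.1, a.2.2) := fun a => measureReal_mono (by
    intro x; simp +contextual [Prod.ext_iff])
  have h3 : ∀ a, p a ≤ r a.2.2 := fun a => measureReal_mono (by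
    intro x; simp +contextual [Prod.ext_iff])
  have sp : ∑ a, p a = 1 := by rw [real_fiber_total (hf.pair (hg.pair hk))]; simp
  have sr : ∑ a, r a = 1 := by rw [real_fiber_total hk]; simp
  have sf : ∀ c, ∑ a, pf (a, c) = r c := real_fiber_sum' hf hk
  have sg : ∀ c, ∑ a, pg (a, c) = r c := real_fiber_sum' hg hk
  have spf : ∀ a c, ∑ b, p (a, b, c) = pf (a, c) := by
    intro a c
    have := real_fiber_sum' (μ := μ) hg (hf.pair hk) (a, c)
    rw [show pf (a, c) = _ from this.symm]
    refine Finset.sum_congr rfl fun b _ => ?_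
    simp only [p]; congr 1; ext x; simp; tauto
  have spg : ∀ b c, ∑ a, p (a, b, c) = pg (b, c) := by
    intro b c
    exact real_fiber_sum' (μ := μ) hf (hg.pair hk) (b, c)
  have sq : ∑ a, q a ≤ ∑ a, p a := by
    rw [sp, ← sr]
    have : ∑ a, q a = ∑ c, ∑ a, ∑ b, q (a, b, c) := by
      rw [Fintype.sum_prod_type]
      simp_rw [Fintype.sum_prod_type_right]
      rw [Finset.sum_comm]
    rw [this]
    refine Finset.sum_le_sum fun c _ => ?_
    simp only [q]
    simp_rw [← Finset.sum_div, ← Finset.mul_sum, ← Finset.sum_mul, sg, sf]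
    by_cases h : r c = 0
    · simp [h]
    · exact le_of_eq (by field_simp)
  have hq0 : ∀ a, q a = 0 → p a = 0 := by
    intro a ha
    by_contra hpa
    have hpa : 0 < p a := lt_of_le_of_ne (hp a) (Ne.symm hpa)
    have : 0 < q a := div_pos (mul_pos (hpa.trans_le (h1 a)) (hpa.trans_le (h2 a))) (hpa.trans_le (h3 a))
    exact this.ne' ha
  have key := gibbs p q hp (fun a => div_nonneg (mul_nonneg (hpf _) (hpg _)) (hr _)) hq0 sq
  have e1 : ∀ a, -p a * Real.log (q a) = -p a * Real.log (pf (a.1, a.2.2)) +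
      -p a * Real.log (pg (a.2.1, a.2.2)) - -p a * Real.log (r a.2.2) := by
    intro a
    rcases (hp a).eq_or_lt with hpa | hpa
    · simp [← hpa]
    simp only [q]
    rw [Real.log_div (mul_pos (hpa.trans_le (h1 a)) (hpa.trans_le (h2 a))).ne' (hpa.trans_le (h3 a)).ne',
      Real.log_mul (hpa.trans_le (h1 a)).ne' (hpa.trans_le (h2 a)).ne']
    ring
  simp only [e1] at key
  rw [Finset.sum_sub_distrib, Finset.sum_add_distrib] at key
  have E1 : ∑ a, -p a * Real.log (pf (a.1, a.2.2)) = Hm μ (fun x => (f x, k x)) := by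
    unfold Hm
    rw [Fintype.sum_prod_type, Fintype.sum_prod_type]
    refine Finset.sum_congr rfl fun a _ => ?_
    rw [Fintype.sum_prod_type_right]
    refine Finset.sum_congr rfl fun c _ => ?_
    simp only
    rw [← Finset.sum_mul, Finset.sum_neg_distrib, spf, Real.negMulLog]
  have E2 : ∑ a, -p a * Real.log (pg (a.2.1, a.2.2)) = Hm μ (fun x => (g x, k x)) := by
    unfold Hm
    rw [Fintype.sum_prod_type_right]
    refine Finset.sum_congr rfl fun b _ => ?_
    simp only
    rw [← Finset.sum_mul, Finset.sum_neg_distrib, spg, Real.negMulLog]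
  have E3 : ∑ a, -p a * Real.log (r a.2.2) = Hm μ k := by
    unfold Hm
    rw [Fintype.sum_prod_type_right, Fintype.sum_prod_type_right]
    refine Finset.sum_congr rfl fun c _ => ?_
    simp only
    simp_rw [← Finset.sum_mul, Finset.sum_neg_distrib, spg, sg]
    rw [Real.negMulLog]
  rw [E1, E2, E3] at key
  have : Hm μ (fun x => (f x, g x, k x)) = ∑ a, Real.negMulLog (p a) := rfl
  linarith

theorem Hm_unit {μ : Measure M} [IsProbabilityMeasure μ] : Hm μ (fun _ : M => ()) = 0 := by
  simp [Hm]

theorem Hm_pair_le {ι κ : Type*} [Fintype ι] [Fintype κ] {μ : Measure M}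
    [IsProbabilityMeasure μ] {f : M → ι} {g : M → κ} (hf : Lm f) (hg : Lm g) :
    Hm μ (fun x => (f x, g x)) ≤ Hm μ f + Hm μ g := by
  have := Hm_submod (μ := μ) (k := fun _ => ()) hf hg (fun i => by simp)
  rw [Hm_unit, add_zero] at this
  rw [Hm_inj (fun x => (f x)) (e := fun a => (a, ())) (fun a b h => by simpa using h),
    Hm_inj (fun x => (g x)) (e := fun a => (a, ())) (fun a b h => by simpa using h),
    Hm_inj (fun x => (f x, g x)) (e := fun a => (a.1, a.2, ())) (fun a b h => by
      simpa [Prod.ext_iff] using h)] at this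
  exact this

theorem Hm_le_pair {ι κ : Type*} [Fintype ι] [Fintype κ] {μ : Measure M}
    [IsProbabilityMeasure μ] {f : M → ι} {g : M → κ} (hf : Lm f) (hg : Lm g) :
    Hm μ g ≤ Hm μ (fun x => (f x, g x)) := by
  unfold Hm
  rw [Fintype.sum_prod_type_right]
  refine Finset.sum_le_sum fun j _ => ?_
  rw [← real_fiber_sum' hf hg j]
  simp only [Real.negMulLog]
  rw [← Finset.sum_neg_distrib, Finset.sum_mul]
  refine Finset.sum_le_sum fun i _ => ?_
  set p := fun i => μ.real ((fun x => (f x, g x)) ⁻¹' {(i, j)}) with hpd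
  change -p i * Real.log (∑ i, p i) ≤ -p i * Real.log (p i)
  rcases (measureReal_nonneg : 0 ≤ p i).eq_or_lt with h | h
  · rw [show p i = 0 from h.symm]; simp
  · have : Real.log (p i) ≤ Real.log (∑ i, p i) := Real.log_le_log h
      (Finset.single_le_sum (f := p) (fun i _ => measureReal_nonneg) (Finset.mem_univ i))
    nlinarith

theorem Hm_comp_le {ι κ : Type*} [Fintype ι] [Fintype κ] {μ : Measure M}
    [IsProbabilityMeasure μ] {g : M → κ} (hg : Lm g) (h : κ → ι) :
    Hm μ (fun x => h (g x)) ≤ Hm μ g := by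
  have h1 := Hm_le_pair (μ := μ) (f := g) (g := fun x => h (g x)) hg (hg.comp_left h)
  rwa [Hm_inj g (e := fun a => (a, h a)) (fun a b h => by simp at h; exact h.1)] at h1

theorem Hm_det_le {ι κ : Type*} [Fintype ι] [Fintype κ] {μ : Measure M}
    [IsProbabilityMeasure μ] {f : M → ι} {g : M → κ} (hg : Lm g)
    (h : ∀ x y, g x = g y → f x = f y) : Hm μ f ≤ Hm μ g := by
  have : Nonempty M := nonempty_of_isProbabilityMeasure μ
  have : Nonempty ι := this.map f
  obtain ⟨e, rfl⟩ := (Function.factorsThrough_iff f).1 (show f.FactorsThrough g from fun x y hxy => h x y hxy)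
  exact Hm_comp_le hg e

theorem Hm_le_log {ι : Type*} [Fintype ι] {μ : Measure M}
    [IsProbabilityMeasure μ] {f : M → ι} (hf : Lm f) : Hm μ f ≤ Real.log (Fintype.card ι) := by
  have : Nonempty M := nonempty_of_isProbabilityMeasure μ
  have : Nonempty ι := this.map f
  have h := Hm_count (μ := μ) (N := Fintype.card ι) (f := f) (g := fun _ => ()) hf (fun i => by simp)
    (Fintype.card_pos) (fun j => ⟨fun x => Fintype.equivFin ι (f x), fun x y _ _ h => by simpa using h⟩)
  rw [Hm_unit, zero_add, Hm_inj f (e := fun a => (a, ())) (fun a b h => by simpa using h)] at h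
  exact h

theorem Hm_map {ι : Type*} [Fintype ι] {μ : Measure M} {f : M → ι} (hf : Lm f) {T : M → M}
    (hT : Measurable T) : Hm (μ.map T) f = Hm μ (fun x => f (T x)) := by
  unfold Hm
  refine Finset.sum_congr rfl fun i _ => ?_
  rw [map_measureReal_apply hT (hf i)]; rfl

theorem negMulLog_add_le {x y : ℝ} (hx : 0 ≤ x) (hy : 0 ≤ y) :
    Real.negMulLog (x + y) ≤ Real.negMulLog x + Real.negMulLog y := by
  rcases hx.eq_or_lt with rfl | hx
  · simp
  rcases hy.eq_or_lt with rfl | hy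
  · simp
  have h1 : Real.log x ≤ Real.log (x + y) := Real.log_le_log hx (by linarith)
  have h2 : Real.log y ≤ Real.log (x + y) := Real.log_le_log hy (by linarith)
  simp only [Real.negMulLog]
  nlinarith

/-- entropy with respect to a mixture -/
theorem Hm_mix {ι : Type*} [Fintype ι] {μ κ l : Measure M} [IsProbabilityMeasure κ]
    [IsProbabilityMeasure l] {f : M → ι} (hf : Lm f)
    {a : ℝ} (ha : a ∈ Icc (0:ℝ) 1)
    (h : ∀ A, MeasurableSet A → μ.real A = a * κ.real A + (1 - a) * l.real A) :
    Hm μ f ≤ a * Hm κ f + (1 - a) * Hm l f + 2 := by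
  unfold Hm
  have hb : ∀ b ∈ Icc (0:ℝ) 1, Real.negMulLog b ≤ 1 := by
    intro b hb
    have := negMulLog_le hb.1 zero_le_one (by simp)
    simp at this; linarith [hb.1]
  have : ∀ i, Real.negMulLog (μ.real (f ⁻¹' {i})) ≤ a * Real.negMulLog (κ.real (f ⁻¹' {i})) +
     (1 - a) * Real.negMulLog (l.real (f ⁻¹' {i})) + (κ.real (f ⁻¹' {i}) * 1 + l.real (f ⁻¹' {i}) * 1) := by
    intro i
    rw [h _ (hf i)]
    refine (negMulLog_add_le (mul_nonneg ha.1 measureReal_nonneg) (mul_nonneg (by linarith [ha.2]) measureReal_nonneg)).trans ?_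
    rw [Real.negMulLog_mul, Real.negMulLog_mul]
    have h1 := mul_le_mul_of_nonneg_left (hb a ha) (measureReal_nonneg (μ := κ) (s := f ⁻¹' {i}))
    have h2 := mul_le_mul_of_nonneg_left (hb (1 - a) ⟨by linarith [ha.2], by linarith [ha.1]⟩) (measureReal_nonneg (μ := l) (s := f ⁻¹' {i}))
    linarith
  refine (Finset.sum_le_sum fun i _ => this i).trans ?_
  rw [Finset.sum_add_distrib, Finset.sum_add_distrib, Finset.sum_add_distrib, ← Finset.mul_sum, ← Finset.mul_sum,
    ← Finset.sum_mul, ← Finset.sum_mul, real_fiber_total hf, real_fiber_total hf]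
  simp; linarith

end Entropy
end CT


set_option linter.all false

namespace CT

section DynEntropy
variable {M : Type*}

/-- itinerary of length `n` -/
def itin {ι : Type*} (T : M → M) (f : M → ι) (n : ℕ) : M → (Fin n → ι) :=
  fun x i => f (T^[i] x)

theorem itin_eq_iff {ι : Type*} {T : M → M} {f : M → ι} {n : ℕ} {x y : M} :
    itin T f n x = itin T f n y ↔ ∀ i < n, f (T^[i] x) = f (T^[i] y) := by
  constructor
  · intro h i hi
    exact congrFun h ⟨i, hi⟩
  · intro h; funext i; exact h i i.2

variable [MeasurableSpace M]

theorem Lm.itin {ι : Type*} {T : M → M} (hT : Measurable T) {f : M → ι} (hf : Lm f) (n : ℕ) :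
    Lm (itin T f n) :=
  Lm.pi fun i => hf.comp_right (hT.iterate i)

/-- entropy of `T` with respect to a labelling -/
noncomputable def hT {ι : Type*} [Fintype ι] (μ : Measure M) (T : M → M) (f : M → ι) : ℝ :=
  ⨅ n : ℕ, Hm μ (itin T f (n + 1)) / (n + 1)

theorem hT_bdd {ι : Type*} [Fintype ι] (μ : Measure M) [IsProbabilityMeasure μ] (T : M → M) (f : M → ι) :
    BddBelow (range fun n : ℕ => Hm μ (itin T f (n + 1)) / ((n : ℝ) + 1)) :=
  ⟨0, by rintro _ ⟨n, rfl⟩; exact div_nonneg (Hm_nonneg _) (by positivity)⟩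

theorem hT_nonneg {ι : Type*} [Fintype ι] (μ : Measure M) [IsProbabilityMeasure μ] (T : M → M) (f : M → ι) :
    0 ≤ hT μ T f := le_ciInf fun n => div_nonneg (Hm_nonneg _) (by positivity)

theorem hT_le {ι : Type*} [Fintype ι] (μ : Measure M) [IsProbabilityMeasure μ] (T : M → M) (f : M → ι)
    {n : ℕ} (hn : 1 ≤ n) : n * hT μ T f ≤ Hm μ (itin T f n) := by
  obtain ⟨m, rfl⟩ : ∃ m, n = m + 1 := ⟨n - 1, by omega⟩
  have := ciInf_le (hT_bdd μ T f) m
  have h2 : hT μ T f ≤ Hm μ (itin T f (m + 1)) / (m + 1) := this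
  rw [le_div_iff₀ (by positivity)] at h2
  push_cast; linarith

theorem le_hT {ι : Type*} [Fintype ι] (μ : Measure M) (T : M → M) (f : M → ι)
    {c : ℝ} (h : ∀ n : ℕ, 1 ≤ n → n * c ≤ Hm μ (itin T f n)) : c ≤ hT μ T f := by
  refine le_ciInf fun n => ?_
  rw [le_div_iff₀ (by positivity)]
  have := h (n + 1) (by omega)
  push_cast at this; linarith

theorem Hm_itin_zero {ι : Type*} [Fintype ι] (μ : Measure M) [IsProbabilityMeasure μ] (T : M → M) (f : M → ι) :
    Hm μ (itin T f 0) = 0 := by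
  have : itin T f 0 = fun x => (fun i : Fin 0 => i.elim0) := by funext x i; exact i.elim0
  rw [this, Hm]
  rw [Fintype.sum_eq_single (fun i : Fin 0 => i.elim0)]
  · simp
  · intro v hv; exact absurd (funext fun i => i.elim0) hv

theorem Hm_inv {ι : Type*} [Fintype ι] {μ : Measure M} {T : M → M} (hT : Measurable T)
    (hinv : μ.map T = μ) {f : M → ι} (hf : Lm f) (m : ℕ) :
    Hm μ (fun x => f (T^[m] x)) = Hm μ f := by
  induction m with
  | zero => rfl
  | succ m ih =>
    simp only [Function.iterate_succ_apply]
    rw [← Hm_map (f := fun x => f (T^[m] x)) (hf.comp_right (hT.iterate m)) hT, hinv, ih]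

theorem Hm_itin_add {ι : Type*} [Fintype ι] {μ : Measure M} [IsProbabilityMeasure μ] {T : M → M}
    (hT : Measurable T) (hinv : μ.map T = μ) {f : M → ι} (hf : Lm f) (m n : ℕ) :
    Hm μ (itin T f (m + n)) ≤ Hm μ (itin T f m) + Hm μ (itin T f n) := by
  rw [← Hm_inv hT hinv (hf.itin hT n) m]
  refine le_trans (Hm_det_le (g := fun x => (itin T f m x, itin T f n (T^[m] x)))
    ((hf.itin hT m).pair ((hf.itin hT n).comp_right (hT.iterate m))) ?_) (Hm_pair_le (hf.itin hT m) ((hf.itin hT n).comp_right (hT.iterate m)))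
  intro x y hxy
  rw [Prod.mk.injEq, itin_eq_iff, itin_eq_iff] at hxy
  rw [itin_eq_iff]
  intro i hi
  by_cases h : i < m
  · exact hxy.1 i h
  · have := hxy.2 (i - m) (by omega)
    rw [← Function.iterate_add_apply, ← Function.iterate_add_apply] at this
    rwa [Nat.sub_add_cancel (by omega)] at this

theorem Hm_itin_mul {ι : Type*} [Fintype ι] {μ : Measure M} [IsProbabilityMeasure μ] {T : M → M}
    (hT : Measurable T) (hinv : μ.map T = μ) {f : M → ι} (hf : Lm f) (m n : ℕ) :
    Hm μ (itin T f (n * m)) ≤ n * Hm μ (itin T f m) := by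
  induction n with
  | zero => rw [Nat.zero_mul, Hm_itin_zero]; simp
  | succ n ih =>
    rw [Nat.succ_mul]
    refine (Hm_itin_add hT hinv hf _ _).trans ?_
    push_cast; linarith

theorem Hm_itin_one {ι : Type*} [Fintype ι] {μ : Measure M} {T : M → M} (f : M → ι) :
    Hm μ (itin T f 1) = Hm μ f := by
  have : itin T f 1 = fun x => (fun a => (fun _ : Fin 1 => a)) (f x) := by
    funext x i
    have : i = 0 := Subsingleton.elim _ _
    subst this; rfl
  rw [this, Hm_inj f (e := fun a => (fun _ : Fin 1 => a))]
  intro a b h; exact congrFun h 0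

theorem Hm_itin_le {ι : Type*} [Fintype ι] {μ : Measure M} [IsProbabilityMeasure μ] {T : M → M}
    (hT : Measurable T) (hinv : μ.map T = μ) {f : M → ι} (hf : Lm f) (n : ℕ) :
    Hm μ (itin T f n) ≤ n * Hm μ f := by
  have := Hm_itin_mul hT hinv hf 1 n
  rwa [mul_one, Hm_itin_one] at this

theorem Hm_itin_cond {ι κ : Type*} [Fintype ι] [Fintype κ] {μ : Measure M} [IsProbabilityMeasure μ] {T : M → M}
    (hT : Measurable T) (hinv : μ.map T = μ) {f : M → ι} {g : M → κ} (hf : Lm f) (hg : Lm g) (n : ℕ) :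
    Hm μ (fun x => (itin T f n x, itin T g n x)) ≤ Hm μ (itin T g n) +
      n * (Hm μ (fun x => (f x, g x)) - Hm μ g) := by
  induction n with
  | zero =>
    have := Hm_pair_le (μ := μ) (hf.itin hT 0) (hg.itin hT 0)
    rw [Hm_itin_zero, Hm_itin_zero] at this
    rw [Hm_itin_zero]; simpa using this
  | succ n ih =>
    -- b = f ∘ T^n
    set b := fun x => f (T^[n] x) with hb
    set b' := fun x => g (T^[n] x) with hb'
    have lb : Lm b := hf.comp_right (hT.iterate n)
    have lb' : Lm b' := hg.comp_right (hT.iterate n)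
    have lB := hf.itin hT n
    have lB' := hg.itin hT n
    have s1 := Hm_submod (μ := μ) lb (lB.pair lB') lb'
    have s2 := Hm_submod (μ := μ) lB lb' lB'
    have e1 : Hm μ (fun x => (itin T f (n+1) x, itin T g (n+1) x)) ≤
        Hm μ (fun x => (b x, (itin T f n x, itin T g n x), b' x)) := by
      refine Hm_det_le (lb.pair ((lB.pair lB').pair lb')) ?_
      intro x y h
      simp only [Prod.mk.injEq, itin_eq_iff] at h ⊢
      obtain ⟨h1, ⟨h2, h3⟩, h4⟩ := h
      refine ⟨fun i hi => ?_, fun i hi => ?_⟩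
      · rcases Nat.lt_succ_iff_lt_or_eq.1 hi with h | rfl
        · exact h2 i h
        · exact h1
      · rcases Nat.lt_succ_iff_lt_or_eq.1 hi with h | rfl
        · exact h3 i h
        · exact h4
    have e2 : Hm μ (fun x => (b' x, itin T g n x)) ≤ Hm μ (itin T g (n+1)) := by
      refine Hm_det_le (hg.itin hT (n+1)) ?_
      intro x y h
      rw [itin_eq_iff] at h
      simp only [Prod.mk.injEq, itin_eq_iff]
      exact ⟨h n (by omega), fun i hi => h i (by omega)⟩
    have e3 : Hm μ b' = Hm μ g := Hm_inv hT hinv hg n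
    have e4 : Hm μ (fun x => (b x, b' x)) = Hm μ (fun x => (f x, g x)) :=
      Hm_inv hT hinv (hf.pair hg) n
    have e5 : Hm μ (fun x => ((itin T f n x, itin T g n x), b' x)) ≤ Hm μ (fun x => (itin T f n x, b' x, itin T g n x)) := by
      refine Hm_det_le (lB.pair (lb'.pair lB')) ?_
      intro x y h
      simp only [Prod.mk.injEq] at h ⊢
      tauto
    push_cast
    linarith

theorem hT_cond {ι κ : Type*} [Fintype ι] [Fintype κ] {μ : Measure M} [IsProbabilityMeasure μ] {T : M → M}
    (hTm : Measurable T) (hinv : μ.map T = μ) {f : M → ι} {g : M → κ} (hf : Lm f) (hg : Lm g) :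
    hT μ T f ≤ hT μ T g + (Hm μ (fun x => (f x, g x)) - Hm μ g) := by
  rw [← sub_le_iff_le_add]
  refine le_hT μ T g fun n hn => ?_
  have h1 := hT_le μ T f hn
  have h2 := Hm_itin_cond hTm hinv hf hg n
  have h3 : Hm μ (itin T f n) ≤ Hm μ (fun x => (itin T f n x, itin T g n x)) :=
    Hm_det_le ((hf.itin hTm n).pair (hg.itin hTm n)) (fun x y h => by
      simp only [Prod.mk.injEq] at h; exact h.1)
  linarith

theorem hT_pow {ι : Type*} [Fintype ι] {μ : Measure M} [IsProbabilityMeasure μ] {T : M → M}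
    (hTm : Measurable T) {f : M → ι} (hf : Lm f) {q : ℕ} (hq : 1 ≤ q) :
    q * hT μ T f ≤ hT μ (T^[q]) (itin T f q) := by
  refine le_hT _ _ _ fun n hn => ?_
  have h1 := hT_le μ T f (n := n * q) (Nat.mul_pos hn hq)
  push_cast at h1
  rw [← mul_assoc]
  refine h1.trans (Hm_det_le ((hf.itin hTm q).itin (hTm.iterate q) n) ?_)
  intro x y h
  rw [itin_eq_iff] at h ⊢
  intro i hi
  have h2 := h (i / q) (Nat.div_lt_of_lt_mul (by rwa [mul_comm]))
  rw [itin_eq_iff] at h2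
  have := h2 (i % q) (Nat.mod_lt _ hq)
  rw [← Function.iterate_mul, ← Function.iterate_add_apply, ← Function.iterate_add_apply, Nat.mod_add_div] at this
  exact this

theorem hT_det_le {ι κ : Type*} [Fintype ι] [Fintype κ] {μ : Measure M} [IsProbabilityMeasure μ] {T : M → M}
    (hTm : Measurable T) {f : M → ι} {g : M → κ} (hg : Lm g)
    (h : ∀ x y, g x = g y → f x = f y) : hT μ T f ≤ hT μ T g := by
  refine le_hT _ _ _ fun n hn => (hT_le μ T f hn).trans (Hm_det_le (hg.itin hTm n) ?_)
  intro x y hxy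
  rw [itin_eq_iff] at hxy ⊢
  exact fun i hi => h _ _ (hxy i hi)

/-- compatibility of a finite family of sets with a labelling -/
def Compat {ι : Type*} (Q : Finset (Set M)) (f : M → ι) : Prop :=
  ∀ A : Set M, A.Nonempty → (A ∈ Q ↔ ∃ i, A = f ⁻¹' {i})

theorem Compat.entropy {ι : Type*} [Fintype ι] {Q : Finset (Set M)} {f : M → ι} (h : Compat Q f)
    (μ : Measure M) : partEntropy μ Q = Hm μ f := by
  classical
  unfold partEntropy Hm
  have h1 : ∑ A ∈ Q, -((μ A).toReal * Real.log (μ A).toReal) =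
      ∑ A ∈ Q.filter (fun A => A.Nonempty), Real.negMulLog (μ.real A) := by
    rw [Finset.sum_filter]
    refine Finset.sum_congr rfl fun A _ => ?_
    split_ifs with hA
    · simp [Real.negMulLog, Measure.real]
    · rw [not_nonempty_iff_eq_empty] at hA; simp [hA]
  have h2 : ∑ i, Real.negMulLog (μ.real (f ⁻¹' {i})) =
      ∑ i ∈ Finset.univ.filter (fun i => (f ⁻¹' {i}).Nonempty), Real.negMulLog (μ.real (f ⁻¹' {i})) := by
    rw [Finset.sum_filter]
    refine Finset.sum_congr rfl fun A _ => ?_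
    split_ifs with hA
    · rfl
    · rw [not_nonempty_iff_eq_empty] at hA; simp [hA]
  rw [h1, h2]
  symm
  refine Finset.sum_bij (fun i _ => f ⁻¹' {i}) ?_ ?_ ?_ ?_
  · intro i hi
    simp only [Finset.mem_filter, Finset.mem_univ, true_and] at hi ⊢
    exact ⟨(h _ hi).2 ⟨i, rfl⟩, hi⟩
  · intro i hi j hj hij
    simp only [Finset.mem_filter, Finset.mem_univ, true_and] at hi hj
    obtain ⟨x, hx⟩ := hi
    have hx' := hx
    rw [hij] at hx'
    simp at hx hx'
    rw [← hx, ← hx']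
  · intro A hA
    rw [Finset.mem_filter] at hA
    obtain ⟨i, hi⟩ := (h A hA.2).1 hA.1
    exact ⟨i, by simp [← hi, hA.2], hi.symm⟩
  · intros; rfl

theorem Compat.preimg {ι : Type*} {Q : Finset (Set M)} {f : M → ι} (h : Compat Q f) (T : M → M) :
    Compat (preimgPart T Q) (fun x => f (T x)) := by
  intro A hA
  simp only [preimgPart, Finset.mem_image]
  constructor
  · rintro ⟨B, hB, rfl⟩
    obtain ⟨i, rfl⟩ := (h B (by obtain ⟨x, hx⟩ := hA; exact ⟨T x, hx⟩)).1 hB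
    exact ⟨i, rfl⟩
  · rintro ⟨i, rfl⟩
    refine ⟨f ⁻¹' {i}, (h _ ?_).2 ⟨i, rfl⟩, rfl⟩
    obtain ⟨x, hx⟩ := hA
    exact ⟨T x, hx⟩

theorem Compat.join {ι κ : Type*} {Q R : Finset (Set M)} {f : M → ι} {g : M → κ} (h : Compat Q f)
    (h' : Compat R g) : Compat (pJoin Q R) (fun x => (f x, g x)) := by
  have e : ∀ i j, (fun x => (f x, g x)) ⁻¹' {(i, j)} = f ⁻¹' {i} ∩ g ⁻¹' {j} := by
    intro i j; ext x; simp
  intro A hA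
  simp only [pJoin, Finset.mem_image₂]
  constructor
  · rintro ⟨B, hB, C, hC, rfl⟩
    obtain ⟨i, rfl⟩ := (h B (hA.mono inter_subset_left)).1 hB
    obtain ⟨j, rfl⟩ := (h' C (hA.mono inter_subset_right)).1 hC
    exact ⟨(i, j), (e i j).symm⟩
  · rintro ⟨⟨i, j⟩, rfl⟩
    rw [e] at hA ⊢
    exact ⟨_, (h _ (hA.mono inter_subset_left)).2 ⟨i, rfl⟩, _,
      (h' _ (hA.mono inter_subset_right)).2 ⟨j, rfl⟩, rfl⟩

theorem Compat.inj {ι κ : Type*} {Q : Finset (Set M)} {f : M → ι} {g : M → κ} (h : Compat Q f)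
    (hfg : ∀ x y, f x = f y ↔ g x = g y) : Compat Q g := by
  intro A hA
  rw [h A hA]
  constructor
  · rintro ⟨i, rfl⟩
    obtain ⟨x, hx⟩ := hA
    refine ⟨g x, ?_⟩
    ext y
    simp at hx ⊢
    rw [← hfg, hx]
  · rintro ⟨i, rfl⟩
    obtain ⟨x, hx⟩ := hA
    refine ⟨f x, ?_⟩
    ext y
    simp at hx ⊢
    rw [hfg, hx]

theorem Compat.dyn {ι : Type*} {Q : Finset (Set M)} {f : M → ι} (h : Compat Q f) (T : M → M) (n : ℕ) :
    Compat (dynRefine T Q n) (itin T f (n + 1)) := by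
  induction n with
  | zero =>
    refine h.inj ?_
    intro x y
    rw [itin_eq_iff]
    constructor
    · intro h i hi
      obtain rfl : i = 0 := by omega
      exact h
    · intro h; exact h 0 (by omega)
  | succ n ih =>
    refine (h.join (ih.preimg T)).inj ?_
    intro x y
    rw [Prod.mk.injEq, itin_eq_iff, itin_eq_iff]
    constructor
    · rintro ⟨h1, h2⟩ i hi
      rcases i with _ | i
      · exact h1
      · rw [Function.iterate_succ_apply, Function.iterate_succ_apply]
        exact h2 i (by omega)
    · intro h
      refine ⟨h 0 (by omega), fun i hi => ?_⟩
      rw [← Function.iterate_succ_apply, ← Function.iterate_succ_apply]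
      exact h (i + 1) (by omega)

theorem Compat.hT_eq {ι : Type*} [Fintype ι] {Q : Finset (Set M)} {f : M → ι} (h : Compat Q f)
    (μ : Measure M) (T : M → M) : entropyOfPartition μ T Q = hT μ T f := by
  unfold entropyOfPartition hT
  simp_rw [(h.dyn T _).entropy μ]

theorem exists_label_of_part (Q : Finset (Set M)) (hQ : IsMeasPartition Q) :
    ∃ f : M → Fin Q.card, Lm f ∧ Compat Q f := by
  classical
  have hex : ∀ x : M, ∃ A : Q, x ∈ (A : Set M) := by
    intro x
    have : x ∈ ⋃₀ (Q : Set (Set M)) := by rw [hQ.2.2]; trivial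
    obtain ⟨A, hA, hx⟩ := this
    exact ⟨⟨A, hA⟩, hx⟩
  choose a ha using hex
  have huniq : ∀ (x : M) (A : Q), x ∈ (A : Set M) → A = a x := by
    intro x A hx
    by_contra hne
    have := hQ.2.1 A A.2 (a x) (a x).2 (fun h => hne (Subtype.ext h))
    have h2 : x ∈ (A : Set M) ∩ (a x : Set M) := ⟨hx, ha x⟩
    rw [this] at h2; exact h2
  have hfib : ∀ i, (fun x => Q.equivFin (a x)) ⁻¹' {i} = (Q.equivFin.symm i : Set M) := by
    intro i
    ext x
    simp only [mem_preimage, mem_singleton_iff]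
    constructor
    · rintro rfl; simpa using ha x
    · intro hx
      rw [← huniq x _ hx]; simp
  refine ⟨fun x => Q.equivFin (a x), fun i => ?_, ?_⟩
  · rw [hfib]; exact hQ.1 _ (Q.equivFin.symm i).2
  · intro A hA
    constructor
    · intro h
      exact ⟨Q.equivFin ⟨A, h⟩, by rw [hfib]; simp⟩
    · rintro ⟨i, rfl⟩
      rw [hfib]; exact (Q.equivFin.symm i).2

theorem exists_part_of_label {ι : Type*} [Fintype ι] {f : M → ι} (hf : Lm f) :
    ∃ Q : Finset (Set M), IsMeasPartition Q ∧ Compat Q f := by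
  classical
  refine ⟨Finset.univ.image fun i => f ⁻¹' {i}, ⟨?_, ?_, ?_⟩, ?_⟩
  · intro A hA
    obtain ⟨i, -, rfl⟩ := Finset.mem_image.1 hA
    exact hf i
  · intro A hA B hB hAB
    obtain ⟨i, -, rfl⟩ := Finset.mem_image.1 hA
    obtain ⟨j, -, rfl⟩ := Finset.mem_image.1 hB
    ext x
    simp
    rintro rfl rfl
    exact hAB rfl
  · ext x; simp
  · intro A hA
    simp [eq_comm]

theorem metricEntropy_le {μ : Measure M} {T : M → M} {c : ℝ}
    (h : ∀ (k : ℕ) (f : M → Fin k), Lm f → hT μ T f ≤ c) : metricEntropy μ T ≤ c := by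
  refine csSup_le ?_ ?_
  · obtain ⟨Q, hQ, -⟩ := exists_part_of_label (f := fun _ : M => ()) (fun i => by simp)
    exact ⟨_, Q, hQ, rfl⟩
  · rintro _ ⟨Q, hQ, rfl⟩
    obtain ⟨f, hf, hc⟩ := exists_label_of_part Q hQ
    rw [hc.hT_eq]
    exact h _ f hf

theorem le_metricEntropy {ι : Type*} [Fintype ι] {μ : Measure M} {T : M → M} {c : ℝ}
    (h : ∀ (k : ℕ) (f : M → Fin k), Lm f → hT μ T f ≤ c) {f : M → ι} (hf : Lm f) :
    hT μ T f ≤ metricEntropy μ T := by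
  refine le_csSup ⟨c, ?_⟩ ?_
  · rintro _ ⟨Q, hQ, rfl⟩
    obtain ⟨f, hf, hc⟩ := exists_label_of_part Q hQ
    rw [hc.hT_eq]
    exact h _ f hf
  · obtain ⟨Q, hQ, hc⟩ := exists_part_of_label hf
    exact ⟨Q, hQ, (hc.hT_eq μ T).symm⟩

end DynEntropy
end CT


set_option linter.all false

namespace CT

section Weak
variable {M : Type*} [MetricSpace M] [CompactSpace M] [MeasurableSpace M] [BorelSpace M]
  {φ : ℝ → M → M}

/-- time average of a measure -/
noncomputable def avgM (φ : ℝ → M → M) (σ : Measure M) (t : ℝ) : Measure M :=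
  (ENNReal.ofReal t)⁻¹ • Measure.map (fun q : ℝ × M => φ q.1 q.2) ((volume.restrict (Ioc 0 t)).prod σ)

theorem flow_meas (hφ : IsCtsFlow φ) : Measurable (fun q : ℝ × M => φ q.1 q.2) := hφ.1.measurable

theorem flow_meas_t (hφ : IsCtsFlow φ) (t : ℝ) : Measurable (φ t) := (flow_cont hφ t).measurable

theorem avgM_prob (hφ : IsCtsFlow φ) (σ : Measure M) [IsProbabilityMeasure σ] {t : ℝ} (ht : 0 < t) :
    IsProbabilityMeasure (avgM φ σ t) := by
  constructor
  rw [avgM, Measure.smul_apply, Measure.map_apply (flow_meas hφ) MeasurableSet.univ, preimage_univ,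
    ← univ_prod_univ, Measure.prod_prod]
  simp
  exact ENNReal.inv_mul_cancel (by simpa using ht) (by simp)

theorem avgM_integrable_aux (hφ : IsCtsFlow φ) (σ : Measure M) [IsProbabilityMeasure σ] {t : ℝ}
    {g : M → ℝ} (hg : Measurable g) {C : ℝ} (hC : ∀ x, |g x| ≤ C) :
    Integrable (fun q : ℝ × M => g (φ q.1 q.2)) ((volume.restrict (Ioc 0 t)).prod σ) := by
  refine Integrable.of_bound (hg.comp (flow_meas hφ)).aestronglyMeasurable C ?_
  exact Eventually.of_forall fun q => hC _

theorem avgM_integral (hφ : IsCtsFlow φ) (σ : Measure M) [IsProbabilityMeasure σ] {t : ℝ} (ht : 0 < t)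
    {g : M → ℝ} (hg : Measurable g) {C : ℝ} (hC : ∀ x, |g x| ≤ C) :
    ∫ x, g x ∂(avgM φ σ t) = t⁻¹ * ∫ s in (0:ℝ)..t, ∫ x, g (φ s x) ∂σ := by
  rw [avgM, integral_smul_measure, integral_map (flow_meas hφ).aemeasurable hg.aestronglyMeasurable,
    integral_prod _ (avgM_integrable_aux hφ σ hg hC), intervalIntegral.integral_of_le ht.le]
  simp [ht.le]

theorem avgM_intervalIntegrable (hφ : IsCtsFlow φ) (σ : Measure M) [IsProbabilityMeasure σ]
    {g : M → ℝ} (hg : Measurable g) {C : ℝ} (hC : ∀ x, |g x| ≤ C) (a b : ℝ) :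
    IntervalIntegrable (fun s => ∫ x, g (φ s x) ∂σ) volume a b := by
  have hsm : StronglyMeasurable (fun s => ∫ x, g (φ s x) ∂σ) :=
    StronglyMeasurable.integral_prod_right' (f := fun q : ℝ × M => g (φ q.1 q.2))
      (hg.comp (flow_meas hφ)).stronglyMeasurable
  refine (intervalIntegrable_const (c := C)).mono_fun hsm.aestronglyMeasurable ?_
  refine Eventually.of_forall fun s => ?_
  have h1 : ‖∫ x, g (φ s x) ∂σ‖ ≤ C * σ.real univ := norm_integral_le_of_norm_le_const (Eventually.of_forall fun x => hC _)
  simp at h1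
  exact h1.trans (le_abs_self C)

theorem avgM_real (hφ : IsCtsFlow φ) (σ : Measure M) [IsProbabilityMeasure σ] {t : ℝ} (ht : 0 < t)
    {A : Set M} (hA : MeasurableSet A) :
    (avgM φ σ t).real A = t⁻¹ * ∫ s in (0:ℝ)..t, σ.real (φ s ⁻¹' A) := by
  have := avgM_integral hφ σ ht (g := A.indicator 1) ((measurable_const).indicator hA) (C := 1) (by
    intro x; by_cases h : x ∈ A <;> simp [h])
  rw [integral_indicator_one hA] at this
  rw [this]
  congr 1
  refine intervalIntegral.integral_congr fun s _ => ?_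
  have h2 : (fun x => A.indicator (1 : M → ℝ) (φ s x)) = (φ s ⁻¹' A).indicator 1 := by
    ext x; by_cases h : φ s x ∈ A <;> simp [h]
  simp only [h2]
  rw [integral_indicator_one (flow_meas_t hφ s hA)]

/-- criterion for invariance of limits -/
theorem invariant_of_tendsto (hφ : IsCtsFlow φ) {ι : Type*} {U : Filter ι} [U.NeBot]
    {μ : ι → ProbabilityMeasure M} {ν : ProbabilityMeasure M} (h : Tendsto μ U (nhds ν))
    (hg : ∀ (r : ℝ) (g : M → ℝ), Continuous g →
      Tendsto (fun k => ∫ x, g (φ r x) ∂(μ k : Measure M) - ∫ x, g x ∂(μ k : Measure M)) U (nhds 0)) :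
    flowInvariant φ (ν : Measure M) := by
  intro r
  have : IsFiniteMeasure (Measure.map (φ r) (ν : Measure M)) := by infer_instance
  refine ext_of_forall_integral_eq_of_IsFiniteMeasure fun f => ?_
  rw [integral_map (flow_meas_t hφ r).aemeasurable f.continuous.aestronglyMeasurable]
  have h1 := (ProbabilityMeasure.tendsto_iff_forall_integral_tendsto.1 h) f
  have h2 := (ProbabilityMeasure.tendsto_iff_forall_integral_tendsto.1 h)
    (BoundedContinuousFunction.mkOfCompact ⟨fun x => f (φ r x), f.continuous.comp (flow_cont hφ r)⟩)
  have h3 := tendsto_nhds_unique (hg r f f.continuous) (h2.sub h1)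
  simp at h3
  linarith

theorem exists_bound_cont {g : M → ℝ} (hg : Continuous g) : ∃ C > 0, ∀ x, |g x| ≤ C :=
  exists_pot_bound hg

theorem avgM_diff (hφ : IsCtsFlow φ) (σ : Measure M) [IsProbabilityMeasure σ] {t : ℝ} (ht : 0 < t)
    {g : M → ℝ} (hg : Continuous g) {C : ℝ} (hC : ∀ x, |g x| ≤ C) (r : ℝ) :
    |∫ x, g (φ r x) ∂(avgM φ σ t) - ∫ x, g x ∂(avgM φ σ t)| ≤ 2 * C * |r| / t := by
  rw [avgM_integral hφ σ ht hg.measurable hC, avgM_integral hφ σ ht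
    (g := fun x => g (φ r x)) (hg.comp (flow_cont hφ r)).measurable (fun x => hC _), ← mul_sub]
  set h : ℝ → ℝ := fun s => ∫ x, g (φ s x) ∂σ with hh
  have hIntg : ∀ a b, IntervalIntegrable h volume a b := avgM_intervalIntegrable hφ σ hg.measurable hC
  have hb : ∀ s, |h s| ≤ C := fun s => by
    have h1 : ‖∫ x, g (φ s x) ∂σ‖ ≤ C * σ.real univ := norm_integral_le_of_norm_le_const (Eventually.of_forall fun x => hC _)
    simpa using h1
  have e1 : ∫ s in (0:ℝ)..t, ∫ x, g (φ r (φ s x)) ∂σ = ∫ s in r..(t + r), h s := by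
    have := intervalIntegral.integral_comp_add_right h (a := 0) (b := t) r
    rw [zero_add] at this
    rw [← this]
    refine intervalIntegral.integral_congr fun s _ => ?_
    simp only [hh]
    congr 1; ext x; rw [add_comm, flow_add hφ]
  rw [e1]
  have e2 : (∫ s in r..(t + r), h s) - ∫ s in (0:ℝ)..t, h s = (∫ s in t..(t+r), h s) - ∫ s in (0:ℝ)..r, h s := by
    have a1 := intervalIntegral.integral_add_adjacent_intervals (hIntg 0 r) (hIntg r (t+r))
    have a2 := intervalIntegral.integral_add_adjacent_intervals (hIntg 0 t) (hIntg t (t+r))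
    linarith
  rw [e2, abs_mul, abs_of_pos (inv_pos.2 ht)]
  have b1 : |∫ s in t..(t+r), h s| ≤ C * |r| := by
    have := intervalIntegral.norm_integral_le_of_norm_le_const (a := t) (b := t + r) (f := h) (C := C) (fun s _ => hb s)
    simpa using this
  have b2 : |∫ s in (0:ℝ)..r, h s| ≤ C * |r| := by
    have := intervalIntegral.norm_integral_le_of_norm_le_const (a := 0) (b := r) (f := h) (C := C) (fun s _ => hb s)
    simpa using this
  have b3 : |(∫ s in t..(t+r), h s) - ∫ s in (0:ℝ)..r, h s| ≤ 2 * C * |r| := by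
    refine (abs_sub _ _).trans (by linarith)
  calc t⁻¹ * |_| ≤ t⁻¹ * (2 * C * |r|) := mul_le_mul_of_nonneg_left b3 (inv_pos.2 ht).le
    _ = _ := by field_simp

/-- The hyperfilter on the naturals, as a filter. -/
noncomputable abbrev UF : Filter ℕ := (hyperfilter ℕ : Filter ℕ)

theorem UF_le : UF ≤ atTop := by
  rw [← Nat.cofinite_eq_atTop]; exact hyperfilter_le_cofinite

theorem exists_UF_lim (μ : ℕ → ProbabilityMeasure M) : ∃ ν, Tendsto μ UF (nhds ν) := by
  obtain ⟨ν, -, h⟩ := isCompact_univ.ultrafilter_le_nhds ((hyperfilter ℕ).map μ) (by simp)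
  exact ⟨ν, h⟩

theorem exists_avg_limit (hφ : IsCtsFlow φ) (μ : ℕ → ProbabilityMeasure M) (σ : ℕ → Measure M)
    (hσ : ∀ k, IsProbabilityMeasure (σ k)) (t : ℕ → ℝ) (ht : Tendsto t atTop atTop)
    (ht0 : ∀ k, 0 < t k) (hμ : ∀ k, (μ k : Measure M) = avgM φ (σ k) (t k)) :
    ∃ ν : ProbabilityMeasure M, Tendsto μ UF (nhds ν) ∧ flowInvariant φ (ν : Measure M) := by
  obtain ⟨ν, hν⟩ := exists_UF_lim μ
  refine ⟨ν, hν, invariant_of_tendsto hφ hν ?_⟩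
  intro r g hg
  obtain ⟨C, hC0, hC⟩ := exists_bound_cont hg
  have h1 : Tendsto (fun k => 2 * C * |r| / t k) UF (nhds 0) := (ht.const_div_atTop _).mono_left UF_le
  refine squeeze_zero_norm (fun k => ?_) h1
  rw [hμ k]
  have := hσ k
  exact avgM_diff hφ (σ k) (ht0 k) hg hC r

theorem exists_inv_limit (hφ : IsCtsFlow φ) (μ : ℕ → ProbabilityMeasure M)
    (hμ : ∀ k, flowInvariant φ (μ k : Measure M)) :
    ∃ ν : ProbabilityMeasure M, Tendsto μ UF (nhds ν) ∧ flowInvariant φ (ν : Measure M) := by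
  obtain ⟨ν, hν⟩ := exists_UF_lim μ
  refine ⟨ν, hν, invariant_of_tendsto hφ hν ?_⟩
  intro r g hg
  have : ∀ k, ∫ x, g (φ r x) ∂(μ k : Measure M) - ∫ x, g x ∂(μ k : Measure M) = 0 := by
    intro k
    have := integral_map (μ := (μ k : Measure M)) (flow_meas_t hφ r).aemeasurable (f := g) (hg.aestronglyMeasurable)
    rw [hμ k r] at this
    rw [this]; simp
  simp only [this]
  exact tendsto_const_nhds

theorem tendsto_real_of_null {μ : ℕ → ProbabilityMeasure M} {ν : ProbabilityMeasure M}
    (h : Tendsto μ UF (nhds ν)) {A : Set M} (hA : (ν : Measure M) (frontier A) = 0) :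
    Tendsto (fun k => (μ k : Measure M).real A) UF (nhds ((ν : Measure M).real A)) := by
  have := ProbabilityMeasure.tendsto_measure_of_null_frontier_of_tendsto' h hA
  exact (ENNReal.tendsto_toReal (measure_ne_top _ _)).comp this

theorem tendsto_integral {μ : ℕ → ProbabilityMeasure M} {ν : ProbabilityMeasure M}
    (h : Tendsto μ UF (nhds ν)) {g : M → ℝ} (hg : Continuous g) :
    Tendsto (fun k => ∫ x, g x ∂(μ k : Measure M)) UF (nhds (∫ x, g x ∂(ν : Measure M))) :=
  (ProbabilityMeasure.tendsto_iff_forall_integral_tendsto.1 h)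
    (BoundedContinuousFunction.mkOfCompact ⟨g, hg⟩)

/-- a finite labelling with small cells whose boundaries are null -/
theorem exists_null_cells (ν : Measure M) [IsProbabilityMeasure ν] {ρ : ℝ} (hρ : 0 < ρ) :
    ∃ (k : ℕ) (c : M → Fin k), Lm c ∧ (∀ x y, c x = c y → dist x y ≤ ρ) ∧
      ∀ i, ν (frontier (c ⁻¹' {i})) = 0 := by
  have hrad : ∀ x : M, ∃ r, r ∈ Ioo 0 (ρ/2) ∧ ν (frontier (Metric.ball x r)) = 0 := by
    intro x
    have := exists_null_frontier_thickening ν {x} (a := 0) (b := ρ/2) (by positivity)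
    simpa [Metric.thickening_singleton] using this
  choose r hr hnull using hrad
  obtain ⟨t, ht⟩ := isCompact_univ.elim_finite_subcover (fun x : M => Metric.ball x (r x))
    (fun x => Metric.isOpen_ball) (fun x _ => mem_iUnion.2 ⟨x, Metric.mem_ball_self (hr x).1⟩)
  classical
  let e := t.equivFin
  let B : ℕ → Set M := fun n => if h : n < t.card then Metric.ball (e.symm ⟨n, h⟩ : M) (r (e.symm ⟨n, h⟩)) else ∅
  have hB0 : ∀ n, ν (frontier (B n)) = 0 := by
    intro n; simp only [B]; split_ifs
    · exact hnull _
    · simp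
  have hBm : ∀ n, MeasurableSet (B n) := by
    intro n; simp only [B]; split_ifs
    · exact Metric.isOpen_ball.measurableSet
    · simp
  have hBd : ∀ n x y, x ∈ B n → y ∈ B n → dist x y ≤ ρ := by
    intro n x y hx hy
    simp only [B] at hx hy
    split_ifs at hx hy with h
    · rw [Metric.mem_ball] at hx hy
      have := dist_triangle_right x y (e.symm ⟨n, h⟩ : M)
      have := (hr (e.symm ⟨n, h⟩ : M)).2
      linarith
    · exact hx.elim
  have hex : ∀ x : M, ∃ n : ℕ, x ∈ B n := by
    intro x
    have := ht (mem_univ x)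
    simp only [mem_iUnion] at this
    obtain ⟨i, hi, hx⟩ := this
    exact ⟨e ⟨i, hi⟩, by simp only [B]; rw [dif_pos (e ⟨i, hi⟩).2]; simpa using hx⟩
  have hlt : ∀ x, Nat.find (hex x) < t.card := by
    intro x
    by_contra h
    have := Nat.find_spec (hex x)
    simp only [B] at this
    rw [dif_neg h] at this
    exact this
  have hfib : ∀ i : Fin t.card, (fun x => (⟨Nat.find (hex x), hlt x⟩ : Fin t.card)) ⁻¹' {i} =
      B i ∩ ⋂ j ∈ Finset.range i, (B j)ᶜ := by
    intro i
    ext x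
    simp only [mem_preimage, mem_singleton_iff, Fin.ext_iff, Nat.find_eq_iff, mem_inter_iff, mem_iInter, mem_compl_iff, Finset.mem_range]
  have hfr : ∀ n : ℕ, ν (frontier (⋂ j ∈ Finset.range n, (B j)ᶜ)) = 0 := by
    intro n
    induction n with
    | zero => simp
    | succ n ih =>
      have : (⋂ j ∈ Finset.range (n+1), (B j)ᶜ) = (⋂ j ∈ Finset.range n, (B j)ᶜ) ∩ (B n)ᶜ := by
        ext x
        simp only [mem_iInter, Finset.mem_range, mem_inter_iff, Nat.lt_succ_iff_lt_or_eq]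
        constructor
        · exact fun h => ⟨fun j hj => h j (Or.inl hj), h n (Or.inr rfl)⟩
        · rintro ⟨h1, h2⟩ j (hj | rfl)
          · exact h1 j hj
          · exact h2
      rw [this]
      refine measure_mono_null ((frontier_inter_subset _ _).trans (union_subset_union inter_subset_left inter_subset_right)) ?_
      rw [measure_union_null_iff]
      exact ⟨ih, by rw [frontier_compl]; exact hB0 n⟩
  refine ⟨t.card, fun x => ⟨Nat.find (hex x), hlt x⟩, fun i => ?_, ?_, fun i => ?_⟩
  · rw [hfib]
    exact (hBm _).inter (Finset.measurableSet_biInter _ fun j _ => (hBm j).compl)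
  · intro x y hxy
    have hxy' : Nat.find (hex x) = Nat.find (hex y) := by simpa using hxy
    exact hBd _ x y (Nat.find_spec (hex x)) (hxy' ▸ Nat.find_spec (hex y))
  · rw [hfib]
    refine measure_mono_null ((frontier_inter_subset _ _).trans (union_subset_union inter_subset_left inter_subset_right)) ?_
    rw [measure_union_null_iff]
    exact ⟨hB0 _, hfr _⟩

/-- itineraries of null-frontier cells have null frontier -/
theorem null_frontier_itin {ν : Measure M} {T : M ≃ₜ M} (hinv : ν.map T = ν) {k : ℕ} {c : M → Fin k}
    (hc : ∀ i, ν (frontier (c ⁻¹' {i})) = 0) (hl : Lm c) (n : ℕ) (v : Fin n → Fin k) :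
    ν (frontier (itin T c n ⁻¹' {v})) = 0 := by
  have hiter : ∀ m, ν.map (T^[m]) = ν := by
    intro m
    induction m with
    | zero => simp
    | succ m ih =>
      rw [Function.iterate_succ, ← Measure.map_map (T.continuous.iterate m).measurable T.continuous.measurable, hinv, ih]
  have h1 : ∀ m i, ν (frontier ((fun x => c (T^[m] x)) ⁻¹' {i})) = 0 := by
    intro m i
    have hcont : Continuous (T^[m]) := T.continuous.iterate m
    have : (fun x => c (T^[m] x)) ⁻¹' {i} = T^[m] ⁻¹' (c ⁻¹' {i}) := rfl
    rw [this]
    refine measure_mono_null (hcont.frontier_preimage_subset _) ?_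
    rw [← Measure.map_apply hcont.measurable isClosed_frontier.measurableSet, hiter, hc]
  have h2 : itin T c n ⁻¹' {v} = ⋂ i : Fin n, (fun x => c (T^[(i : ℕ)] x)) ⁻¹' {v i} := by
    ext x; simp [itin, funext_iff]
  have h3 : ∀ s : Finset (Fin n), ν (frontier (⋂ i ∈ s, (fun x => c (T^[(i : ℕ)] x)) ⁻¹' {v i})) = 0 := by
    classical
    intro s
    induction s using Finset.induction_on with
    | empty => simp
    | insert a s ha ih =>
      rw [Finset.set_biInter_insert]
      refine measure_mono_null ((frontier_inter_subset _ _).trans (union_subset_union inter_subset_left inter_subset_right)) ?_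
      rw [measure_union_null_iff]
      exact ⟨h1 _ _, ih⟩
  have := h3 Finset.univ
  rw [h2]; simpa using this

theorem tendsto_Hm {ι : Type*} [Fintype ι] {μ : ℕ → ProbabilityMeasure M} {ν : ProbabilityMeasure M}
    (h : Tendsto μ UF (nhds ν)) {f : M → ι} (hf : ∀ i, (ν : Measure M) (frontier (f ⁻¹' {i})) = 0) :
    Tendsto (fun k => Hm (μ k : Measure M) f) UF (nhds (Hm (ν : Measure M) f)) := by
  unfold Hm
  exact tendsto_finset_sum _ fun i _ =>
    (Real.continuous_negMulLog.tendsto _).comp (tendsto_real_of_null h (hf i))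

end Weak
end CT


set_option linter.all false

namespace CT

section Tail
variable {M : Type*} [MetricSpace M] [CompactSpace M] [MeasurableSpace M] [BorelSpace M]
  {φ : ℝ → M → M} {ε : ℝ}

/-- expansive points with a given time bound -/
def ExpS (φ : ℝ → M → M) (ε s : ℝ) : Set M :=
  {z | biBowenBall φ ε z ⊆ (fun u => φ u z) '' Icc (-s) s}

theorem ExpS_mono {s s' : ℝ} (h : s ≤ s') : ExpS φ ε s ⊆ ExpS φ ε s' := fun z hz =>
  hz.trans (image_mono (Icc_subset_Icc (by linarith) h))

theorem measurable_ExpS (hφ : IsCtsFlow φ) (s : ℝ) : MeasurableSet (ExpS φ ε s) := by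
  have hC : IsClosed {q : M × M | ∀ t : ℝ, dist (φ t q.1) (φ t q.2) ≤ ε} := by
    rw [setOf_forall]
    exact isClosed_iInter fun t => isClosed_le
      (((flow_cont hφ t).comp continuous_fst).dist ((flow_cont hφ t).comp continuous_snd)) continuous_const
  have hD : IsClosed ((fun q : ℝ × M => (q.2, φ q.1 q.2)) '' (Icc (-s) s ×ˢ univ)) :=
    ((isCompact_Icc.prod isCompact_univ).image (continuous_snd.prodMk hφ.1)).isClosed
  obtain ⟨F, hF, hFU, hFe, -⟩ := hD.isOpen_compl.exists_iUnion_isClosed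
  have : (ExpS φ ε s)ᶜ = ⋃ n, Prod.fst '' ({q : M × M | ∀ t : ℝ, dist (φ t q.1) (φ t q.2) ≤ ε} ∩ F n) := by
    rw [← image_iUnion, ← inter_iUnion, hFe]
    ext z
    simp only [ExpS, mem_compl_iff, mem_setOf_eq, not_subset, mem_image, mem_inter_iff, Prod.exists,
      exists_and_right, exists_eq_right, biBowenBall, mem_prod, mem_univ, and_true, Prod.mk.injEq]
    constructor
    · rintro ⟨y, hy, h⟩
      exact ⟨y, hy, fun ⟨u, w, hu, hw, h2⟩ => h ⟨u, hu, by rw [← h2, hw]⟩⟩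
    · rintro ⟨y, hy, h⟩
      exact ⟨y, hy, fun ⟨u, hu, h2⟩ => h ⟨u, z, hu, rfl, h2⟩⟩
  rw [← MeasurableSet.compl_iff, this]
  exact MeasurableSet.iUnion fun n =>
    ((hC.inter (hF n)).isCompact.image continuous_fst).isClosed.measurableSet

theorem exists_compact_exp (hφ : IsCtsFlow φ) (hexp : AlmostExpansive φ ε) (ν : Measure M)
    [IsProbabilityMeasure ν] (hν : flowInvariant φ ν) {A : Set M} (hA : MeasurableSet A)
    (hA1 : ν A = 1) {ζ : ℝ} (hζ : 0 < ζ) :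
    ∃ s > 0, ∃ K ⊆ A ∩ ExpS φ ε s, IsCompact K ∧ 1 - ζ < ν.real K := by
  have h1 : (⋃ n : ℕ, ExpS φ ε ((n : ℝ) + 1)) ⊇ expansivePoints φ ε := by
    rintro x ⟨s, hs, h⟩
    obtain ⟨n, hn⟩ := exists_nat_gt s
    exact mem_iUnion.2 ⟨n, ExpS_mono (by linarith) h⟩
  have h2 : ν (⋃ n : ℕ, ExpS φ ε ((n : ℝ) + 1)) = 1 :=
    le_antisymm prob_le_one ((hexp ν inferInstance hν).symm.le.trans (measure_mono h1))
  have h3 : Tendsto (fun n : ℕ => ν (ExpS φ ε ((n : ℝ) + 1))) atTop (nhds 1) := by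
    rw [← h2]
    refine tendsto_measure_iUnion_atTop (fun a b hab => ExpS_mono ?_)
    have : (a : ℝ) ≤ b := by exact_mod_cast hab
    linarith
  have h4 : ∀ᶠ n : ℕ in atTop, 1 - ENNReal.ofReal ζ < ν (ExpS φ ε ((n : ℝ) + 1)) :=
    h3.eventually_const_lt (ENNReal.sub_lt_self ENNReal.one_ne_top one_ne_zero (by simpa using hζ))
  obtain ⟨n, hn⟩ := h4.exists
  have h5 : ν (A ∩ ExpS φ ε ((n : ℝ) + 1)) = ν (ExpS φ ε ((n : ℝ) + 1)) := by
    rw [inter_comm]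
    refine measure_inter_conull' ?_
    have : ν Aᶜ = 0 := by rw [prob_compl_eq_zero_iff hA]; exact hA1
    exact measure_mono_null (fun x hx => hx.2) this
  obtain ⟨K, hK, hKc, hlt⟩ := (hA.inter (measurable_ExpS (ε := ε) hφ ((n : ℝ) + 1))).exists_lt_isCompact (μ := ν) (h5 ▸ hn)
  refine ⟨(n : ℝ) + 1, by positivity, K, hK, hKc, ?_⟩
  have h6 := ENNReal.toReal_strict_mono (measure_ne_top ν K) hlt
  have h7 : (1 : ℝ) - ζ ≤ (1 - ENNReal.ofReal ζ).toReal := by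
    have := ENNReal.le_toReal_sub (a := 1) (b := ENNReal.ofReal ζ) (by simp)
    simpa [hζ.le] using this
  exact h7.trans_lt h6

theorem tail_local (hφ : IsCtsFlow φ) {s θ : ℝ} (hs : 0 < s) (hθ : 0 < θ) :
    ∃ K0 : ℕ, 1 ≤ K0 ∧ ∀ K : Set M, IsCompact K → K ⊆ ExpS φ ε s → ∀ L : ℝ,
      ∃ m : ℕ, ∃ U : Set M, IsOpen U ∧ K ⊆ U ∧ ∀ w ∈ U, Lab φ θ {y | dclose φ (-m) m ε w y} 0 L K0 := by
  obtain ⟨ζ, hζ, hsmall⟩ := exists_small_time hφ (θ := θ / 4) (by positivity)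
  set K0 : ℕ := ⌊2 * s / ζ⌋₊ + 1 with hK0
  refine ⟨K0, by omega, fun K hK hKE L => ?_⟩
  obtain ⟨ρ, hρ, hclose⟩ := exists_dist_dclose hφ (L := L) (θ := θ / 4) (by positivity)
  set u : ℕ → ℝ := fun j => -s + j * ζ with hu
  -- local claim
  have hloc : ∀ z ∈ K, ∃ m : ℕ, ∀ w : M, dist w z < 1 / ((m : ℝ) + 1) → ∀ y, dclose φ (-m) m ε w y →
      ∃ j : Fin K0, dclose φ 0 L (θ / 2) y (φ (u j) z) := by
    intro z hz
    by_contra hcon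
    push Not at hcon
    choose w hw y hy hbad using hcon
    obtain ⟨y0, -, hy0⟩ := isCompact_univ.ultrafilter_le_nhds ((hyperfilter ℕ).map y) (by simp)
    have hy0 : Tendsto y UF (nhds y0) := hy0
    have hw0 : Tendsto w UF (nhds z) := by
      rw [tendsto_iff_dist_tendsto_zero]
      refine squeeze_zero (fun _ => dist_nonneg) (fun m => (hw m).le) ?_
      exact tendsto_one_div_add_atTop_nhds_zero_nat.mono_left UF_le
    have hΓ : y0 ∈ biBowenBall φ ε z := by
      intro t
      have h1 : Tendsto (fun m => dist (φ t (w m)) (φ t (y m))) UF (nhds (dist (φ t z) (φ t y0))) :=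
        (((flow_cont hφ t).tendsto z).comp hw0).dist (((flow_cont hφ t).tendsto y0).comp hy0)
      refine le_of_tendsto h1 (UF_le ?_)
      obtain ⟨N, hN⟩ := exists_nat_ge |t|
      filter_upwards [eventually_ge_atTop N] with m hm
      have hm' : (N : ℝ) ≤ m := by exact_mod_cast hm
      have := abs_le.1 (hN.trans hm')
      exact hy m t ⟨this.1, this.2⟩
    obtain ⟨v, hv, hvz⟩ := hKE hz hΓ
    have hvz : φ v z = y0 := hvz
    have hnn : 0 ≤ (v + s) / ζ := div_nonneg (by linarith [hv.1]) hζ.le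
    set j := ⌊(v + s) / ζ⌋₊ with hj
    have hjK : j < K0 := by
      rw [hK0, Nat.lt_succ_iff]
      exact Nat.floor_le_floor (div_le_div_of_nonneg_right (by linarith [hv.2]) hζ.le)
    have hd : |v - u j| ≤ ζ := by
      have h1 := Nat.floor_le hnn
      have h2 := Nat.lt_floor_add_one ((v + s) / ζ)
      rw [← hj] at h1 h2
      rw [le_div_iff₀ hζ] at h1
      rw [div_lt_iff₀ hζ] at h2
      rw [abs_le]; simp only [hu]
      constructor <;> nlinarith
    have hc1 : dclose φ 0 L (θ / 4) y0 (φ (u j) z) := by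
      intro r _
      have : φ r y0 = φ (v - u j) (φ r (φ (u j) z)) := by
        rw [← hvz, ← flow_add hφ, ← flow_add hφ, ← flow_add hφ]; congr 1; ring
      rw [this]
      exact hsmall _ hd _
    have hev : ∀ᶠ m in UF, dist (y m) y0 ≤ ρ := by
      have := hy0.eventually (Metric.closedBall_mem_nhds y0 hρ)
      exact this
    obtain ⟨m, hm⟩ := hev.exists
    have := (hclose _ _ hm).trans hc1
    exact hbad m ⟨j, hjK⟩ (this.mono le_rfl le_rfl (by linarith))
  choose! m hm using hloc
  obtain ⟨t, htK, ht⟩ := hK.elim_nhds_subcover (fun z => Metric.ball z (1 / ((m z : ℝ) + 1)))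
    (fun z hz => Metric.ball_mem_nhds z (by positivity))
  refine ⟨t.sup m, ⋃ z ∈ t, Metric.ball z (1 / ((m z : ℝ) + 1)),
    isOpen_biUnion fun z _ => Metric.isOpen_ball, ht, ?_⟩
  intro w hw
  simp only [mem_iUnion] at hw
  obtain ⟨z, hz, hwz⟩ := hw
  have hle : (m z : ℝ) ≤ (t.sup m : ℕ) := by exact_mod_cast Finset.le_sup hz
  have hex : ∀ y, dclose φ (-(t.sup m : ℕ)) (t.sup m : ℕ) ε w y → ∃ j : Fin K0, dclose φ 0 L (θ / 2) y (φ (u j) z) :=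
    fun y hy => hm z (htK z hz) w hwz y (hy.mono (by linarith) hle le_rfl)
  classical
  have hpos : 0 < K0 := by omega
  refine ⟨fun y => if h : ∃ j : Fin K0, dclose φ 0 L (θ / 2) y (φ (u j) z) then h.choose else ⟨0, hpos⟩, ?_⟩
  intro y hy y' hy' h
  beta_reduce at h
  rw [dif_pos (hex y hy), dif_pos (hex y' hy')] at h
  have h1 := (hex y hy).choose_spec
  have h2 := (hex y' hy').choose_spec
  rw [← h] at h2
  exact (h1.trans h2.symm).mono le_rfl le_rfl (by linarith)

/-- combinatorial counting -/
theorem tail_count (hφ : IsCtsFlow φ) {θ : ℝ} {C1 K0 L m : ℕ} {U : Set M}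
    (hC1 : ∀ a : ℝ, Lab φ θ univ a (a + 1) C1) (hL : 1 ≤ L)
    (hU : ∀ w ∈ U, Lab φ θ {y | dclose φ (-m) m ε w y} 0 L K0) (x : M) (n : ℕ)
    (bad : Finset ℕ) (hbad : ∀ j < n, j ∉ bad → m ≤ j ∧ j + 1 + m ≤ n ∧ j + L ≤ n ∧
      ∃ a ∈ Icc (0:ℝ) 1, φ (j + a) x ∈ U) :
    ∀ d ≤ n, ∃ b g : ℕ, b ≤ (bad.filter (fun j => n - d ≤ j)).card ∧ L * g ≤ d ∧
      Lab φ θ (bowenBallSeg φ ε n x) ((n - d : ℕ) : ℝ) n (C1 ^ (b + 1) * (C1 * K0) ^ g) := by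
  intro d
  induction d using Nat.strong_induction_on with
  | _ d ih =>
    intro hd
    rcases Nat.eq_zero_or_pos d with rfl | hd0
    · refine ⟨0, 0, by simp, by simp, ?_⟩
      simpa using (hC1 (n : ℝ)).mono (subset_univ _) le_rfl (by linarith)
    by_cases hb : (n - d) ∈ bad
    · obtain ⟨b, g, h1, h2, h3⟩ := ih (d - 1) (by omega) (by omega)
      refine ⟨b + 1, g, ?_, by omega, ?_⟩
      · have hlt : (bad.filter (fun j => n - (d - 1) ≤ j)).card < (bad.filter (fun j => n - d ≤ j)).card := by
          refine Finset.card_lt_card ?_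
          rw [Finset.ssubset_iff_of_subset]
          · exact ⟨n - d, by simp only [Finset.mem_filter]; exact ⟨hb, le_rfl⟩, by
              simp only [Finset.mem_filter, not_and]
              intro _
              omega⟩
          · intro j hj
            simp only [Finset.mem_filter] at hj ⊢
            exact ⟨hj.1, by omega⟩
        omega
      · have h4 := (hC1 ((n - d : ℕ) : ℝ)).mono (subset_univ (bowenBallSeg φ ε n x)) le_rfl le_rfl
        have : ((n - d : ℕ) : ℝ) + 1 = ((n - (d - 1) : ℕ) : ℝ) := by
          rw [show n - (d - 1) = (n - d) + 1 by omega]; push_cast; ring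
        rw [this] at h4
        have := h4.glue h3
        rw [← mul_assoc, ← pow_succ'] at this
        exact this
    · obtain ⟨hm, hm', hL', a, ha, haU⟩ := hbad (n - d) (by omega) hb
      obtain ⟨b, g, h1, h2, h3⟩ := ih (d - L) (by omega) (by omega)
      refine ⟨b, g + 1, h1.trans (Finset.card_le_card ?_), ?_, ?_⟩
      · intro j hj
        simp only [Finset.mem_filter] at hj ⊢
        exact ⟨hj.1, by omega⟩
      · rw [mul_add, mul_one]; omega
      · set i := n - d with hi
        have hmi : (m : ℝ) ≤ i := by exact_mod_cast hm
        have hin : (i : ℝ) + 1 + m ≤ n := by exact_mod_cast hm'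
        have hLr : (1 : ℝ) ≤ L := by exact_mod_cast hL
        have hk : Lab φ θ (bowenBallSeg φ ε n x) (i + a) (i + a + L) K0 := by
          obtain ⟨c, hc⟩ := hU _ haU
          refine ⟨fun y => c (φ (i + a) y), fun y hy y' hy' hcc => ?_⟩
          have hmem : ∀ y ∈ bowenBallSeg φ ε n x, φ (i + a) y ∈ {y | dclose φ (-m) m ε (φ (i + a) x) y} := by
            intro y hy
            rw [mem_setOf_eq, dclose_shift hφ]
            exact dclose.mono (show dclose φ 0 n ε x y from hy) (by linarith [ha.1]) (by linarith [ha.2]) le_rfl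
          have := hc _ (hmem y hy) _ (hmem y' hy') hcc
          rw [dclose_shift hφ] at this
          exact this.mono (by linarith) (by linarith) le_rfl
        have h4 : Lab φ θ (bowenBallSeg φ ε n x) i (i + L) (C1 * K0) :=
          ((hC1 (i : ℝ)).mono (subset_univ _) le_rfl le_rfl).glue
            (hk.mono subset_rfl (by linarith [ha.2]) (by linarith [ha.1]))
        have e : (i : ℝ) + L = ((n - (d - L) : ℕ) : ℝ) := by
          rw [show n - (d - L) = i + L by omega]; push_cast; ring
        rw [e] at h4
        have := h4.glue h3
        convert this using 1
        rw [pow_succ]; ring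

theorem bad_count (hφ : IsCtsFlow φ) {U : Set M} (hU : IsOpen U) (x : M) {n : ℕ} (hn : 0 < n)
    (S : Finset ℕ) (hS : ∀ j ∈ S, j < n ∧ ∀ a ∈ Icc (0:ℝ) 1, φ (j + a) x ∉ U) :
    (S.card : ℝ) ≤ n * (avgM φ (Measure.dirac x) n).real Uᶜ := by
  have hn' : (0:ℝ) < n := by exact_mod_cast hn
  rw [avgM_real hφ _ hn' hU.measurableSet.compl, ← mul_assoc, mul_inv_cancel₀ hn'.ne', one_mul]
  set h : ℝ → ℝ := fun s => (Measure.dirac x).real (φ s ⁻¹' Uᶜ) with hh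
  have hIntg : ∀ a b, IntervalIntegrable h volume a b := by
    intro a b
    have := avgM_intervalIntegrable hφ (Measure.dirac x) (g := Uᶜ.indicator 1)
      ((measurable_const).indicator hU.measurableSet.compl) (C := 1) (by
      intro x; by_cases h : x ∈ U <;> simp [h]) a b
    convert this using 2 with s
    have h2 : (fun x => Uᶜ.indicator (1 : M → ℝ) (φ s x)) = (φ s ⁻¹' Uᶜ).indicator 1 := by
      ext x; by_cases h : φ s x ∈ U <;> simp [h]
    rw [h2, integral_indicator_one (flow_meas_t hφ s hU.measurableSet.compl)]
  have hsum := intervalIntegral.sum_integral_adjacent_intervals (f := h) (μ := volume) (a := fun k : ℕ => (k : ℝ)) (n := n)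
    (fun k _ => hIntg _ _)
  simp only [Nat.cast_zero] at hsum
  rw [← hsum]
  have hnn : ∀ k : ℕ, 0 ≤ ∫ s in (k:ℝ)..((k+1:ℕ):ℝ), h s := fun k =>
    intervalIntegral.integral_nonneg (by push_cast; linarith) (fun s _ => measureReal_nonneg)
  have h1 : ∀ j ∈ S, (1 : ℝ) ≤ ∫ s in (j:ℝ)..((j+1:ℕ):ℝ), h s := by
    intro j hj
    have hone : ∀ s ∈ Icc (j:ℝ) ((j+1:ℕ):ℝ), (fun _ => (1:ℝ)) s ≤ h s := by
      intro s hs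
      have h2 := (hS j hj).2 (s - j) ⟨by linarith [hs.1], by have := hs.2; push_cast at this; linarith⟩
      rw [add_sub_cancel] at h2
      simp only [hh]
      rw [measureReal_def, Measure.dirac_apply_of_mem (show x ∈ φ s ⁻¹' Uᶜ from h2)]
      simp
    have := intervalIntegral.integral_mono_on (by push_cast; linarith) (intervalIntegrable_const (μ := volume)) (hIntg _ _) hone
    simpa using this
  calc (S.card : ℝ) = ∑ j ∈ S, (1:ℝ) := by simp
    _ ≤ ∑ j ∈ S, ∫ s in (j:ℝ)..((j+1:ℕ):ℝ), h s := Finset.sum_le_sum h1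
    _ ≤ _ := Finset.sum_le_sum_of_subset_of_nonneg (fun j hj => Finset.mem_range.2 (hS j hj).1)
      (fun j _ _ => hnn j)

/-- **Tail entropy lemma.** -/
theorem tail_entropy (hφ : IsCtsFlow φ) (hexp : AlmostExpansive φ ε) {η θ : ℝ} (hη : 0 < η) (hθ : 0 < θ) :
    ∃ N : ℕ, ∀ n ≥ N, ∀ x, ∃ k : ℕ, (k : ℝ) ≤ Real.exp (η * n) ∧ Lab φ θ (bowenBallSeg φ ε n x) 0 n k := by
  by_contra hcon
  push Not at hcon
  choose n hn x hbad using hcon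
  have ht : Tendsto n atTop atTop := tendsto_atTop_mono hn tendsto_id
  -- avoid zero lengths by shifting
  let n' : ℕ → ℕ := fun k => n (k + 1)
  let x' : ℕ → M := fun k => x (k + 1)
  have hn'0 : ∀ k, 0 < n' k := fun k => lt_of_lt_of_le (Nat.succ_pos k) (hn (k+1))
  have hn'r : ∀ k, (0:ℝ) < n' k := fun k => by exact_mod_cast hn'0 k
  have ht' : Tendsto (fun k => (n' k : ℝ)) atTop atTop :=
    tendsto_natCast_atTop_atTop.comp (ht.comp (tendsto_add_atTop_nat 1))
  have hP := fun k => avgM_prob hφ (Measure.dirac (x' k)) (hn'r k)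
  let μ : ℕ → ProbabilityMeasure M := fun k => ⟨avgM φ (Measure.dirac (x' k)) (n' k), hP k⟩
  obtain ⟨ν, hν, hinv⟩ := exists_avg_limit hφ μ (fun k => Measure.dirac (x' k)) (fun k => inferInstance)
    (fun k => n' k) ht' hn'r (fun k => rfl)
  obtain ⟨k1, hk1, hlab1⟩ := exists_lab_pow hφ hθ
  set C1 : ℕ := k1 ^ 2 with hC1
  have hC1' : ∀ a : ℝ, Lab φ θ univ a (a + 1) C1 := fun a => by simpa using hlab1 1 a
  have hC1p : 1 ≤ C1 := Nat.one_le_pow _ _ hk1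
  have hlC : 0 ≤ Real.log C1 := Real.log_nonneg (by exact_mod_cast hC1p)
  set ζ := η / (4 * (Real.log C1 + 1)) with hζd
  have hζ : 0 < ζ := by positivity
  obtain ⟨s, hs, K, hKE, hK, hKν⟩ := exists_compact_exp hφ hexp (ν : Measure M) hinv MeasurableSet.univ (by simp) hζ
  obtain ⟨K0, hK0, hloc⟩ := tail_local (ε := ε) hφ hs hθ
  have hlK : 0 ≤ Real.log (C1 * K0 : ℕ) := Real.log_nonneg (by exact_mod_cast Nat.mul_pos hC1p hK0)
  obtain ⟨L, hL⟩ := exists_nat_gt (4 * Real.log (C1 * K0 : ℕ) / η)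
  have hL1 : 1 ≤ L := by
    have : (0:ℝ) < L := lt_of_le_of_lt (by positivity) hL
    exact_mod_cast this
  rw [div_lt_iff₀ hη] at hL
  obtain ⟨m, U, hU, hKU, hlabU⟩ := hloc K hK (hKE.trans inter_subset_right) L
  -- measure of the complement of U
  have hev : ∀ᶠ k in UF, (μ k : Measure M).real Uᶜ < ζ := by
    have h1 := ProbabilityMeasure.limsup_measure_closed_le_of_tendsto hν hU.isClosed_compl
    have h2 : (ν : Measure M) Uᶜ < ENNReal.ofReal ζ := by
      have : (ν : Measure M).real Uᶜ < ζ := by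
        rw [probReal_compl_eq_one_sub hU.measurableSet]
        have := measureReal_mono (μ := (ν : Measure M)) hKU
        linarith
      rw [measureReal_def] at this
      exact (ENNReal.lt_ofReal_iff_toReal_lt (measure_ne_top _ _)).2 this
    have h3 := eventually_lt_of_limsup_lt (h1.trans_lt h2)
    filter_upwards [h3] with k hk
    rw [measureReal_def]
    exact (ENNReal.lt_ofReal_iff_toReal_lt (measure_ne_top _ _)).1 hk
  have hlarge : ∀ᶠ k in UF, (Real.log C1 * (2 * m + 2 + L)) / (η / 4) ≤ n' k :=
    UF_le (ht'.eventually_ge_atTop _)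
  obtain ⟨k, hk1, hk2⟩ := (hev.and hlarge).exists
  rw [div_le_iff₀ (by positivity)] at hk2
  classical
  -- the bad set
  set N := n' k with hN
  set S : Finset ℕ := (Finset.range N).filter (fun j => ∀ a ∈ Icc (0:ℝ) 1, φ (j + a) (x' k) ∉ U) with hS
  set bad : Finset ℕ := Finset.range m ∪ (Finset.Ico (N - m) (N + 1) ∪ (Finset.Ico (N + 1 - L) (N+1) ∪ S)) with hbd
  have hcard : (bad.card : ℝ) ≤ m + ((m + 1) + (L + S.card)) := by
    have a1 := Finset.card_union_le (Finset.range m) (Finset.Ico (N - m) (N + 1) ∪ (Finset.Ico (N + 1 - L) (N+1) ∪ S))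
    have a2 := Finset.card_union_le (Finset.Ico (N - m) (N + 1)) (Finset.Ico (N + 1 - L) (N+1) ∪ S)
    have a3 := Finset.card_union_le (Finset.Ico (N + 1 - L) (N+1)) S
    simp only [Finset.card_range, Nat.card_Ico] at a1 a2 a3
    have : bad.card ≤ m + ((m + 1) + (L + S.card)) := by rw [hbd]; omega
    exact_mod_cast this
  have hScard := bad_count hφ hU (x' k) (hn'0 k) S (by
    intro j hj
    rw [hS, Finset.mem_filter, Finset.mem_range] at hj
    exact hj)
  obtain ⟨b, g, hb, hg, hlab⟩ := tail_count hφ hC1' hL1 hlabU (x' k) N bad (by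
    intro j hj hjb
    simp only [hbd, hS, Finset.mem_union, Finset.mem_range, Finset.mem_Ico, Finset.mem_filter, not_or, not_and, not_forall] at hjb
    obtain ⟨h1, h2, h3, h4⟩ := hjb
    refine ⟨by omega, ?_, ?_, ?_⟩
    · by_contra h; exact h2 (by omega) (by omega)
    · by_contra h; exact h3 (by omega) (by omega)
    · obtain ⟨a, ha, h5⟩ := h4 hj
      exact ⟨a, ha, not_not.1 h5⟩) N le_rfl
  refine hbad (k + 1) _ ?_ (by simpa using hlab)
  change (( C1 ^ (b + 1) * (C1 * K0) ^ g : ℕ) : ℝ) ≤ Real.exp (η * N)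
  have hposC : (0:ℝ) < C1 := by exact_mod_cast hC1p
  have hposK : (0:ℝ) < (C1 * K0 : ℕ) := by exact_mod_cast Nat.mul_pos hC1p hK0
  rw [← Real.log_le_iff_le_exp (by push_cast at hposK ⊢; positivity)]
  push_cast at hposK ⊢
  rw [Real.log_mul (by positivity) (by positivity), Real.log_pow, Real.log_pow]
  have hbr : (b : ℝ) ≤ m + ((m + 1) + (L + N * ζ)) := by
    have h1 : (b : ℝ) ≤ bad.card := by exact_mod_cast hb.trans (Finset.card_le_card (Finset.filter_subset _ _))
    have h2 : (N : ℝ) * (avgM φ (Measure.dirac (x' k)) N).real Uᶜ ≤ N * ζ :=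
      mul_le_mul_of_nonneg_left hk1.le (by positivity)
    linarith
  have hgr : (L : ℝ) * g ≤ N := by exact_mod_cast hg
  have e1 : Real.log C1 * ζ ≤ η / 4 := by
    rw [hζd, ← mul_div_assoc, div_le_iff₀ (by positivity)]
    nlinarith
  push_cast at hL hlK
  have e2 : (g : ℝ) * Real.log (C1 * K0) ≤ N * (η / 4) := by
    have h1 : (g:ℝ) * (4 * Real.log (C1 * K0)) ≤ g * (L * η) := mul_le_mul_of_nonneg_left hL.le (by positivity)
    have h2 : (L : ℝ) * g * η ≤ N * η := mul_le_mul_of_nonneg_right hgr hη.le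
    nlinarith
  push_cast
  have e3 : ((b:ℝ) + 1) * Real.log C1 ≤ (2 * m + 2 + L + N * ζ) * Real.log C1 :=
    mul_le_mul_of_nonneg_right (by linarith) hlC
  have e4 : (N:ℝ) * (Real.log C1 * ζ) ≤ N * (η / 4) := mul_le_mul_of_nonneg_left e1 (by positivity)
  have e5 : 0 ≤ (N : ℝ) * η := by positivity
  nlinarith

end Tail
end CT


set_option linter.all false

namespace CT
section LemE
variable {M : Type*} [MetricSpace M] [CompactSpace M] [MeasurableSpace M] [BorelSpace M]
  {φ : ℝ → M → M} {ε : ℝ}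

theorem dclose_blocks (hφ : IsCtsFlow φ) {t θ : ℝ} {n : ℕ} (hn : 1 ≤ n) {x y : M}
    (h : ∀ i < n, dclose φ 0 t θ (φ (i * t) x) (φ (i * t) y)) : dclose φ 0 (n * t) θ x y := by
  induction n, hn using Nat.le_induction with
  | base => simpa [flow_zero hφ] using h 0 (by norm_num)
  | succ n hn ih =>
    have h1 := ih (fun i hi => h i (by omega))
    have h2 := (dclose_shift hφ).1 (h n (by omega))
    refine h1.glue (h2.mono (by simp) (by push_cast; linarith) le_rfl)

/-- approximate a label by compact sets -/
theorem exists_compact_label {ι : Type*} [Fintype ι] (μ : Measure M) [IsProbabilityMeasure μ]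
    {f : M → ι} (hf : Lm f) :
    ∃ b : M → Option ι, Lm b ∧ (∀ x v, b x = some v → f x = v) ∧ (∀ v, IsCompact (b ⁻¹' {some v})) ∧
      Hm μ (fun x => (f x, b x)) - Hm μ b ≤ 1 := by
  classical
  have hcard : (0:ℝ) < 1 / ((Fintype.card ι : ℝ) + 1) := by positivity
  obtain ⟨r, hr, hr'⟩ := Metric.continuous_iff.1 Real.continuous_negMulLog 0 _ hcard
  have hK : ∀ v, ∃ K ⊆ f ⁻¹' {v}, IsCompact K ∧ μ.real (f ⁻¹' {v} \ K) < r := by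
    intro v
    obtain ⟨K, hK1, hK2, hK3⟩ := (hf v).exists_isCompact_diff_lt (μ := μ) (measure_ne_top _ _)
      (ε := ENNReal.ofReal r) (by simpa using hr)
    refine ⟨K, hK1, hK2, ?_⟩
    rw [Measure.real]
    exact ENNReal.toReal_lt_of_lt_ofReal hK3
  choose K hK1 hK2 hK3 using hK
  let b : M → Option ι := fun x => if x ∈ K (f x) then some (f x) else none
  have hbs : ∀ v, b ⁻¹' {some v} = K v := by
    intro v
    ext x
    simp only [b, mem_preimage, mem_singleton_iff]
    constructor
    · intro h
      split_ifs at h with h1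
      · rw [Option.some.injEq] at h; rwa [h] at h1
    · intro h
      have : f x = v := hK1 v h
      rw [this, if_pos h]
  have hbn : b ⁻¹' {none} = (⋃ v, K v)ᶜ := by
    ext x
    simp only [mem_preimage, mem_singleton_iff, mem_compl_iff, mem_iUnion, not_exists]
    constructor
    · intro h v hv
      rw [← hbs v] at hv
      simp only [mem_preimage, mem_singleton_iff] at hv
      rw [hv] at h; simp at h
    · intro h
      simp only [b]; rw [if_neg (h _)]
  have hbL : Lm b := by
    intro o
    cases o with
    | none => rw [hbn]; exact (MeasurableSet.iUnion fun v => (hK2 v).measurableSet).compl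
    | some v => rw [hbs]; exact (hK2 v).measurableSet
  refine ⟨b, hbL, ?_, fun v => by rw [hbs]; exact hK2 v, ?_⟩
  · intro x v h
    have : x ∈ b ⁻¹' {some v} := h
    rw [hbs] at this
    exact hK1 v this
  · have e1 : Hm μ b = Real.negMulLog (μ.real (b ⁻¹' {none})) +
        ∑ v, Real.negMulLog (μ.real (b ⁻¹' {some v})) := by
      rw [Hm, Fintype.sum_option]
    have e2 : Hm μ (fun x => (f x, b x)) = ∑ i, Real.negMulLog (μ.real ((fun x => (f x, b x)) ⁻¹' {(i, none)})) +
        ∑ v, Real.negMulLog (μ.real (b ⁻¹' {some v})) := by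
      rw [Hm, Fintype.sum_prod_type]
      simp only [Fintype.sum_option]
      rw [Finset.sum_add_distrib]
      congr 1
      rw [Finset.sum_comm]
      refine Finset.sum_congr rfl fun v _ => ?_
      rw [Finset.sum_eq_single v]
      · congr 2
        ext x
        simp only [mem_preimage, mem_singleton_iff, Prod.mk.injEq, and_iff_right_iff_imp]
        intro h
        have : x ∈ b ⁻¹' {some v} := h
        rw [hbs] at this
        exact hK1 v this
      · intro i _ hi
        have : (fun x => (f x, b x)) ⁻¹' {(i, some v)} = ∅ := by
          ext x
          simp only [mem_preimage, mem_singleton_iff, Prod.mk.injEq, mem_empty_iff_false, iff_false, not_and]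
          intro h h'
          have : x ∈ b ⁻¹' {some v} := h'
          rw [hbs] at this
          exact hi (h.symm.trans (hK1 v this))
        rw [this]; simp
      · simp
    have e3 : ∀ i, Real.negMulLog (μ.real ((fun x => (f x, b x)) ⁻¹' {(i, none)})) ≤ 1 / ((Fintype.card ι : ℝ) + 1) := by
      intro i
      have hlt : μ.real ((fun x => (f x, b x)) ⁻¹' {(i, none)}) < r := by
        refine lt_of_le_of_lt (measureReal_mono ?_) (hK3 i)
        intro x hx
        simp only [mem_preimage, mem_singleton_iff, Prod.mk.injEq] at hx
        refine ⟨hx.1, fun h => ?_⟩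
        rw [← hbs i] at h
        simp only [mem_preimage, mem_singleton_iff] at h
        rw [hx.2] at h; simp at h
      have := hr' (μ.real ((fun x => (f x, b x)) ⁻¹' {(i, none)})) (by
        rw [Real.dist_eq, sub_zero, abs_of_nonneg measureReal_nonneg]; exact hlt)
      rw [Real.dist_eq] at this
      simp only [Real.negMulLog_zero, sub_zero] at this
      exact (le_abs_self _).trans this.le
    have e4 : 0 ≤ Real.negMulLog (μ.real (b ⁻¹' {none})) :=
      Real.negMulLog_nonneg measureReal_nonneg measureReal_le_one
    have e5 := Finset.sum_le_sum (s := Finset.univ) (fun i _ => e3 i)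
    rw [Finset.sum_const, Finset.card_univ, nsmul_eq_mul] at e5
    have e6 : (Fintype.card ι : ℝ) * (1 / ((Fintype.card ι : ℝ) + 1)) ≤ 1 := by
      rw [mul_one_div, div_le_one (by positivity)]; linarith
    rw [e1, e2]; linarith

theorem Hm_count' {ι κ τ : Type*} [Fintype ι] [Fintype κ] [Fintype τ] [Nonempty τ] {μ : Measure M} [IsProbabilityMeasure μ]
    {f : M → ι} {g : M → κ} (hf : Lm f) (hg : Lm g)
    (h : ∀ j, ∃ c : M → τ, ∀ x y, g x = j → g y = j → c x = c y → f x = f y) :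
    Hm μ f ≤ Hm μ g + Real.log (Fintype.card τ) := by
  have := Hm_count (μ := μ) hf hg (N := Fintype.card τ) Fintype.card_pos (fun j => by
    obtain ⟨c, hc⟩ := h j
    exact ⟨fun x => Fintype.equivFin τ (c x), fun x y hx hy hxy => hc x y hx hy ((Fintype.equivFin τ).injective hxy)⟩)
  refine le_trans ?_ this
  exact Hm_comp_le (hf.pair hg) Prod.fst

theorem lemE_aux (hφ : IsCtsFlow φ) (hexp : AlmostExpansive φ ε) (ν : Measure M) [IsProbabilityMeasure ν]
    (hν : flowInvariant φ ν) {ι : Type*} [Fintype ι] {t : ℕ} (ht : 1 ≤ t) {w : M → ι} (hw : Lm w)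
    (hwc : ∀ x y, w x = w y → dclose φ 0 t ε x y) {k : ℕ} {β : M → Fin k} (hβ : Lm β)
    {η : ℝ} (hη : 0 < η) {q' : ℕ} (hq' : 1 ≤ q') :
    (q' : ℝ) * (t * hT ν (φ 1) β) ≤ q' * Hm ν w + Real.log 2 + η * t * q' + 1 := by
  classical
  set q := t * q' with hq
  have hq1 : 1 ≤ q := Nat.mul_pos ht hq'
  have h1 := hT_pow (μ := ν) (flow_meas_t hφ 1) hβ hq1
  have hS : (φ 1)^[q] = φ q := by
    funext x; rw [flow_iter hφ, mul_one]
  rw [hS] at h1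
  obtain ⟨b, hbL, hbv, hbK, hbH⟩ := exists_compact_label ν (hβ.itin (flow_meas_t hφ 1) q)
  have h2 := hT_cond (flow_meas_t hφ q) (hν q) (hβ.itin (flow_meas_t hφ 1) q) hbL
  -- separation of the compacts
  have hθ : ∃ θ > 0, ∀ x y, dist x y ≤ θ → b x ≠ none → b y ≠ none → b x = b y := by
    have : ∀ v v', ∃ θ > 0, v ≠ v' → ∀ x y, b x = some v → b y = some v' → θ < dist x y := by
      intro v v'
      by_cases hvv : v = v'
      · exact ⟨1, one_pos, fun h => absurd hvv h⟩
      have hd : Disjoint (b ⁻¹' {some v}) (b ⁻¹' {some v'}) := by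
        rw [Set.disjoint_left]
        intro x hx hx'
        simp only [mem_preimage, mem_singleton_iff] at hx hx'
        rw [hx, Option.some.injEq] at hx'
        exact hvv hx'
      obtain ⟨r, hr, h⟩ := Metric.exists_pos_forall_lt_edist (hbK v) (hbK v').isClosed hd
      refine ⟨r, by exact_mod_cast hr, fun _ x y hx hy => ?_⟩
      have := h x hx y hy
      rw [edist_dist, ← ENNReal.ofReal_coe_nnreal] at this
      exact (ENNReal.ofReal_lt_ofReal_iff_of_nonneg (by positivity)).1 this
    choose Θ hΘ hΘ' using this
    obtain ⟨θ, hθ, hle⟩ : ∃ θ > 0, ∀ v v', θ ≤ Θ v v' := by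
      have hfin : (Set.range (fun u : (Fin q → Fin k) × (Fin q → Fin k) => Θ u.1 u.2)).Finite := Set.finite_range _
      rcases isEmpty_or_nonempty ((Fin q → Fin k) × (Fin q → Fin k)) with he | hne
      · exact ⟨1, one_pos, fun v v' => (he.false (v, v')).elim⟩
      · obtain ⟨u, hu⟩ := Finite.exists_min (fun u : (Fin q → Fin k) × (Fin q → Fin k) => Θ u.1 u.2)
        exact ⟨Θ u.1 u.2, hΘ _ _, fun v v' => hu (v, v')⟩
    refine ⟨θ, hθ, fun x y hxy hx hy => ?_⟩
    obtain ⟨v, hv⟩ := Option.ne_none_iff_exists'.1 hx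
    obtain ⟨v', hv'⟩ := Option.ne_none_iff_exists'.1 hy
    by_contra hne
    have hvv : v ≠ v' := by rintro rfl; exact hne (hv.trans hv'.symm)
    have := hΘ' v v' hvv x y hv hv'
    linarith [hle v v']
  obtain ⟨θ, hθ, hsep⟩ := hθ
  obtain ⟨N, hN⟩ := tail_entropy hφ hexp hη hθ
  set n := N + 1 with hn
  have hqn : N ≤ q * n := by nlinarith
  set W := itin (φ t) w (q' * n) with hW
  have hWL : Lm W := hw.itin (flow_meas_t hφ t) _
  have hbi : Lm (itin (φ q) b n) := hbL.itin (flow_meas_t hφ q) n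
  set k0 := ⌊Real.exp (η * (q * n : ℕ))⌋₊ with hk0
  have hk01 : 1 ≤ k0 := Nat.le_floor (by simpa using Real.one_le_exp (by positivity))
  haveI : Nonempty (Fin k0 × (Fin n → Bool)) := ⟨(⟨0, hk01⟩, fun _ => true)⟩
  have h3 : Hm ν (itin (φ q) b n) ≤ Hm ν W + Real.log (Fintype.card (Fin k0 × (Fin n → Bool))) := by
    refine Hm_count' hbi hWL (fun j => ?_)
    by_cases hj : ∃ x, W x = j
    swap
    · exact ⟨fun _ => Classical.arbitrary _, fun x _ hx => absurd ⟨x, hx⟩ hj⟩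
    obtain ⟨x0, hx0⟩ := hj
    obtain ⟨k1, hk1, hlab⟩ := hN (q * n) hqn x0
    obtain ⟨c, hc⟩ := hlab.mono_card (Nat.le_floor hk1)
    have hmem : ∀ y, W y = j → y ∈ bowenBallSeg φ ε (q * n : ℕ) x0 := by
      intro y hy
      have e := (hx0.trans hy.symm)
      rw [hW, itin_eq_iff] at e
      have : dclose φ 0 ((q' * n : ℕ) * t) ε x0 y := by
        refine dclose_blocks hφ (Nat.mul_pos hq' (by omega)) (fun i hi => ?_)
        have := hwc _ _ (e i hi)
        rwa [flow_iter hφ, flow_iter hφ] at this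
      exact this.mono le_rfl (by rw [hq]; push_cast; apply le_of_eq; ring) le_rfl
    refine ⟨fun y => (c y, fun i => decide (b ((φ q)^[i] y) = none)), fun x y hx hy hxy => ?_⟩
    rw [Prod.mk.injEq] at hxy
    have hcl := hc x (hmem x hx) y (hmem y hy) hxy.1
    rw [itin_eq_iff]
    intro i hi
    have hd := congrFun hxy.2 ⟨i, hi⟩
    simp only [decide_eq_decide] at hd
    by_cases hnn : b ((φ q)^[i] x) = none
    · rw [hnn, hd.1 hnn]
    · refine hsep _ _ ?_ hnn (fun h => hnn (hd.2 h))
      rw [flow_iter hφ, flow_iter hφ]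
      refine hcl _ ⟨by positivity, ?_⟩
      push_cast
      rw [mul_comm]
      have : (i : ℝ) ≤ n := by exact_mod_cast hi.le
      gcongr
  have h4 : Hm ν W ≤ (q' * n : ℕ) * Hm ν w := Hm_itin_le (flow_meas_t hφ t) (hν t) hw _
  have h5 : Real.log (Fintype.card (Fin k0 × (Fin n → Bool))) ≤ η * (q * n : ℕ) + n * Real.log 2 := by
    rw [Fintype.card_prod, Fintype.card_fin, Fintype.card_fun, Fintype.card_fin, Fintype.card_bool]
    push_cast
    rw [Real.log_mul (by positivity) (by positivity), Real.log_pow]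
    gcongr
    have : (k0 : ℝ) ≤ Real.exp (η * (q * n : ℕ)) := Nat.floor_le (Real.exp_pos _).le
    have h6 := Real.log_le_log (by exact_mod_cast hk01) this
    rw [Real.log_exp] at h6
    push_cast at h6
    exact h6
  have h6 := hT_le ν (φ q) b (n := n) (by omega)
  have hn0 : (0:ℝ) < n := by rw [hn]; positivity
  have h7 : (n : ℝ) * hT ν (φ q) b ≤ n * (q' * Hm ν w + η * q + Real.log 2) := by
    push_cast at h4 h5
    nlinarith
  have h8 := le_of_mul_le_mul_left h7 hn0
  have e1 : (q : ℝ) = t * q' := by rw [hq]; push_cast; ring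
  have h9 : (q : ℝ) * hT ν (φ 1) β ≤ q' * Hm ν w + η * q + Real.log 2 + 1 := by linarith
  rw [e1] at h9
  linarith

theorem le_of_forall_nat {a b c : ℝ} (h : ∀ n : ℕ, 1 ≤ n → n * a ≤ n * b + c) : a ≤ b := by
  by_contra hab
  push Not at hab
  obtain ⟨n, hn⟩ := exists_nat_gt (|c| / (a - b))
  have h1 := h (n + 1) (by omega)
  rw [div_lt_iff₀ (by linarith)] at hn
  push_cast at h1
  have := le_abs_self c
  nlinarith

theorem lemE (hφ : IsCtsFlow φ) (hexp : AlmostExpansive φ ε) (ν : Measure M) [IsProbabilityMeasure ν]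
    (hν : flowInvariant φ ν) {ι : Type*} [Fintype ι] {t : ℕ} (ht : 1 ≤ t) {w : M → ι} (hw : Lm w)
    (hwc : ∀ x y, w x = w y → dclose φ 0 t ε x y) {k : ℕ} {β : M → Fin k} (hβ : Lm β) :
    t * hT ν (φ 1) β ≤ Hm ν w := by
  have h : ∀ η > 0, t * hT ν (φ 1) β ≤ Hm ν w + η * t := by
    intro η hη
    refine le_of_forall_nat (c := Real.log 2 + 1) (fun n hn => ?_)
    have := lemE_aux hφ hexp ν hν ht hw hwc hβ hη hn
    linarith
  refine le_of_forall_pos_le_add (fun ξ hξ => ?_)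
  have ht0 : (0:ℝ) < t := by exact_mod_cast ht
  have := h (ξ / t) (by positivity)
  rwa [div_mul_cancel₀ _ ht0.ne'] at this

end LemE
end CT


set_option linter.all false

namespace CT
section Exist
variable {M : Type*} [MetricSpace M] [CompactSpace M] [MeasurableSpace M] [BorelSpace M]
  {φ : ℝ → M → M} {ε : ℝ} {pot : M → ℝ}

theorem exists_ent_bound (hφ : IsCtsFlow φ) (hε : 0 < ε) (hexp : AlmostExpansive φ ε) :
    ∃ C : ℝ, 0 ≤ C ∧ ∀ (ν : Measure M) [IsProbabilityMeasure ν], flowInvariant φ ν →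
      ∀ (k : ℕ) (f : M → Fin k), Lm f → hT ν (φ 1) f ≤ C := by
  obtain ⟨k, c, hc, hcc⟩ := exists_cells hφ 1 hε
  refine ⟨Real.log k, Real.log_natCast_nonneg k, fun ν _ hν k' f hf => ?_⟩
  have h1 := lemE hφ hexp ν hν (t := 1) le_rfl (Lm.of_measurable hc) (by simpa using hcc) hf
  have h2 := Hm_le_log (μ := ν) (Lm.of_measurable hc)
  simp only [Nat.cast_one, one_mul, Fintype.card_fin] at h1 h2
  linarith

theorem le_ent (hφ : IsCtsFlow φ) (hε : 0 < ε) (hexp : AlmostExpansive φ ε) (ν : Measure M)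
    [IsProbabilityMeasure ν] (hν : flowInvariant φ ν) {ι : Type*} [Fintype ι] {f : M → ι} (hf : Lm f) :
    hT ν (φ 1) f ≤ metricEntropy ν (φ 1) := by
  obtain ⟨C, -, h⟩ := exists_ent_bound hφ hε hexp
  exact le_metricEntropy (h ν hν) hf

theorem ent_le (hφ : IsCtsFlow φ) (hexp : AlmostExpansive φ ε) (ν : Measure M)
    [IsProbabilityMeasure ν] (hν : flowInvariant φ ν) {ι : Type*} [Fintype ι] {t : ℕ} (ht : 1 ≤ t)
    {w : M → ι} (hw : Lm w) (hwc : ∀ x y, w x = w y → dclose φ 0 t ε x y) :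
    t * metricEntropy ν (φ 1) ≤ Hm ν w := by
  have ht0 : (0:ℝ) < t := by exact_mod_cast ht
  rw [mul_comm, ← le_div_iff₀ ht0]
  refine metricEntropy_le (fun k f hf => ?_)
  rw [le_div_iff₀ ht0, mul_comm]
  exact lemE hφ hexp ν hν ht hw hwc hf

theorem inv_on_univ {μ : Measure M} : InvariantProbOn φ univ μ ↔ IsProbabilityMeasure μ ∧ flowInvariant φ μ := by
  simp [InvariantProbOn]

theorem pressure_bdd (hφ : IsCtsFlow φ) (hpot : Continuous pot) (hε : 0 < ε) (hexp : AlmostExpansive φ ε) :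
    BddAbove {r : ℝ | ∃ μ : Measure M, InvariantProbOn φ univ μ ∧
      r = metricEntropy μ (φ 1) + ∫ y, pot y ∂μ} := by
  obtain ⟨C, hC, h⟩ := exists_ent_bound hφ hε hexp
  obtain ⟨B, hB, hB'⟩ := exists_pot_bound hpot
  refine ⟨C + B, ?_⟩
  rintro r ⟨μ, hμ, rfl⟩
  rw [inv_on_univ] at hμ
  haveI := hμ.1
  have h1 := metricEntropy_le (h μ hμ.2)
  have h2 : ‖∫ y, pot y ∂μ‖ ≤ B * μ.real univ := norm_integral_le_of_norm_le_const (Eventually.of_forall hB')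
  rw [probReal_univ, mul_one] at h2
  have := (le_abs_self _).trans h2
  linarith

theorem le_pressure (hφ : IsCtsFlow φ) (hpot : Continuous pot) (hε : 0 < ε) (hexp : AlmostExpansive φ ε)
    (ν : Measure M) [hp : IsProbabilityMeasure ν] (hν : flowInvariant φ ν) :
    metricEntropy ν (φ 1) + ∫ y, pot y ∂ν ≤ pressureOn φ univ pot :=
  le_csSup (pressure_bdd hφ hpot hε hexp) ⟨ν, inv_on_univ.2 ⟨hp, hν⟩, rfl⟩

theorem exists_invariant (hφ : IsCtsFlow φ) [Nonempty M] : ∃ μ : Measure M, InvariantProbOn φ univ μ := by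
  obtain ⟨x⟩ := ‹Nonempty M›
  have hp : ∀ k : ℕ, IsProbabilityMeasure (avgM φ (Measure.dirac x) ((k : ℝ) + 1)) := fun k =>
    avgM_prob hφ _ (by positivity)
  obtain ⟨ν, -, hν⟩ := exists_avg_limit hφ (fun k => ⟨_, hp k⟩) (fun _ => Measure.dirac x)
    (fun _ => inferInstance) (fun k => (k : ℝ) + 1)
    (tendsto_atTop_add_const_right _ _ tendsto_natCast_atTop_atTop) (fun k => by positivity) (fun k => rfl)
  exact ⟨ν, inv_on_univ.2 ⟨inferInstance, hν⟩⟩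

theorem itin_dclose (hφ : IsCtsFlow φ) {k : ℕ} {c : M → Fin k} {θ : ℝ}
    (hc : ∀ x y, c x = c y → dclose φ 0 1 θ x y) {m : ℕ} (hm : 1 ≤ m) {x y : M}
    (h : itin (φ 1) c m x = itin (φ 1) c m y) : dclose φ 0 m θ x y := by
  rw [itin_eq_iff] at h
  have := dclose_blocks hφ (t := 1) (θ := θ) hm (x := x) (y := y) (fun i hi => by
    have := hc _ _ (h i hi)
    rwa [flow_iter hφ, flow_iter hφ] at this)
  simpa using this

theorem exists_equilibrium (hφ : IsCtsFlow φ) (hpot : Continuous pot) (hε : 0 < ε)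
    (hexp : AlmostExpansive φ ε) [Nonempty M] : ∃ μ : Measure M, IsEquilibriumOn φ univ pot μ := by
  obtain ⟨μ0, hμ0⟩ := exists_invariant (M := M) hφ
  obtain ⟨u, -, hu, hmem⟩ := exists_seq_tendsto_sSup (S := {r : ℝ | ∃ μ : Measure M, InvariantProbOn φ univ μ ∧
      r = metricEntropy μ (φ 1) + ∫ y, pot y ∂μ}) ⟨_, μ0, hμ0, rfl⟩ (pressure_bdd hφ hpot hε hexp)
  choose μ hμ hμu using hmem
  simp only [inv_on_univ] at hμ
  obtain ⟨ν, hlim, hν⟩ := exists_inv_limit hφ (fun k => ⟨μ k, (hμ k).1⟩) (fun k => (hμ k).2)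
  have hu' : Tendsto u UF (nhds (pressureOn φ univ pot)) := hu.mono_left UF_le
  have hi := tendsto_integral hlim hpot
  obtain ⟨ρ, hρ, hρ'⟩ := exists_dist_dclose hφ (L := 1) hε
  obtain ⟨k, c, hc, hcd, hcf⟩ := exists_null_cells (ν : Measure M) hρ
  have hcc : ∀ x y, c x = c y → dclose φ 0 1 ε x y := fun x y h => hρ' x y (hcd x y h)
  have key : pressureOn φ univ pot - ∫ y, pot y ∂(ν : Measure M) ≤ hT (ν : Measure M) (φ 1) c := by
    refine le_hT _ _ _ (fun m hm => ?_)
    have hl := tendsto_Hm hlim (f := itin (φ 1) c m) (fun i =>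
      null_frontier_itin (T := flowHomeo hφ 1) (hν 1) hcf hc m i)
    refine le_of_tendsto_of_tendsto ((hu'.sub hi).const_mul (m : ℝ)) hl (Eventually.of_forall fun j => ?_)
    haveI := (hμ j).1
    have := ent_le hφ hexp (μ j) (hμ j).2 hm (hc.itin (flow_meas_t hφ 1) m)
      (fun x y h => itin_dclose hφ hcc hm h)
    have e : u j - ∫ y, pot y ∂(μ j) = metricEntropy (μ j) (φ 1) := by rw [hμu j]; ring
    simp only [ProbabilityMeasure.coe_mk]
    rw [e]
    exact this
  refine ⟨ν, inv_on_univ.2 ⟨inferInstance, hν⟩, le_antisymm (le_pressure hφ hpot hε hexp _ hν) ?_⟩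
  have := le_ent hφ hε hexp (ν : Measure M) hν hc
  linarith

end Exist
end CT


set_option linter.all false

namespace CT
section Misiu
variable {M : Type*} [MetricSpace M] [CompactSpace M] [MeasurableSpace M] [BorelSpace M]
  {φ : ℝ → M → M} {ε : ℝ} {pot : M → ℝ}

/-- discrete measures -/
noncomputable def discM (E : Finset M) (p : M → ℝ) : Measure M :=
  ∑ x ∈ E, ENNReal.ofReal (p x) • Measure.dirac x

theorem discM_real {E : Finset M} {p : M → ℝ} (hp : ∀ x, 0 ≤ p x) {A : Set M} (hA : MeasurableSet A) :
    (discM E p).real A = ∑ x ∈ E, A.indicator p x := by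
  classical
  rw [discM, Measure.real, Measure.finset_sum_apply, ENNReal.toReal_sum]
  · refine Finset.sum_congr rfl fun x _ => ?_
    rw [Measure.smul_apply, Measure.dirac_apply' _ hA, smul_eq_mul, ENNReal.toReal_mul,
      ENNReal.toReal_ofReal (hp x)]
    by_cases hx : x ∈ A <;> simp [hx]
  · intro x _
    rw [Measure.smul_apply]
    exact ENNReal.mul_ne_top ENNReal.ofReal_ne_top (measure_ne_top _ _)

theorem discM_prob {E : Finset M} {p : M → ℝ} (hp : ∀ x, 0 ≤ p x) (h1 : ∑ x ∈ E, p x = 1) :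
    IsProbabilityMeasure (discM E p) := by
  constructor
  rw [discM, Measure.finset_sum_apply]
  simp only [Measure.smul_apply, measure_univ, smul_eq_mul, mul_one]
  rw [← ENNReal.ofReal_sum_of_nonneg (fun x _ => hp x), h1, ENNReal.ofReal_one]

theorem discM_integral {E : Finset M} {p : M → ℝ} (hp : ∀ x, 0 ≤ p x) (g : M → ℝ) :
    ∫ x, g x ∂(discM E p) = ∑ x ∈ E, p x * g x := by
  rw [discM, integral_finset_sum_measure]
  · refine Finset.sum_congr rfl fun x _ => ?_
    rw [integral_smul_measure, integral_dirac, ENNReal.toReal_ofReal (hp x), smul_eq_mul]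
  · intro x _
    refine Integrable.smul_measure ?_ ENNReal.ofReal_ne_top
    exact integrable_dirac (by simp)

theorem discM_Hm {E : Finset M} {p : M → ℝ} (hp : ∀ x, 0 ≤ p x) {ι : Type*} [Fintype ι] {f : M → ι}
    (hf : Lm f) (hinj : ∀ x ∈ E, ∀ y ∈ E, f x = f y → x = y) :
    Hm (discM E p) f = ∑ x ∈ E, Real.negMulLog (p x) := by
  classical
  rw [Hm]
  have h1 : ∀ i, Real.negMulLog ((discM E p).real (f ⁻¹' {i})) =
      ∑ x ∈ E with f x = i, Real.negMulLog (p x) := by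
    intro i
    rw [discM_real hp (hf i)]
    by_cases h : ∃ x ∈ E, f x = i
    · obtain ⟨x, hx, hxi⟩ := h
      have e : E.filter (fun x => f x = i) = {x} := by
        ext y
        simp only [Finset.mem_filter, Finset.mem_singleton]
        constructor
        · rintro ⟨hy, hyi⟩; exact hinj y hy x hx (hyi.trans hxi.symm)
        · rintro rfl; exact ⟨hx, hxi⟩
      rw [e, Finset.sum_singleton, Finset.sum_eq_single x]
      · rw [indicator_of_mem]; exact hxi
      · intro y hy hne
        rw [indicator_of_notMem]
        intro hyi
        exact hne (hinj y hy x hx ((show f y = i from hyi).trans hxi.symm))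
      · exact fun h => absurd hx h
    · have e : E.filter (fun x => f x = i) = ∅ := by
        rw [Finset.filter_eq_empty_iff]
        exact fun x hx hxi => h ⟨x, hx, hxi⟩
      rw [e, Finset.sum_empty, Finset.sum_eq_zero, Real.negMulLog_zero]
      intro x hx
      rw [indicator_of_notMem]
      exact fun hxi => h ⟨x, hx, hxi⟩
  simp only [h1]
  exact Finset.sum_fiberwise E f _

/-- the shifted block estimate -/
theorem block_est (hφ : IsCtsFlow φ) (σ : Measure M) [IsProbabilityMeasure σ] {k : ℕ} {c : M → Fin k}
    (hc : Lm c) (n q : ℕ) (s : ℝ) :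
    q * Hm σ (fun x => itin (φ 1) c n (φ s x)) ≤ q * q * Real.log k +
      ∑ i ∈ Finset.range n, Hm σ (fun x => itin (φ 1) c q (φ (s + i) x)) := by
  set A : ℕ → ℝ := fun i => Hm σ (fun x => itin (φ 1) c (n - i) (φ (s + i) x)) with hA
  set F : ℕ → ℝ := fun i => Hm σ (fun x => itin (φ 1) c q (φ (s + i) x)) with hF
  have hL : ∀ m (u : ℝ), Lm (fun x => itin (φ 1) c m (φ u x)) := fun m u =>
    (hc.itin (flow_meas_t hφ 1) m).comp_right (flow_meas_t hφ u)
  have hshift : ∀ (i j : ℕ) (x : M), (φ 1)^[i] (φ (s + j) x) = φ (s + (i + j : ℕ)) x := by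
    intro i j x
    rw [flow_iter hφ, ← flow_add hφ]
    congr 1; push_cast; ring
  have h1 : ∀ i, A i ≤ F i + A (i + q) := by
    intro i
    refine le_trans ?_ (Hm_pair_le (hL q _) (hL _ _))
    refine Hm_det_le ((hL q _).pair (hL _ _)) (fun x y h => ?_)
    rw [Prod.mk.injEq] at h
    obtain ⟨ha, hb⟩ := h
    rw [itin_eq_iff] at ha hb ⊢
    intro j hj
    rcases lt_or_ge j q with hjq | hjq
    · exact ha j hjq
    · have := hb (j - q) (by omega)
      rw [hshift, hshift, show j - q + (i + q) = j + i by omega] at this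
      rw [hshift, hshift]; exact this
  have h0 : ∀ i, n ≤ i → A i = 0 := by
    intro i hi
    have : ∀ m, m = 0 → Hm σ (fun x => itin (φ 1) c m (φ (s + i) x)) = 0 := by
      rintro m rfl
      have := Hm_det_le (μ := σ) (f := fun x => itin (φ 1) c 0 (φ (s + i) x)) (g := fun _ : M => ())
        (fun i => by simp) (fun x y _ => by funext j; exact j.elim0)
      rw [Hm_unit] at this
      exact le_antisymm this (Hm_nonneg _)
    exact this _ (by omega)
  have h2 : ∀ i, A 0 ≤ i * Real.log k + A i := by
    intro i
    have hk := Hm_le_log (μ := σ) (hL i (s + (0:ℕ)))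
    rw [Fintype.card_fun, Fintype.card_fin, Fintype.card_fin] at hk
    push_cast at hk
    rw [Real.log_pow] at hk
    refine le_trans ?_ (add_le_add (by simpa using hk) le_rfl)
    have := Hm_pair_le (μ := σ) (hL i (s + (0:ℕ))) (hL (n - i) (s + i))
    refine le_trans ?_ (this.trans (by simp [hA]))
    refine Hm_det_le ((hL i _).pair (hL _ _)) (fun x y h => ?_)
    rw [Prod.mk.injEq] at h
    obtain ⟨ha, hb⟩ := h
    rw [itin_eq_iff] at ha hb ⊢
    intro j hj
    rcases lt_or_ge j i with hjq | hjq
    · exact ha j hjq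
    · have := hb (j - i) (by omega)
      rw [hshift, hshift, show j - i + i = j + 0 by omega] at this
      rw [hshift, hshift]; exact this
  have h3 : ∑ i ∈ Finset.range q, A i ≤ ∑ i ∈ Finset.range n, F i := by
    have e1 : ∑ i ∈ Finset.range (q + n), A i = ∑ i ∈ Finset.range q, A i + ∑ i ∈ Finset.range n, A (q + i) :=
      Finset.sum_range_add _ _ _
    have e2 : ∑ i ∈ Finset.range (n + q), A i = ∑ i ∈ Finset.range n, A i + ∑ i ∈ Finset.range q, A (n + i) :=
      Finset.sum_range_add _ _ _
    have e3 : ∑ i ∈ Finset.range q, A (n + i) = 0 := Finset.sum_eq_zero fun i _ => h0 _ (by omega)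
    have e4 : ∑ i ∈ Finset.range n, A i ≤ ∑ i ∈ Finset.range n, F i + ∑ i ∈ Finset.range n, A (q + i) := by
      rw [← Finset.sum_add_distrib]
      exact Finset.sum_le_sum fun i _ => by rw [add_comm q i]; exact h1 i
    rw [add_comm q n] at e1
    linarith
  have h4 : ∑ i ∈ Finset.range q, A 0 ≤ ∑ i ∈ Finset.range q, (q * Real.log k + A i) := by
    refine Finset.sum_le_sum fun i hi => (h2 i).trans ?_
    have : (i : ℝ) ≤ q := by exact_mod_cast (Finset.mem_range.1 hi).le
    have := Real.log_natCast_nonneg k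
    gcongr
  rw [Finset.sum_const, Finset.sum_add_distrib, Finset.sum_const, Finset.card_range, nsmul_eq_mul, nsmul_eq_mul] at h4
  have e0 : A 0 = Hm σ (fun x => itin (φ 1) c n (φ s x)) := by simp [hA]
  rw [e0] at h4
  linarith

theorem avg_Hm (hφ : IsCtsFlow φ) (σ : Measure M) [IsProbabilityMeasure σ] {ι : Type*} [Fintype ι]
    {f : M → ι} (hf : Lm f) {t : ℝ} (ht : 0 < t) (a b : ℝ) :
    IntervalIntegrable (fun s => Hm σ (fun x => f (φ s x))) volume a b ∧
    ∫ s in (0:ℝ)..t, Hm σ (fun x => f (φ s x)) ≤ t * Hm (avgM φ σ t) f := by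
  have hi : ∀ i a b, IntervalIntegrable (fun s => σ.real (φ s ⁻¹' (f ⁻¹' {i}))) volume a b := by
    intro i a b
    have := avgM_intervalIntegrable hφ σ (g := (f ⁻¹' {i}).indicator 1) (measurable_one.indicator (hf i)) (C := 1)
      (fun x => by by_cases h : x ∈ f ⁻¹' {i} <;> simp [indicator, h]) a b
    refine this.congr (fun s _ => ?_)
    have h1 : (fun x => (f ⁻¹' {i}).indicator (1 : M → ℝ) (φ s x)) = (φ s ⁻¹' (f ⁻¹' {i})).indicator 1 := rfl
    beta_reduce
    rw [h1, integral_indicator_one ((flow_meas_t hφ s) (hf i))]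
  have hm : ∀ i a b, IntervalIntegrable (fun s => Real.negMulLog (σ.real (φ s ⁻¹' (f ⁻¹' {i})))) volume a b := by
    intro i a b
    have hb : ∃ C, ∀ x ∈ Icc (0:ℝ) 1, ‖Real.negMulLog x‖ ≤ C :=
      isCompact_Icc.exists_bound_of_continuousOn Real.continuous_negMulLog.continuousOn
    obtain ⟨C, hC⟩ := hb
    rw [intervalIntegrable_iff]
    refine Integrable.mono' (g := fun _ => C) (continuous_const.intervalIntegrable a b).def' ?_ ?_
    · exact Real.continuous_negMulLog.comp_aestronglyMeasurable (hi i a b).def'.aestronglyMeasurable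
    · exact Eventually.of_forall fun s => hC _ ⟨measureReal_nonneg, measureReal_le_one⟩
  have eF : (fun s => Hm σ (fun x => f (φ s x))) =
      fun s => ∑ i, Real.negMulLog (σ.real (φ s ⁻¹' (f ⁻¹' {i}))) := rfl
  refine ⟨?_, ?_⟩
  · rw [eF]
    have := IntervalIntegrable.sum Finset.univ fun i _ => hm i a b
    have e : (fun s => ∑ i, Real.negMulLog (σ.real (φ s ⁻¹' (f ⁻¹' {i})))) =
        ∑ i, fun s => Real.negMulLog (σ.real (φ s ⁻¹' (f ⁻¹' {i}))) := by funext s; simp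
    rw [e]
    exact this
  · rw [eF, Hm]
    rw [intervalIntegral.integral_finset_sum (fun i _ => hm i 0 t), Finset.mul_sum]
    refine Finset.sum_le_sum fun i _ => ?_
    rw [avgM_real hφ σ ht (hf i)]
    rw [intervalIntegral.integral_of_le ht.le, intervalIntegral.integral_of_le ht.le]
    have hv : (volume.restrict (Ioc 0 t)).real univ = t := by
      simp [Measure.real, ht.le]
    haveI : NeZero (volume.restrict (Ioc (0:ℝ) t)) := ⟨by
      intro h; rw [h] at hv; simp at hv; linarith⟩
    have hj := Real.concaveOn_negMulLog.le_map_average (μ := volume.restrict (Ioc 0 t))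
      (f := fun s => σ.real (φ s ⁻¹' (f ⁻¹' {i}))) Real.continuous_negMulLog.continuousOn isClosed_Ici
      (Eventually.of_forall fun s => measureReal_nonneg)
      ((intervalIntegrable_iff_integrableOn_Ioc_of_le ht.le).1 (hi i 0 t))
      ((intervalIntegrable_iff_integrableOn_Ioc_of_le ht.le).1 (hm i 0 t))
    rw [average_eq, average_eq, hv, smul_eq_mul, smul_eq_mul] at hj
    rw [inv_mul_le_iff₀ ht] at hj
    exact hj

theorem misiu_step (hφ : IsCtsFlow φ) (hpot : Continuous pot) {γ : ℝ} {n : ℕ} (hn : 1 ≤ n) {E : Finset M}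
    (hE : Sep φ 0 n γ E) (hne : E.Nonempty) :
    ∃ σ : Measure M, IsProbabilityMeasure σ ∧ ∀ (k : ℕ) (c : M → Fin k), Lm c →
      (∀ x y, c x = c y → dclose φ 0 1 γ x y) → ∀ q : ℕ, 
      q * Real.log (∑ x ∈ E, Real.exp (birkhoff φ pot x n)) ≤ (q + q * q) * Real.log k +
        n * Hm (avgM φ σ n) (itin (φ 1) c q) + q * n * ∫ y, pot y ∂(avgM φ σ n) := by
  set Z := ∑ x ∈ E, Real.exp (birkhoff φ pot x n) with hZ
  have hZ0 : 0 < Z := Finset.sum_pos (fun x _ => Real.exp_pos _) hne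
  set p : M → ℝ := fun x => Real.exp (birkhoff φ pot x n) / Z with hp
  have hp0 : ∀ x, 0 ≤ p x := fun x => by positivity
  have hp1 : ∑ x ∈ E, p x = 1 := by
    rw [hp, ← Finset.sum_div, ← hZ, div_self hZ0.ne']
  have hprob := discM_prob hp0 hp1
  have hn0 : (0:ℝ) < n := by exact_mod_cast hn
  refine ⟨discM E p, hprob, fun k c hc hcc q => ?_⟩
  set σ := discM E p with hσ
  -- gibbs
  have hG : Real.log Z = ∑ x ∈ E, Real.negMulLog (p x) + ∑ x ∈ E, p x * birkhoff φ pot x n := by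
    rw [← Finset.sum_add_distrib]
    have : ∀ x ∈ E, Real.negMulLog (p x) + p x * birkhoff φ pot x n = p x * Real.log Z := by
      intro x _
      have : Real.log (p x) = birkhoff φ pot x n - Real.log Z := by
        rw [hp]; rw [Real.log_div (Real.exp_ne_zero _) hZ0.ne', Real.log_exp]
      rw [Real.negMulLog, this]; ring
    rw [Finset.sum_congr rfl this, ← Finset.sum_mul, hp1, one_mul]
  have hI : n * ∫ y, pot y ∂(avgM φ σ n) = ∑ x ∈ E, p x * birkhoff φ pot x n := by
    obtain ⟨B, hB, hB'⟩ := exists_pot_bound hpot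
    rw [avgM_integral hφ σ hn0 hpot.measurable hB', ← mul_assoc, mul_inv_cancel₀ hn0.ne', one_mul]
    have : ∀ s, ∫ x, pot (φ s x) ∂σ = ∑ x ∈ E, p x * pot (φ s x) := fun s =>
      discM_integral hp0 _
    simp only [this]
    rw [intervalIntegral.integral_finset_sum]
    · simp only [intervalIntegral.integral_const_mul]; rfl
    · intro x _
      exact (birkhoff_integrable hφ hpot x 0 n).const_mul _
  have hLs : ∀ s : ℝ, Lm (fun x => itin (φ 1) c n (φ s x)) := fun s =>
    (hc.itin (flow_meas_t hφ 1) n).comp_right (flow_meas_t hφ s)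
  -- injectivity
  have hH : ∀ s ∈ Icc (0:ℝ) 1, ∑ x ∈ E, Real.negMulLog (p x) ≤
      Real.log k + Hm σ (fun x => itin (φ 1) c n (φ s x)) := by
    intro s hs
    rw [← discM_Hm hp0 (f := fun x => (c x, itin (φ 1) c n (φ s x))) (hc.pair (hLs s))]
    · have h1 := Hm_pair_le (μ := σ) hc (hLs s)
      have h2 := Hm_le_log (μ := σ) hc
      rw [Fintype.card_fin] at h2
      linarith
    · intro x hx y hy hxy
      rw [Prod.mk.injEq] at hxy
      refine hE x hx y hy ?_
      have h1 := (hcc x y hxy.1).mono le_rfl hs.2 le_rfl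
      have h2 := (dclose_shift hφ).1 (itin_dclose hφ hcc hn hxy.2)
      rw [zero_add] at h2
      exact (h1.glue h2).mono le_rfl (by linarith [hs.1]) le_rfl
  have hF := fun a b => (avg_Hm hφ σ (hc.itin (flow_meas_t hφ 1) q) hn0 a b).1
  have hJ := (avg_Hm hφ σ (hc.itin (flow_meas_t hφ 1) q) hn0 0 0).2
  set F : ℝ → ℝ := fun s => Hm σ (fun x => itin (φ 1) c q (φ s x)) with hFd
  have hpt : ∀ s ∈ Icc (0:ℝ) 1, q * ∑ x ∈ E, Real.negMulLog (p x) - (q + q * q) * Real.log k ≤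
      ∑ i ∈ Finset.range n, F (s + i) := by
    intro s hs
    have h1 := mul_le_mul_of_nonneg_left (hH s hs) (Nat.cast_nonneg (α := ℝ) q)
    have h2 := block_est hφ σ hc n q s
    simp only [hFd]
    linarith
  have hii : ∀ i : ℕ, IntervalIntegrable (fun s => F (s + i)) volume 0 1 := fun i => by
    have := (hF (0 + i) (1 + i)).comp_add_right (i : ℝ)
    simpa using this
  have hIntg : ∫ s in (0:ℝ)..1, ∑ i ∈ Finset.range n, F (s + i) = ∫ s in (0:ℝ)..n, F s := by
    rw [intervalIntegral.integral_finset_sum (fun i _ => hii i)]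
    have h1 := intervalIntegral.sum_integral_adjacent_intervals (f := F) (μ := volume) (a := fun i : ℕ => (i : ℝ)) (n := n)
      (fun i _ => hF _ _)
    rw [Nat.cast_zero] at h1
    rw [← h1]
    refine Finset.sum_congr rfl fun i _ => ?_
    rw [intervalIntegral.integral_comp_add_right]
    congr 1
    · simp
    · push_cast; ring
  have hmono := intervalIntegral.integral_mono_on (a := 0) (b := 1) (μ := volume) zero_le_one
    (f := fun _ => q * ∑ x ∈ E, Real.negMulLog (p x) - (q + q * q) * Real.log k)
    (by simp) (IntervalIntegrable.sum (Finset.range n) fun i _ => hii i) (fun s hs => by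
      have := hpt s hs
      simpa using this)
  simp only [intervalIntegral.integral_const, sub_zero, one_smul, Finset.sum_apply] at hmono
  rw [hIntg] at hmono
  rw [hG, ← hI]
  have hq0 : (0:ℝ) ≤ q := Nat.cast_nonneg q
  nlinarith

theorem misiu (hφ : IsCtsFlow φ) (hpot : Continuous pot) (hε : 0 < ε) (hexp : AlmostExpansive φ ε)
    {γ a : ℝ} (hγ : 0 < γ)
    (h : ∃ᶠ n : ℕ in atTop, ∃ E : Finset M, Sep φ 0 n γ E ∧
      Real.exp (n * a) ≤ ∑ x ∈ E, Real.exp (birkhoff φ pot x n)) : a ≤ pressureOn φ univ pot := by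
  have h' := h.and_eventually (eventually_ge_atTop 1)
  obtain ⟨ψ, hψ, hψ'⟩ := extraction_of_frequently_atTop h'
  choose E hE using fun k => (hψ' k).1
  have hn1 := fun k => (hψ' k).2
  have hne : ∀ k, (E k).Nonempty := by
    intro k
    by_contra hc
    rw [Finset.not_nonempty_iff_eq_empty] at hc
    have := (hE k).2
    rw [hc, Finset.sum_empty] at this
    exact absurd this (not_le.2 (Real.exp_pos _))
  choose σ hσ hest using fun k => misiu_step hφ hpot (hn1 k) (hE k).1 (hne k)
  have hn0 : ∀ k, (0:ℝ) < ψ k := fun k => by exact_mod_cast hn1 k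
  have htop : Tendsto (fun k => (ψ k : ℝ)) atTop atTop := tendsto_natCast_atTop_atTop.comp hψ.tendsto_atTop
  obtain ⟨ν, hlim, hν⟩ := exists_avg_limit hφ (fun k => ⟨avgM φ (σ k) (ψ k), avgM_prob hφ (σ k) (hn0 k)⟩) σ hσ
    (fun k => (ψ k : ℝ)) htop hn0 (fun k => rfl)
  have hi := tendsto_integral hlim hpot
  obtain ⟨ρ, hρ, hρ'⟩ := exists_dist_dclose hφ (L := 1) hγ
  obtain ⟨k, c, hc, hcd, hcf⟩ := exists_null_cells (ν : Measure M) hρ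
  have hcc : ∀ x y, c x = c y → dclose φ 0 1 γ x y := fun x y h => hρ' x y (hcd x y h)
  have key : a - ∫ y, pot y ∂(ν : Measure M) ≤ hT (ν : Measure M) (φ 1) c := by
    refine le_hT _ _ _ (fun q hq => ?_)
    have hl := tendsto_Hm hlim (f := itin (φ 1) c q) (fun i =>
      null_frontier_itin (T := flowHomeo hφ 1) (hν 1) hcf hc q i)
    have hz : Tendsto (fun j => ((q:ℝ) + q * q) * Real.log k / (ψ j : ℝ)) UF (nhds 0) :=
      (htop.const_div_atTop _).mono_left UF_le
    have hR := (hz.add hl).add (hi.const_mul (q : ℝ))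
    have hle : (q : ℝ) * a ≤ 0 + Hm (ν : Measure M) (itin (φ 1) c q) + q * ∫ y, pot y ∂(ν : Measure M) := by
      refine ge_of_tendsto hR (Eventually.of_forall fun j => ?_)
      have h1 := hest j k c hc hcc q
      have h2 : ψ j * a ≤ Real.log (∑ x ∈ E j, Real.exp (birkhoff φ pot x (ψ j))) := by
        rw [Real.le_log_iff_exp_le (Finset.sum_pos (fun x _ => Real.exp_pos _) (hne j))]
        exact (hE j).2
      simp only [ProbabilityMeasure.coe_mk]
      have h3 : (ψ j : ℝ) * (q * a) ≤ ψ j * (((q:ℝ) + q * q) * Real.log k / (ψ j : ℝ) +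
          Hm (avgM φ (σ j) (ψ j)) (itin (φ 1) c q) + q * ∫ y, pot y ∂(avgM φ (σ j) (ψ j))) := by
        have e : (ψ j : ℝ) * (((q:ℝ) + q * q) * Real.log k / (ψ j : ℝ)) = ((q:ℝ) + q * q) * Real.log k := by
          rw [mul_div_cancel₀ _ (hn0 j).ne']
        have h4 := mul_le_mul_of_nonneg_left h2 (Nat.cast_nonneg (α := ℝ) q)
        rw [mul_add, mul_add, e]
        linarith
      exact le_of_mul_le_mul_left h3 (hn0 j)
    linarith
  have h1 := le_ent hφ hε hexp (ν : Measure M) hν hc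
  have h2 := le_pressure hφ hpot hε hexp (ν : Measure M) hν
  linarith

end Misiu
end CT


set_option linter.all false

namespace CT
section LemC
variable {M : Type*} [MetricSpace M] [CompactSpace M] [MeasurableSpace M] [BorelSpace M]
  {φ : ℝ → M → M} {ε δ : ℝ} {pot : M → ℝ}

theorem misiu_upper (hφ : IsCtsFlow φ) (hpot : Continuous pot) (hε : 0 < ε) (hexp : AlmostExpansive φ ε)
    {γ η : ℝ} (hγ : 0 < γ) (hη : 0 < η) : ∃ N : ℕ, ∀ n ≥ N, ∀ E : Finset M, Sep φ 0 n γ E →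
      ∑ x ∈ E, Real.exp (birkhoff φ pot x n) ≤ Real.exp (n * (pressureOn φ univ pot + η)) := by
  by_contra hc
  push Not at hc
  have : pressureOn φ univ pot + η ≤ pressureOn φ univ pot := by
    refine misiu hφ hpot hε hexp hγ (frequently_atTop.2 fun N => ?_)
    obtain ⟨n, hn, E, hE, h⟩ := hc N
    exact ⟨n, hn, E, hE, h.le⟩
  linarith

theorem exists_crude (hφ : IsCtsFlow φ) (hpot : Continuous pot) {θ : ℝ} (hθ : 0 < θ) :
    ∃ c : ℝ, 0 ≤ c ∧ ∀ (n : ℕ) (F : Finset M), Sep φ 0 n θ F →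
      ∑ x ∈ F, Real.exp (birkhoff φ pot x n) ≤ Real.exp (c * (n + 1)) := by
  obtain ⟨k, hk, hlab⟩ := exists_lab_pow hφ hθ
  obtain ⟨B, hB, hB'⟩ := exists_pot_bound hpot
  have hk0 : (0:ℝ) < k := by exact_mod_cast hk
  refine ⟨Real.log k + B, by have := Real.log_natCast_nonneg k; positivity, fun n F hF => ?_⟩
  have hcard : F.card ≤ k ^ (n + 1) := (hlab n 0).card_le (by rwa [zero_add]) (subset_univ _)
  have h1 : ∑ x ∈ F, Real.exp (birkhoff φ pot x n) ≤ ∑ x ∈ F, Real.exp (B * (n + 1)) := by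
    refine Finset.sum_le_sum fun x _ => Real.exp_le_exp.2 ?_
    have := (le_abs_self _).trans (birkhoff_bound (φ := φ) hB' x n)
    rw [abs_of_nonneg (Nat.cast_nonneg n)] at this
    linarith
  rw [Finset.sum_const, nsmul_eq_mul] at h1
  refine h1.trans ?_
  have : (F.card : ℝ) ≤ Real.exp (Real.log k * (n + 1)) := by
    rw [Real.exp_mul, Real.exp_log hk0]
    have : ((n : ℝ) + 1) = ((n + 1 : ℕ) : ℝ) := by push_cast; ring
    rw [this, Real.rpow_natCast]
    exact_mod_cast hcard
  calc (F.card : ℝ) * Real.exp (B * (n + 1)) ≤ Real.exp (Real.log k * (n + 1)) * Real.exp (B * (n + 1)) := by gcongr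
    _ = _ := by rw [← Real.exp_add]; ring_nf

theorem lemC (hφ : IsCtsFlow φ) (hpot : Continuous pot) (hε : 0 < ε) (hδ : 0 < δ)
    (hexp : AlmostExpansive φ ε) {𝒞 : Set (M × ℝ)} {P : ℝ} (hgap : ctPressure φ pot 𝒞 δ ε < P) :
    ∃ κ > 0, ∀ θ > 0, ∃ C > 0, ∀ (n : ℕ) (F : Finset M), (∀ x ∈ F, (x, (n : ℝ)) ∈ 𝒞) → Sep φ 0 n θ F →
      ∑ x ∈ F, Real.exp (birkhoff φ pot x n) ≤ C * Real.exp (n * (P - κ)) := by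
  classical
  obtain ⟨B, hB, hB'⟩ := exists_pot_bound hpot
  obtain ⟨k, hk, hlab⟩ := exists_lab_pow hφ hε
  have hk0 : (0:ℝ) < k := by exact_mod_cast hk
  have hlogk := Real.log_natCast_nonneg k
  have hset : ∀ t : ℝ, 0 ≤ t → ∀ r ∈ {r : ℝ | ∃ E : Finset M, (↑E : Set M) ⊆ {x : M | (x, t) ∈ 𝒞} ∧
      IsSeparated φ ε t E ∧ r = ∑ x ∈ E, ctWeight φ pot δ x t}, r ≤ Real.exp ((t + 2) * Real.log k + B * t) := by
    rintro t ht r ⟨E, hE, hsep, rfl⟩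
    have hl := (hlab ⌈t⌉₊ 0).mono (subset_univ univ) le_rfl (show t ≤ 0 + (⌈t⌉₊ : ℝ) by rw [zero_add]; exact Nat.le_ceil t)
    have hcard := hl.card_le (sep_iff.2 hsep) (subset_univ _)
    have h1 : ∑ x ∈ E, ctWeight φ pot δ x t ≤ ∑ x ∈ E, Real.exp (B * t) := by
      refine Finset.sum_le_sum fun x _ => Real.exp_le_exp.2 (Real.sSup_le ?_ (by positivity))
      rintro _ ⟨y, _, rfl⟩
      have := (le_abs_self _).trans (birkhoff_bound (φ := φ) hB' y t)
      rwa [abs_of_nonneg ht] at this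
    rw [Finset.sum_const, nsmul_eq_mul] at h1
    refine h1.trans ?_
    rw [Real.exp_add]
    have hc2 : ((⌈t⌉₊ + 1 : ℕ) : ℝ) ≤ t + 2 := by push_cast; linarith [Nat.ceil_lt_add_one ht]
    have : (E.card : ℝ) ≤ Real.exp ((t + 2) * Real.log k) := by
      calc (E.card : ℝ) ≤ (k : ℝ) ^ (⌈t⌉₊ + 1) := by exact_mod_cast hcard
        _ = Real.exp ((⌈t⌉₊ + 1 : ℕ) * Real.log k) := by
            rw [← Real.log_pow, Real.exp_log (by positivity)]
        _ ≤ _ := by gcongr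
    gcongr
  have hps0 : ∀ t : ℝ, 0 ≤ partitionSum φ pot 𝒞 δ ε t := by
    intro t
    refine Real.sSup_nonneg ?_
    rintro r ⟨E, -, -, rfl⟩
    exact Finset.sum_nonneg fun x _ => (Real.exp_pos _).le
  have hbdd : IsBoundedUnder (· ≤ ·) atTop (fun t : ℝ => Real.log (partitionSum φ pot 𝒞 δ ε t) / t) := by
    refine ⟨3 * Real.log k + B, ?_⟩
    rw [eventually_map]
    filter_upwards [eventually_ge_atTop 1] with t ht
    rw [div_le_iff₀ (by linarith)]
    have h1 : partitionSum φ pot 𝒞 δ ε t ≤ Real.exp ((t + 2) * Real.log k + B * t) :=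
      Real.sSup_le (hset t (by linarith)) (Real.exp_pos _).le
    have h2 : Real.log (partitionSum φ pot 𝒞 δ ε t) ≤ (t + 2) * Real.log k + B * t := by
      rcases (hps0 t).eq_or_lt with h0 | h0
      · rw [← h0, Real.log_zero]; positivity
      · have := Real.log_le_log h0 h1
        rwa [Real.log_exp] at this
    nlinarith
  set L := ctPressure φ pot 𝒞 δ ε with hL
  set κ := (P - L) / 3 with hκ
  have hκ0 : 0 < κ := by rw [hκ]; linarith
  have hev := eventually_lt_of_limsup_lt (b := P - 2 * κ) (by
    change L < _
    rw [hκ]; linarith) hbdd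
  obtain ⟨t0, ht0⟩ := eventually_atTop.1 hev
  refine ⟨κ, hκ0, fun θ hθ => ?_⟩
  obtain ⟨N1, hN1⟩ := tail_entropy hφ hexp hκ0 hθ
  obtain ⟨c, hc, hcr⟩ := exists_crude hφ hpot hθ
  set N := max (max N1 ⌈t0⌉₊) 1 with hN
  refine ⟨Real.exp (c * (N + 1) + N * |P - κ|) + 1, by positivity, fun n F hFC hF => ?_⟩
  rcases lt_or_ge n N with hn | hn
  · refine (hcr n F hF).trans ?_
    have : Real.exp (c * (n + 1)) ≤ Real.exp (c * (N + 1) + N * |P - κ|) * Real.exp (n * (P - κ)) := by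
      rw [← Real.exp_add, Real.exp_le_exp]
      have h1 : (n : ℝ) ≤ N := by exact_mod_cast hn.le
      have h2 := neg_abs_le (P - κ)
      have h3 : (0:ℝ) ≤ n := Nat.cast_nonneg n
      nlinarith [abs_nonneg (P - κ), mul_le_mul_of_nonneg_left h1 hc, mul_le_mul_of_nonneg_right h1 (abs_nonneg (P - κ))]
    nlinarith [Real.exp_pos (n * (P - κ))]
  · have hn1 : N1 ≤ n := le_trans (le_trans (le_max_left _ _) (le_max_left _ _)) hn
    have hn2 : t0 ≤ n := (Nat.le_ceil t0).trans (by exact_mod_cast le_trans (le_trans (le_max_right _ _) (le_max_left _ _)) hn)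
    have hn3 : 1 ≤ n := le_trans (le_max_right _ _) hn
    have hn0 : (0:ℝ) < n := by exact_mod_cast hn3
    rcases F.eq_empty_or_nonempty with rfl | hne
    · simp; positivity
    obtain ⟨E, hEF, hEsep, r, hr⟩ := greedy (fun x y => dclose φ 0 n ε x y) (fun x y h => h.symm)
      (fun x => dclose.refl hε.le x) (fun x => birkhoff φ pot x n) F
    have hEps : ∑ x ∈ E, Real.exp (birkhoff φ pot x n) ≤ partitionSum φ pot 𝒞 δ ε n := by
      have h1 : ∑ x ∈ E, Real.exp (birkhoff φ pot x n) ≤ ∑ x ∈ E, ctWeight φ pot δ x n := by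
        refine Finset.sum_le_sum fun x _ => Real.exp_le_exp.2 (le_csSup ?_ ⟨x, ?_, rfl⟩)
        · refine ⟨B * n, ?_⟩
          rintro _ ⟨y, _, rfl⟩
          have := (le_abs_self _).trans (birkhoff_bound (φ := φ) hB' y n)
          rwa [abs_of_nonneg hn0.le] at this
        · intro s _; simpa using hδ.le
      refine h1.trans (le_csSup ⟨_, hset n hn0.le⟩ ⟨E, fun x hx => hFC x (hEF hx), sep_iff.1 hEsep, rfl⟩)
    have hpos : 0 < ∑ x ∈ E, Real.exp (birkhoff φ pot x n) := by
      obtain ⟨x, hx⟩ := hne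
      exact Finset.sum_pos (fun x _ => Real.exp_pos _) ⟨r x, (hr x hx).1⟩
    have hlt := ht0 n hn2
    rw [div_lt_iff₀ hn0] at hlt
    have hps : partitionSum φ pot 𝒞 δ ε n ≤ Real.exp ((P - 2 * κ) * n) :=
      (Real.log_le_iff_le_exp (hpos.trans_le hEps)).1 hlt.le
    have hfib : ∑ x ∈ F, Real.exp (birkhoff φ pot x n) ≤ ∑ e ∈ E, Real.exp (κ * n) * Real.exp (birkhoff φ pot e n) := by
      rw [← Finset.sum_fiberwise_of_maps_to (s := F) (t := E) (g := r) (fun x hx => (hr x hx).1)]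
      refine Finset.sum_le_sum fun e he => ?_
      have h1 : ∑ x ∈ F with r x = e, Real.exp (birkhoff φ pot x n) ≤
          ∑ x ∈ F with r x = e, Real.exp (birkhoff φ pot e n) := by
        refine Finset.sum_le_sum fun x hx => Real.exp_le_exp.2 ?_
        rw [Finset.mem_filter] at hx
        have := (hr x hx.1).2.2
        rwa [hx.2] at this
      refine h1.trans ?_
      rw [Finset.sum_const, nsmul_eq_mul]
      obtain ⟨k', hk', hl⟩ := hN1 n hn1 e
      have := hl.card_le (E := F.filter (fun x => r x = e)) (hF.subset (Finset.filter_subset _ _)) (by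
        intro x hx
        rw [Finset.mem_coe, Finset.mem_filter] at hx
        have := (hr x hx.1).2.1
        rw [hx.2] at this
        exact this.symm)
      have h2 : ((F.filter (fun x => r x = e)).card : ℝ) ≤ k' := by exact_mod_cast this
      have h3 := h2.trans hk'
      gcongr
    rw [← Finset.mul_sum] at hfib
    calc _ ≤ _ := hfib
      _ ≤ Real.exp (κ * n) * Real.exp ((P - 2 * κ) * n) := by gcongr; exact hEps.trans hps
      _ = 1 * Real.exp (n * (P - κ)) := by rw [← Real.exp_add]; ring_nf
      _ ≤ _ := by gcongr; linarith [Real.exp_pos (c * (N + 1) + N * |P - κ|)]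

end LemC
end CT


set_option linter.all false

namespace CT
section LemG
variable {M : Type*} [MetricSpace M] [CompactSpace M] [MeasurableSpace M] [BorelSpace M]
  {φ : ℝ → M → M} {ε δ : ℝ} {pot : M → ℝ}

/-- specification with natural number indexing -/
def SpecT (φ : ℝ → M → M) (𝒢 : Set (M × ℝ)) (δ T : ℝ) : Prop :=
  ∀ (n : ℕ) (x : ℕ → M) (t : ℕ → ℝ), (∀ i < n, (x i, t i) ∈ 𝒢 ∧ T ≤ t i) →
    ∃ (y : M) (τ : ℕ → ℝ), (∀ i, τ i ∈ Icc (0:ℝ) T) ∧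
      ∀ i < n, ∀ u ∈ Icc (0:ℝ) (t i),
        dist (φ ((∑ j ∈ Finset.range i, (t j + τ j)) + u) y) (φ u (x i)) ≤ δ

theorem exists_specT {𝒢 : Set (M × ℝ)} (h : HasTailSpecification φ 𝒢 δ) :
    ∃ T > 0, SpecT φ 𝒢 δ T := by
  obtain ⟨T, hT, h⟩ := h
  refine ⟨T, hT, fun n x t hxt => ?_⟩
  obtain ⟨y, τ, hτ, hy⟩ := h n (fun i => x i) (fun i => t i) (fun i => (hxt i i.2).1) (fun i => (hxt i i.2).2)
  refine ⟨y, fun i => if h : i < n then τ ⟨i, h⟩ else 0, fun i => ?_, fun i hi u hu => ?_⟩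
  · by_cases h : i < n
    · beta_reduce; rw [dif_pos h]; exact hτ _
    · beta_reduce; rw [dif_neg h]; exact ⟨le_rfl, hT.le⟩
  · have := hy ⟨i, hi⟩ u hu
    have e : ∑ j ∈ Finset.range i, (t j + if h : j < n then τ ⟨j, h⟩ else 0) =
        ∑ j ∈ Finset.Iio (⟨i, hi⟩ : Fin n), (t j + τ j) := by
      have hm : Finset.range i = (Finset.Iio (⟨i, hi⟩ : Fin n)).map Fin.valEmbedding := by
        rw [Fin.map_valEmbedding_Iio]; ext; simp
      rw [hm, Finset.sum_map]
      refine Finset.sum_congr rfl fun j _ => ?_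
      simp
    rw [e]; exact this

/-- Bowen property with constant -/
def BowK (φ : ℝ → M → M) (pot : M → ℝ) (ε : ℝ) (𝒢 : Set (M × ℝ)) (K : ℝ) : Prop :=
  ∀ x t, (x, t) ∈ 𝒢 → ∀ y, dclose φ 0 t ε x y → |birkhoff φ pot x t - birkhoff φ pot y t| ≤ K

theorem exists_bowK (hφ : IsCtsFlow φ) (hpot : Continuous pot) {𝒢 : Set (M × ℝ)}
    (h : HasBowenProperty φ pot ε 𝒢) : ∃ K > 0, BowK φ pot ε 𝒢 K := by
  obtain ⟨K, hK, h⟩ := h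
  refine ⟨K, hK, fun x t hx y hy => ?_⟩
  rw [birkhoff_sub hφ hpot]
  exact h (x, t) hx y hy

theorem birk_lower {B : ℝ} (hB : ∀ x, |pot x| ≤ B) (x : M) {t : ℝ} (ht : 0 ≤ t) :
    -(B * t) ≤ birkhoff φ pot x t := by
  have := neg_abs_le (birkhoff φ pot x t)
  have h2 := birkhoff_bound (φ := φ) hB x t
  rw [abs_of_nonneg ht] at h2
  linarith

theorem birk_upper {B : ℝ} (hB : ∀ x, |pot x| ≤ B) (x : M) {t : ℝ} (ht : 0 ≤ t) :
    birkhoff φ pot x t ≤ B * t := by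
  have := le_abs_self (birkhoff φ pot x t)
  have h2 := birkhoff_bound (φ := φ) hB x t
  rw [abs_of_nonneg ht] at h2
  linarith

theorem glue_birk (hφ : IsCtsFlow φ) (hpot : Continuous pot) {B : ℝ} (hB0 : 0 ≤ B) (hB : ∀ x, |pot x| ≤ B)
    {t τ W : ℕ → ℝ} {T : ℝ} (hτ : ∀ i, τ i ∈ Icc (0:ℝ) T) (y : M) (n : ℕ)
    (hW : ∀ i < n, W i ≤ birkhoff φ pot (φ (∑ j ∈ Finset.range i, (t j + τ j)) y) (t i)) :
    ∑ i ∈ Finset.range n, (W i - B * T) ≤ birkhoff φ pot y (∑ j ∈ Finset.range n, (t j + τ j)) := by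
  induction n with
  | zero => simp [birkhoff_zero]
  | succ n ih =>
    rw [Finset.sum_range_succ, Finset.sum_range_succ _ n, birkhoff_add hφ hpot, birkhoff_add hφ hpot]
    have h1 := ih (fun i hi => hW i (by omega))
    have h2 := hW n (by omega)
    have h3 := birk_lower (φ := φ) hB (φ (t n) (φ (∑ j ∈ Finset.range n, (t j + τ j)) y)) (hτ n).1
    have h4 := mul_le_mul_of_nonneg_left (hτ n).2 hB0
    linarith

theorem pigeon {α β : Type*} [DecidableEq β] {s : Finset α} {t : Finset β} {f : α → β} {w : α → ℝ} {Q : ℝ}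
    (hf : ∀ a ∈ s, f a ∈ t) (hw : ∀ a ∈ s, 0 ≤ w a) (hne : t.Nonempty) (hQ : (t.card : ℝ) ≤ Q) :
    ∃ b ∈ t, ∑ a ∈ s, w a ≤ Q * ∑ a ∈ s with f a = b, w a := by
  obtain ⟨b, hb, hmax⟩ := Finset.exists_max_image t (fun b => ∑ a ∈ s with f a = b, w a) hne
  refine ⟨b, hb, ?_⟩
  rw [← Finset.sum_fiberwise_of_maps_to hf]
  refine (Finset.sum_le_card_nsmul _ _ _ hmax).trans ?_
  rw [nsmul_eq_mul]
  refine mul_le_mul_of_nonneg_right hQ (Finset.sum_nonneg fun a ha => hw a (Finset.mem_filter.1 ha).1)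

/-- one step: lower bound of the glued sum -/
theorem lemG_step (hφ : IsCtsFlow φ) (hpot : Continuous pot) (hδ : 0 < δ) (hδε : δ ≤ ε)
    {𝒢 : Set (M × ℝ)} {T K B ζ : ℝ} (hT : 0 < T) (hK : 0 < K) (hspec : SpecT φ 𝒢 δ T)
    (hbow : BowK φ pot ε 𝒢 K) (hB0 : 0 < B) (hB : ∀ x, |pot x| ≤ B) (hζ : 0 < ζ)
    (hζ' : ∀ u : ℝ, |u| ≤ ζ → ∀ x : M, dist (φ u x) x ≤ δ)
    (A m : ℕ) (F : Finset M) (p g : M → ℝ)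
    (hp : ∀ f ∈ F, p f ∈ Icc ((A:ℝ) - 1) A) (hg : ∀ f ∈ F, p f + g f ∈ Icc ((A:ℝ) + m) (A + m + 1))
    (hG : ∀ f ∈ F, (φ (p f) f, g f) ∈ 𝒢 ∧ T ≤ g f) (hsep : Sep φ A (A + m) (4 * δ) F)
    (hne : F.Nonempty) (n : ℕ) (hn : 1 ≤ n) :
    ∃ E : Finset M, Sep φ 0 (⌈(n:ℝ) * (m + T + 2)⌉₊ + 1 : ℕ) δ E ∧
      (∑ f ∈ F, Real.exp (birkhoff φ pot (φ A f) m)) ^ n ≤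
      ((⌊(T + 2) / ζ⌋₊ + 3 : ℕ) * Real.exp (K + 2 * B * T + 6 * B)) ^ n *
        ∑ y ∈ E, Real.exp (birkhoff φ pot y (⌈(n:ℝ) * (m + T + 2)⌉₊ + 1 : ℕ)) := by
  classical
  obtain ⟨f0, hf0⟩ := hne
  haveI : Nonempty M := ⟨f0⟩
  set N : ℕ := ⌈(n:ℝ) * (m + T + 2)⌉₊ + 1 with hN
  set Q : ℕ := ⌊(T + 2) / ζ⌋₊ + 2 with hQ
  set X : Finset (Fin n → M) := Fintype.piFinset (fun _ : Fin n => F) with hX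
  let ex : (Fin n → M) → ℕ → M := fun f i => if h : i < n then f ⟨i, h⟩ else f0
  have hex : ∀ f ∈ X, ∀ i, ex f i ∈ F := by
    intro f hf i
    simp only [ex]
    split_ifs with h
    · exact (Fintype.mem_piFinset.1 hf) _
    · exact hf0
  have hex' : ∀ f ∈ X, ∃ (y : M) (τ : ℕ → ℝ), (∀ i, τ i ∈ Icc (0:ℝ) T) ∧
      ∀ i < n, ∀ u ∈ Icc (0:ℝ) (g (ex f i)),
        dist (φ ((∑ j ∈ Finset.range i, (g (ex f j) + τ j)) + u) y) (φ u (φ (p (ex f i)) (ex f i))) ≤ δ :=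
    fun f hf => hspec n (fun i => φ (p (ex f i)) (ex f i)) (fun i => g (ex f i)) (fun i _ => hG _ (hex f hf i))
  choose! Y τ hτ hY using hex'
  let S : (Fin n → M) → ℕ → ℝ := fun f i => ∑ j ∈ Finset.range i, (g (ex f j) + τ f j)
  let a : (Fin n → M) → ℕ → ℝ := fun f i => S f i + A - p (ex f i)
  have hinc : ∀ f ∈ X, ∀ i, a f (i + 1) - a f i - m ∈ Icc (0:ℝ) (T + 2) := by
    intro f hf i
    have h1 := hp _ (hex f hf i)
    have h2 := hp _ (hex f hf (i + 1))
    have h3 := hg _ (hex f hf i)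
    have h4 := hτ f hf i
    simp only [a, S, Finset.sum_range_succ]
    constructor <;> linarith [h1.1, h1.2, h2.1, h2.2, h3.1, h3.2, h4.1, h4.2]
  have ha0 : ∀ f ∈ X, a f 0 ∈ Icc (0:ℝ) 1 := by
    intro f hf
    have h1 := hp _ (hex f hf 0)
    simp only [a, S, Finset.range_zero, Finset.sum_empty]
    constructor <;> linarith [h1.1, h1.2]
  have hale : ∀ f ∈ X, ∀ i : ℕ, a f i ∈ Icc (0:ℝ) (1 + i * (m + T + 2)) := by
    intro f hf i
    induction i with
    | zero => simpa using ha0 f hf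
    | succ i ih =>
      have h1 := hinc f hf i
      have h2 : (0:ℝ) ≤ m := Nat.cast_nonneg m
      push_cast
      constructor <;> linarith [h1.1, h1.2, ih.1, ih.2]
  -- tracking
  have htrack : ∀ f ∈ X, ∀ i < n, ∀ v ∈ Icc (0:ℝ) m, dist (φ (a f i + v) (Y f)) (φ (A + v) (ex f i)) ≤ δ := by
    intro f hf i hi v hv
    have h1 := hp _ (hex f hf i)
    have h3 := hg _ (hex f hf i)
    have := hY f hf i hi (A - p (ex f i) + v) ⟨by linarith [h1.2, hv.1], by linarith [h3.1, hv.2]⟩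
    rw [← flow_add hφ] at this
    convert this using 3
    · simp only [a, S]; ring
    · ring
  -- the codes
  let code : (Fin n → M) → (Fin n → ℤ) := fun f i => ⌊a f i / ζ⌋ -
    (if (i : ℕ) = 0 then 0 else ⌊a f (i - 1) / ζ⌋ + ⌊(m:ℝ) / ζ⌋)
  have hcode : ∀ f ∈ X, code f ∈ Fintype.piFinset (fun _ : Fin n => Finset.Icc (0:ℤ) Q) := by
    intro f hf
    rw [Fintype.mem_piFinset]
    intro i
    rw [Finset.mem_Icc]
    simp only [code]
    have hQ' : ∀ z : ℝ, z ≤ (T + 2) / ζ → ⌊z⌋ ≤ (⌊(T + 2) / ζ⌋₊ : ℤ) := by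
      intro z hz
      rw [Int.natCast_floor_eq_floor (by positivity)]
      exact Int.floor_le_floor hz
    rcases i with ⟨i, hi⟩
    rcases i with _ | i
    · have h0 := ha0 f hf
      simp only [if_true, sub_zero]
      constructor
      · exact Int.floor_nonneg.2 (div_nonneg h0.1 hζ.le)
      · have := hQ' (a f 0 / ζ) (by gcongr; linarith [h0.2])
        rw [hQ]; push_cast; omega
    · have h1 := hinc f hf i
      simp only [Nat.add_sub_cancel, Nat.succ_ne_zero, if_false]
      have e : a f (i + 1) / ζ = a f i / ζ + m / ζ + (a f (i + 1) - a f i - m) / ζ := by field_simp; ring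
      have hz0 : 0 ≤ (a f (i + 1) - a f i - m) / ζ := div_nonneg h1.1 hζ.le
      have hz1 : (a f (i + 1) - a f i - m) / ζ ≤ (T + 2) / ζ := by gcongr; exact h1.2
      have b1 := Int.floor_le (a f i / ζ)
      have b2 := Int.floor_le ((m:ℝ) / ζ)
      have b3 := Int.lt_floor_add_one (a f i / ζ)
      have b4 := Int.lt_floor_add_one ((m:ℝ) / ζ)
      constructor
      · have : ⌊a f i / ζ⌋ + ⌊(m:ℝ) / ζ⌋ ≤ ⌊a f (i + 1) / ζ⌋ := by
          rw [Int.le_floor]; push_cast; linarith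
        omega
      · have : ⌊a f (i + 1) / ζ⌋ < ⌊a f i / ζ⌋ + ⌊(m:ℝ) / ζ⌋ + (Q + 1 : ℤ) := by
          rw [Int.floor_lt]
          rw [hQ]; push_cast
          have := Nat.lt_floor_add_one ((T + 2) / ζ)
          linarith
        omega
  have hcodeeq : ∀ f ∈ X, ∀ f' ∈ X, code f = code f' → ∀ i < n, ⌊a f i / ζ⌋ = ⌊a f' i / ζ⌋ := by
    intro f hf f' hf' h i hi
    induction i with
    | zero => simpa [code] using congrFun h ⟨0, hi⟩
    | succ i ih =>
      have := congrFun h ⟨i + 1, hi⟩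
      simp only [code, Nat.add_sub_cancel, Nat.succ_ne_zero, if_false] at this
      rw [ih (by omega)] at this
      omega
  -- injectivity
  have hlast : ∀ f ∈ X, ∀ i < n, a f i + m ≤ N := by
    intro f hf i hi
    have h1 := (hale f hf i).2
    have h2 : (i : ℝ) + 1 ≤ n := by exact_mod_cast hi
    have h3 := Nat.le_ceil ((n:ℝ) * (m + T + 2))
    rw [hN]; push_cast
    have h4 : ((i:ℝ) + 1) * (m + T + 2) ≤ n * (m + T + 2) := by gcongr
    nlinarith
  have hinj : ∀ f ∈ X, ∀ f' ∈ X, code f = code f' → dclose φ 0 N δ (Y f) (Y f') → f = f' := by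
    intro f hf f' hf' hc hcl
    have hce := hcodeeq f hf f' hf' hc
    funext i
    have hi := i.2
    have e1 : ex f i = f i := by simp [ex]
    have e2 : ex f' i = f' i := by simp [ex]
    have m1 := hex f hf i
    have m2 := hex f' hf' i
    rw [← e1, ← e2]
    refine hsep _ m1 _ m2 ?_
    intro v hv
    have hv' : v - A ∈ Icc (0:ℝ) m := ⟨by linarith [hv.1], by linarith [hv.2]⟩
    have t1 := htrack f hf i hi (v - A) hv'
    have t2 := htrack f' hf' i hi (v - A) hv'
    have hr := hale f hf i
    have hl := hlast f hf i hi
    have t3 := hcl (a f i + (v - A)) ⟨by linarith [hr.1, hv'.1], by linarith [hv'.2]⟩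
    have hab : |a f i - a f' i| ≤ ζ := by
      have := Int.abs_sub_lt_one_of_floor_eq_floor (hce i hi)
      rw [← sub_div, abs_div, abs_of_pos hζ, div_lt_one hζ] at this
      exact this.le
    have t4 := hζ' _ hab (φ (a f' i + (v - A)) (Y f'))
    rw [← flow_add hφ] at t4
    rw [show a f i - a f' i + (a f' i + (v - A)) = a f i + (v - A) by ring] at t4
    rw [show (A:ℝ) + (v - A) = v by ring] at t1 t2
    have q1 := dist_triangle (φ v (ex f i)) (φ (a f i + (v - A)) (Y f)) (φ v (ex f' i))
    have q2 := dist_triangle (φ (a f i + (v - A)) (Y f)) (φ (a f i + (v - A)) (Y f')) (φ v (ex f' i))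
    have q3 := dist_triangle (φ (a f i + (v - A)) (Y f')) (φ (a f' i + (v - A)) (Y f')) (φ v (ex f' i))
    rw [dist_comm (φ v (ex f i)) (φ (a f i + (v - A)) (Y f))] at q1
    linarith
  -- weights
  have hweight : ∀ f ∈ X, ∑ i : Fin n, birkhoff φ pot (φ A (f i)) m ≤
      birkhoff φ pot (Y f) N + n * (K + 2 * B * T + 6 * B) := by
    intro f hf
    have hW : ∀ i < n, birkhoff φ pot (φ A (ex f i)) m - 2 * B - K ≤
        birkhoff φ pot (φ (S f i) (Y f)) (g (ex f i)) := by
      intro i hi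
      have h1 := hp _ (hex f hf i)
      have h3 := hg _ (hex f hf i)
      have hb := hbow _ _ (hG _ (hex f hf i)).1 (φ (S f i) (Y f)) (fun u hu => by
        have := hY f hf i hi u hu
        rw [dist_comm, ← flow_add hφ, add_comm u]
        exact this.trans hδε)
      have e : g (ex f i) = (A - p (ex f i)) + (m + (p (ex f i) + g (ex f i) - A - m)) := by ring
      have hsplit : birkhoff φ pot (φ (p (ex f i)) (ex f i)) (g (ex f i)) =
          birkhoff φ pot (φ (p (ex f i)) (ex f i)) (A - p (ex f i)) + (birkhoff φ pot (φ A (ex f i)) m +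
            birkhoff φ pot (φ m (φ A (ex f i))) (p (ex f i) + g (ex f i) - A - m)) := by
        conv_lhs => rw [e]
        rw [birkhoff_add hφ hpot, ← flow_add hφ, sub_add_cancel, birkhoff_add hφ hpot]
      have l1 := birk_lower (φ := φ) hB (φ (p (ex f i)) (ex f i)) (t := A - p (ex f i)) (by linarith [h1.2])
      have l2 := birk_lower (φ := φ) hB (φ m (φ A (ex f i))) (t := p (ex f i) + g (ex f i) - A - m) (by linarith [h3.1])
      have l3 : B * (A - p (ex f i)) ≤ B * 1 := by gcongr; linarith [h1.1]
      have l4 : B * (p (ex f i) + g (ex f i) - A - m) ≤ B * 1 := by gcongr; linarith [h3.2]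
      have := (abs_le.1 hb).2
      linarith
    have hgl := glue_birk hφ hpot hB0.le hB (hτ f hf) (Y f) n hW
    have hSn1 : (n:ℝ) * m ≤ S f n := by
      have : ∑ j ∈ Finset.range n, (m:ℝ) ≤ S f n := by
        refine Finset.sum_le_sum fun j _ => ?_
        have h1 := hp _ (hex f hf j)
        have h3 := hg _ (hex f hf j)
        have h4 := hτ f hf j
        linarith [h1.1, h1.2, h3.1, h4.1]
      simpa using this
    have hSn2 : S f n ≤ n * (m + T + 2) := by
      have : S f n ≤ ∑ j ∈ Finset.range n, ((m:ℝ) + T + 2) := by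
        refine Finset.sum_le_sum fun j _ => ?_
        have h1 := hp _ (hex f hf j)
        have h3 := hg _ (hex f hf j)
        have h4 := hτ f hf j
        linarith [h1.1, h1.2, h3.2, h4.2]
      rw [Finset.sum_const, Finset.card_range, nsmul_eq_mul] at this
      exact this
    have hN1 : (n:ℝ) * (m + T + 2) ≤ N := by
      rw [hN]; push_cast
      linarith [Nat.le_ceil ((n:ℝ) * (m + T + 2))]
    have hN2 : (N:ℝ) ≤ n * (m + T + 2) + 2 := by
      rw [hN]; push_cast
      linarith [Nat.ceil_lt_add_one (show 0 ≤ (n:ℝ) * (m + T + 2) by positivity)]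
    have hsp : birkhoff φ pot (Y f) N = birkhoff φ pot (Y f) (S f n) + birkhoff φ pot (φ (S f n) (Y f)) (N - S f n) := by
      rw [← birkhoff_add hφ hpot]; congr 1; ring
    have l5 := birk_lower (φ := φ) hB (φ (S f n) (Y f)) (t := N - S f n) (by linarith)
    have hn1 : (1:ℝ) ≤ n := by exact_mod_cast hn
    have l6 : B * (N - S f n) ≤ B * (n * (T + 4)) := by
      gcongr
      nlinarith
    have e2 : ∑ i : Fin n, birkhoff φ pot (φ A (f i)) m = ∑ i ∈ Finset.range n, birkhoff φ pot (φ A (ex f i)) m := by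
      rw [Finset.sum_range]
      refine Finset.sum_congr rfl fun i _ => ?_
      simp [ex]
    have e3 : ∑ i ∈ Finset.range n, (birkhoff φ pot (φ A (ex f i)) m - 2 * B - K - B * T) =
        ∑ i ∈ Finset.range n, birkhoff φ pot (φ A (ex f i)) m - n * (2 * B + K + B * T) := by
      simp only [Finset.sum_sub_distrib, Finset.sum_const, Finset.card_range, nsmul_eq_mul]; ring
    rw [e3] at hgl
    change _ ≤ birkhoff φ pot (Y f) (S f n) at hgl
    rw [e2, hsp]
    nlinarith
  -- pigeonhole
  have hpow : (∑ f ∈ F, Real.exp (birkhoff φ pot (φ A f) m)) ^ n =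
      ∑ f ∈ X, Real.exp (∑ i : Fin n, birkhoff φ pot (φ A (f i)) m) := by
    have := Finset.prod_univ_sum (fun _ : Fin n => F) (fun _ f => Real.exp (birkhoff φ pot (φ A f) m))
    rw [Finset.prod_const, Finset.card_univ, Fintype.card_fin] at this
    rw [this]
    refine Finset.sum_congr rfl fun f _ => ?_
    rw [Real.exp_sum]
  obtain ⟨b, -, hb⟩ := pigeon (w := fun f => Real.exp (∑ i : Fin n, birkhoff φ pot (φ A (f i)) m)) (Q := ((Q + 1 : ℕ):ℝ) ^ n)
    hcode (fun f _ => (Real.exp_pos _).le)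
    ⟨fun _ => 0, by rw [Fintype.mem_piFinset]; intro i; rw [Finset.mem_Icc]; exact ⟨le_rfl, by positivity⟩⟩ (by
      rw [Fintype.card_piFinset_const, Int.card_Icc]
      simp)
  set X' := X.filter (fun f => code f = b) with hX'
  refine ⟨X'.image Y, ?_, ?_⟩
  · intro y hy y' hy' hcl
    rw [Finset.mem_image] at hy hy'
    obtain ⟨f, hf, rfl⟩ := hy
    obtain ⟨f', hf', rfl⟩ := hy'
    rw [hX', Finset.mem_filter] at hf hf'
    rw [hinj f hf.1 f' hf'.1 (hf.2.trans hf'.2.symm) hcl]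
  · rw [Finset.sum_image (fun f hf f' hf' h => by
      rw [Finset.mem_coe, hX', Finset.mem_filter] at hf hf'
      exact hinj f hf.1 f' hf'.1 (hf.2.trans hf'.2.symm) (by rw [h]; exact dclose.refl hδ.le _))]
    rw [hpow]
    refine hb.trans ?_
    rw [mul_pow, mul_assoc, ← Real.exp_nat_mul]
    have : Q + 1 = ⌊(T + 2) / ζ⌋₊ + 3 := by omega
    rw [this]
    refine mul_le_mul_of_nonneg_left ?_ (by positivity)
    rw [Finset.mul_sum]
    refine Finset.sum_le_sum fun f hf => ?_
    rw [hX', Finset.mem_filter] at hf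
    rw [← Real.exp_add, Real.exp_le_exp]
    have := hweight f hf.1
    linarith

theorem lemG (hφ : IsCtsFlow φ) (hpot : Continuous pot) (hε : 0 < ε) (hδ : 0 < δ) (hδε : δ ≤ ε)
    (hexp : AlmostExpansive φ ε) {𝒢 : Set (M × ℝ)} {T K : ℝ} (hT : 0 < T) (hK : 0 < K)
    (hspec : SpecT φ 𝒢 δ T) (hbow : BowK φ pot ε 𝒢 K) :
    ∃ C > 0, ∀ (A m : ℕ) (F : Finset M) (p g : M → ℝ),
    (∀ f ∈ F, p f ∈ Icc ((A:ℝ) - 1) A) → (∀ f ∈ F, p f + g f ∈ Icc ((A:ℝ) + m) (A + m + 1)) →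
    (∀ f ∈ F, (φ (p f) f, g f) ∈ 𝒢 ∧ T ≤ g f) → Sep φ A (A + m) (4 * δ) F →
    ∑ f ∈ F, Real.exp (birkhoff φ pot (φ A f) m) ≤ C * Real.exp (m * pressureOn φ univ pot) := by
  obtain ⟨B, hB0, hB⟩ := exists_pot_bound hpot
  obtain ⟨ζ, hζ, hζ'⟩ := exists_small_time hφ hδ
  set P := pressureOn φ univ pot
  set C0 : ℝ := (⌊(T + 2) / ζ⌋₊ + 3 : ℕ) * Real.exp (K + 2 * B * T + 6 * B) with hC0
  have hC0p : 0 < C0 := by positivity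
  refine ⟨C0 * Real.exp (1 + (T + 4) * (|P| + 1)), by positivity, fun A m F p g hp hg hG hsep => ?_⟩
  rcases F.eq_empty_or_nonempty with rfl | hne
  · simp; positivity
  set η : ℝ := 1 / ((m:ℝ) + 1) with hη
  have hη0 : 0 < η := by positivity
  have hη1 : η ≤ 1 := by rw [hη, div_le_one (by positivity)]; linarith [Nat.cast_nonneg (α := ℝ) m]
  have hηm : m * η ≤ 1 := by
    rw [hη, mul_one_div, div_le_one (by positivity)]; linarith
  obtain ⟨N0, hN0⟩ := misiu_upper hφ hpot hε hexp hδ hη0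
  set n := N0 + 1 with hn
  obtain ⟨E, hE, hle⟩ := lemG_step hφ hpot hδ hδε hT hK hspec hbow hB0 hB hζ hζ' A m F p g hp hg hG hsep hne n (by omega)
  set N : ℕ := ⌈(n:ℝ) * (m + T + 2)⌉₊ + 1 with hN
  have hn1 : (1:ℝ) ≤ n := by rw [hn]; push_cast; linarith [Nat.cast_nonneg (α := ℝ) N0]
  have hm0 : (0:ℝ) ≤ m := Nat.cast_nonneg m
  have hN1 : (n:ℝ) * (m + T + 2) ≤ N := by
    rw [hN]; push_cast
    linarith [Nat.le_ceil ((n:ℝ) * (m + T + 2))]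
  have hN2 : (N:ℝ) ≤ n * (m + T + 2) + 2 := by
    rw [hN]; push_cast
    linarith [Nat.ceil_lt_add_one (show 0 ≤ (n:ℝ) * (m + T + 2) by positivity)]
  have hNn : N0 ≤ N := by
    have : (n:ℝ) ≤ N := by nlinarith
    have : n ≤ N := by exact_mod_cast this
    omega
  have h1 := hN0 N hNn E hE
  have h2 : (N:ℝ) * (P + η) ≤ n * (1 + (T + 4) * (|P| + 1) + m * P) := by
    have e : (N:ℝ) * (P + η) = n * m * P + n * (m * η) + (N - n * m) * (P + η) := by ring
    have i1 : (N - n * m) * (P + η) ≤ (N - n * m) * (|P| + 1) := by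
      gcongr
      · nlinarith
      · exact le_abs_self P
    have i2 : (N - n * m) * (|P| + 1) ≤ (n * (T + 4)) * (|P| + 1) := by
      gcongr
      nlinarith
    nlinarith
  have h3 : (∑ f ∈ F, Real.exp (birkhoff φ pot (φ A f) m)) ^ n ≤
      (C0 * Real.exp (1 + (T + 4) * (|P| + 1) + m * P)) ^ n := by
    rw [mul_pow, ← Real.exp_nat_mul]
    refine hle.trans ?_
    rw [hC0]
    gcongr
    exact h1.trans (Real.exp_le_exp.2 h2)
  have h4 := le_of_pow_le_pow_left₀ (by omega) (by positivity) h3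
  rw [Real.exp_add, ← mul_assoc] at h4
  exact h4

end LemG
end CT


set_option linter.all false

namespace CT
section LemU
variable {M : Type*} [MetricSpace M] [CompactSpace M] [MeasurableSpace M] [BorelSpace M]
  {φ : ℝ → M → M} {ε δ : ℝ} {pot : M → ℝ}

theorem prod3 {α : Type*} {X F1 F2 F3 : Finset α} {r1 r2 r3 : α → α} {W w1 w2 w3 : α → ℝ} {c : ℝ}
    (h1 : ∀ x ∈ X, r1 x ∈ F1) (h2 : ∀ x ∈ X, r2 x ∈ F2) (h3 : ∀ x ∈ X, r3 x ∈ F3)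
    (hinj : ∀ x ∈ X, ∀ y ∈ X, r1 x = r1 y → r2 x = r2 y → r3 x = r3 y → x = y)
    (hW : ∀ x ∈ X, W x ≤ w1 (r1 x) + w2 (r2 x) + w3 (r3 x) + c) :
    ∑ x ∈ X, Real.exp (W x) ≤ Real.exp c * ((∑ x ∈ F1, Real.exp (w1 x)) * (∑ x ∈ F2, Real.exp (w2 x)) *
      (∑ x ∈ F3, Real.exp (w3 x))) := by
  classical
  rw [Finset.sum_mul_sum, ← Finset.sum_product', Finset.sum_mul_sum, ← Finset.sum_product', Finset.mul_sum]
  set V : (α × α) × α → ℝ := fun z => Real.exp c * (Real.exp (w1 z.1.1) * Real.exp (w2 z.1.2) * Real.exp (w3 z.2)) with hV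
  have hle : ∑ x ∈ X, Real.exp (W x) ≤ ∑ x ∈ X, V ((r1 x, r2 x), r3 x) := by
    refine Finset.sum_le_sum fun x hx => ?_
    simp only [hV]
    rw [← Real.exp_add, ← Real.exp_add, ← Real.exp_add]
    exact Real.exp_le_exp.2 (by linarith [hW x hx])
  refine hle.trans ?_
  rw [← Finset.sum_image (f := V) (g := fun x => ((r1 x, r2 x), r3 x)) (s := X) (fun x hx y hy h => by
    simp only [Prod.mk.injEq] at h
    exact hinj x hx y hy h.1.1 h.1.2 h.2)]
  refine Finset.sum_le_sum_of_subset_of_nonneg ?_ (fun z _ _ => by simp only [hV]; positivity)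
  intro z hz
  obtain ⟨x, hx, rfl⟩ := Finset.mem_image.1 hz
  exact Finset.mem_product.2 ⟨Finset.mem_product.2 ⟨h1 x hx, h2 x hx⟩, h3 x hx⟩

set_option maxHeartbeats 1000000 in
open Classical in
theorem lemU1 (hφ : IsCtsFlow φ) (hpot : Continuous pot) (hε : 0 < ε) (hδ : 0 < δ) (hδε : δ ≤ ε)
    (hexp : AlmostExpansive φ ε) {𝒟 Pc 𝒢 𝒮 : Set (M × ℝ)} {p g s : M × ℝ → ℝ}
    (hdec : IsDecomposition φ 𝒟 Pc 𝒢 𝒮 p g s) {T K : ℝ} (hT : 0 < T) (hK : 0 < K)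
    (hspec : SpecT φ 𝒢 δ T) (hbow : BowK φ pot ε 𝒢 K)
    (hgap : ctPressure φ pot (segComplement 𝒟 ∪ discretize φ Pc ∪ discretize φ 𝒮) δ ε <
      pressureOn φ univ pot) :
    ∃ κ > 0, ∃ C > 0, ∀ (t : ℕ) (E : Finset M), Sep φ 0 t (10 * δ) E →
      (∑ e ∈ E with (e, (t:ℝ)) ∉ 𝒟, Real.exp (birkhoff φ pot e t) ≤
        C * Real.exp (t * pressureOn φ univ pot - κ * t)) ∧
      ∀ i k : ℕ, ∑ e ∈ E with (e, (t:ℝ)) ∈ 𝒟 ∧ ⌊p (e, (t:ℝ))⌋₊ = i ∧ ⌊s (e, (t:ℝ))⌋₊ = k,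
        Real.exp (birkhoff φ pot e t) ≤ C * Real.exp (t * pressureOn φ univ pot - κ * (i + k)) := by
  obtain ⟨κ, hκ, hC⟩ := lemC hφ hpot hε hδ hexp hgap
  obtain ⟨C1, hC1, hC1'⟩ := hC (4 * δ) (by positivity)
  obtain ⟨C2, hC2, hC2'⟩ := lemG hφ hpot hε hδ hδε hexp hT hK hspec hbow
  obtain ⟨B, hB0, hB⟩ := exists_pot_bound hpot
  obtain ⟨L, hL, hLab⟩ := exists_lab_pow hφ (show 0 < 8 * δ by positivity)
  set P := pressureOn φ univ pot with hP
  set J : ℕ := ⌈T⌉₊ + 4 with hJ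
  have hJT : T + 4 ≤ J := by rw [hJ]; push_cast; linarith [Nat.le_ceil T]
  set D1 : ℝ := (L:ℝ) ^ (J + 1) * Real.exp (B * J + J * |P|) * C1 * C1 with hD1
  set D2 : ℝ := ((L:ℝ) ^ 2 * (L:ℝ) ^ 2) * Real.exp (2 * B + 2 * |P|) * C1 * C1 * C2 with hD2
  have hL0 : (0:ℝ) < L := by exact_mod_cast hL
  have hD1p : 0 < D1 := by positivity
  have hD2p : 0 < D2 := by positivity
  refine ⟨κ, hκ, C1 + D1 + D2, by positivity, fun t E hE => ⟨?_, fun i k => ?_⟩⟩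
  · have h := hC1' t (E.filter (fun e => (e, (t:ℝ)) ∉ 𝒟)) (fun x hx => by
      left; left; exact ⟨Nat.cast_nonneg t, (Finset.mem_filter.1 hx).2⟩)
      ((hE.mono le_rfl le_rfl (by linarith)).subset (Finset.filter_subset _ _))
    refine h.trans ?_
    rw [mul_sub, mul_comm (t:ℝ) κ]
    gcongr
    linarith
  set E' := E.filter (fun e => (e, (t:ℝ)) ∈ 𝒟 ∧ ⌊p (e, (t:ℝ))⌋₊ = i ∧ ⌊s (e, (t:ℝ))⌋₊ = k) with hE'
  have hsub : E' ⊆ E := Finset.filter_subset _ _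
  have hE1 : ∀ e ∈ E', ((i:ℝ) ≤ p (e, (t:ℝ)) ∧ p (e, (t:ℝ)) < i + 1) ∧ ((k:ℝ) ≤ s (e, (t:ℝ)) ∧ s (e, (t:ℝ)) < k + 1) ∧
      0 ≤ g (e, (t:ℝ)) ∧ (t:ℝ) = p (e, (t:ℝ)) + g (e, (t:ℝ)) + s (e, (t:ℝ)) ∧ (e, p (e, (t:ℝ))) ∈ Pc ∧
      (φ (p (e, (t:ℝ))) e, g (e, (t:ℝ))) ∈ 𝒢 ∧ (φ (p (e, (t:ℝ)) + g (e, (t:ℝ))) e, s (e, (t:ℝ))) ∈ 𝒮 := by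
    intro e he
    rw [hE', Finset.mem_filter] at he
    obtain ⟨he1, he2, he3, he4⟩ := he
    obtain ⟨h1, h2, h3, h4, h5, h6, h7⟩ := hdec _ he2
    refine ⟨⟨?_, ?_⟩, ⟨?_, ?_⟩, h2, h4, h5, h6, h7⟩
    · rw [← he3]; exact Nat.floor_le h1
    · rw [← he3]; exact Nat.lt_floor_add_one _
    · rw [← he4]; exact Nat.floor_le h3
    · rw [← he4]; exact Nat.lt_floor_add_one _
  rcases E'.eq_empty_or_nonempty with h0 | ⟨e0, he0⟩
  · rw [h0]; simp; positivity
  have hik : i + k ≤ t := by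
    obtain ⟨h1, h2, h3, h4, -⟩ := hE1 e0 he0
    have : (i:ℝ) + k ≤ t := by linarith [h1.1, h2.1]
    exact_mod_cast this
  obtain ⟨n, rfl⟩ : ∃ n, t = i + n + k := ⟨t - i - k, by omega⟩
  push_cast at hE1 hE' hE ⊢
  -- birkhoff splitting
  have hsplit : ∀ x : M, birkhoff φ pot x ((i:ℝ) + n + k) = birkhoff φ pot x i + birkhoff φ pot (φ i x) n +
      birkhoff φ pot (φ (i + n) x) k := by
    intro x
    rw [birkhoff_add hφ hpot, birkhoff_add hφ hpot]
  -- the initial and final retractions for subsets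
  have hpre : ∀ X ⊆ E', ∃ F : Finset M, ∃ r : M → M, (∀ x ∈ X, r x ∈ F ∧ dclose φ 0 i (4 * δ) x (r x) ∧
      birkhoff φ pot x i ≤ birkhoff φ pot (r x) i) ∧ ∑ x ∈ F, Real.exp (birkhoff φ pot x i) ≤ C1 * Real.exp (i * (P - κ)) := by
    intro X hX
    obtain ⟨F, hF, hsep, r, hr⟩ := greedy (dclose φ 0 i (4 * δ)) (fun x y h => h.symm)
      (fun x => dclose.refl (by positivity) x) (fun x => birkhoff φ pot x i) X
    refine ⟨F, r, hr, hC1' i F (fun x hx => ?_) hsep⟩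
    obtain ⟨h1, h2, h3, h4, h5, -⟩ := hE1 x (hX (hF hx))
    left; right
    refine ⟨i, rfl, 0, ⟨le_rfl, one_pos⟩, p (x, (i:ℝ) + n + k) - i, ⟨by linarith [h1.1], by linarith [h1.2]⟩, ?_⟩
    rw [neg_zero, flow_zero hφ]
    convert h5 using 2
    ring
  have hsuf : ∀ X ⊆ E', ∃ F : Finset M, ∃ r : M → M, (∀ x ∈ X, r x ∈ F ∧ dclose φ (i + n) (i + n + k) (4 * δ) x (r x) ∧
      birkhoff φ pot (φ (i + n) x) k ≤ birkhoff φ pot (φ (i + n) (r x)) k) ∧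
      ∑ x ∈ F, Real.exp (birkhoff φ pot (φ (i + n) x) k) ≤ C1 * Real.exp (k * (P - κ)) := by
    intro X hX
    obtain ⟨F, hF, hsep, r, hr⟩ := greedy (dclose φ ((i:ℝ) + n) (i + n + k) (4 * δ)) (fun x y h => h.symm)
      (fun x => dclose.refl (by positivity) x) (fun x => birkhoff φ pot (φ (i + n) x) k) X
    refine ⟨F, r, hr, ?_⟩
    have hinj : Function.Injective (φ ((i:ℝ) + n)) := (flowHomeo hφ ((i:ℝ) + n)).injective
    have := hC1' k (F.image (φ ((i:ℝ) + n))) (fun x hx => ?_) (fun x hx y hy hxy => ?_)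
    · rwa [Finset.sum_image (fun x _ y _ h => hinj h)] at this
    · obtain ⟨x, hx', rfl⟩ := Finset.mem_image.1 hx
      replace hx := hx'
      obtain ⟨h1, h2, h3, h4, h5, h6, h7⟩ := hE1 x (hX (hF hx))
      right
      refine ⟨k, rfl, s (x, (i:ℝ) + n + k) - k, ⟨by linarith [h2.1], by linarith [h2.2]⟩, 0, ⟨le_rfl, one_pos⟩, ?_⟩
      have e1 : φ (-(s (x, (i:ℝ) + n + k) - k)) (φ ((i:ℝ) + n) x) = φ (p (x, (i:ℝ) + n + k) + g (x, (i:ℝ) + n + k)) x := by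
        rw [← flow_add hφ]; congr 1; linarith
      simp only
      rw [e1]
      convert h7 using 2
      ring
    · obtain ⟨x, hx', rfl⟩ := Finset.mem_image.1 hx
      obtain ⟨y, hy', rfl⟩ := Finset.mem_image.1 hy
      rw [hsep x hx' y hy']
      have := (dclose_shift hφ).1 hxy
      exact this.mono (by linarith) (by linarith) le_rfl
  have habs := abs_nonneg P
  have hPa := neg_abs_le P
  have hPb := le_abs_self P
  by_cases hn : n ≤ J
  · -- short middle part
    obtain ⟨lab, hlab⟩ := hLab n i
    obtain ⟨b, -, hb⟩ := pigeon (s := E') (t := Finset.univ) (f := lab) (w := fun e => Real.exp (birkhoff φ pot e ((i:ℝ) + n + k)))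
      (Q := (L:ℝ) ^ (n + 1)) (fun _ _ => Finset.mem_univ _) (fun _ _ => (Real.exp_pos _).le)
      ⟨lab e0, Finset.mem_univ _⟩ (by simp)
    set X := E'.filter (fun e => lab e = b) with hX
    obtain ⟨F1, r1, hr1, hs1⟩ := hpre X (Finset.filter_subset _ _)
    obtain ⟨F3, r3, hr3, hs3⟩ := hsuf X (Finset.filter_subset _ _)
    have hmain := prod3 (X := X) (F1 := F1) (F2 := {e0}) (F3 := F3) (r1 := r1) (r2 := fun _ => e0) (r3 := r3)
      (W := fun e => birkhoff φ pot e ((i:ℝ) + n + k)) (w1 := fun x => birkhoff φ pot x i) (w2 := fun _ => 0)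
      (w3 := fun x => birkhoff φ pot (φ (i + n) x) k) (c := B * J)
      (fun x hx => (hr1 x hx).1) (fun x hx => Finset.mem_singleton_self _) (fun x hx => (hr3 x hx).1)
      (fun x hx y hy h1 _ h3 => by
        have hx' := Finset.mem_filter.1 hx
        have hy' := Finset.mem_filter.1 hy
        refine hE x (hsub hx'.1) y (hsub hy'.1) ?_
        have c1 := (hr1 x hx).2.1.trans (h1 ▸ (hr1 y hy).2.1.symm)
        have c3 := (hr3 x hx).2.1.trans (h3 ▸ (hr3 y hy).2.1.symm)
        have c2 := hlab x (mem_univ _) y (mem_univ _) (hx'.2.trans hy'.2.symm)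
        exact ((c1.mono le_rfl le_rfl (by linarith)).glue (c2.mono le_rfl le_rfl (by linarith))).glue
          (c3.mono le_rfl le_rfl (by linarith)))
      (fun x hx => by
        rw [hsplit]
        have b1 := birk_upper (φ := φ) hB (φ i x) (t := n) (Nat.cast_nonneg n)
        have b2 : B * n ≤ B * J := by gcongr
        linarith [(hr1 x hx).2.2, (hr3 x hx).2.2])
    simp only [Finset.sum_singleton, Real.exp_zero, mul_one] at hmain
    have hexpP : Real.exp (i * (P - κ)) * Real.exp (k * (P - κ)) ≤
        Real.exp (J * |P|) * Real.exp (((i:ℝ) + n + k) * P - κ * (i + k)) := by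
      rw [← Real.exp_add, ← Real.exp_add, Real.exp_le_exp]
      have : -(J * |P|) ≤ n * P := by
        have h1 : (n:ℝ) * |P| ≤ J * |P| := by gcongr
        have h2 : (n:ℝ) * (-|P|) ≤ n * P := by gcongr
        linarith
      nlinarith
    calc _ ≤ _ := hb
      _ ≤ (L:ℝ) ^ (J + 1) * (Real.exp (B * J) * ((C1 * Real.exp (i * (P - κ))) * (C1 * Real.exp (k * (P - κ))))) := by
          gcongr
          · exact_mod_cast hL
          · refine hmain.trans ?_
            gcongr
      _ = (L:ℝ) ^ (J + 1) * Real.exp (B * J) * C1 * C1 * (Real.exp (i * (P - κ)) * Real.exp (k * (P - κ))) := by ring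
      _ ≤ (L:ℝ) ^ (J + 1) * Real.exp (B * J) * C1 * C1 *
          (Real.exp (J * |P|) * Real.exp (((i:ℝ) + n + k) * P - κ * (i + k))) := by gcongr
      _ = D1 * Real.exp (((i:ℝ) + n + k) * P - κ * (i + k)) := by rw [hD1, Real.exp_add]; ring
      _ ≤ _ := by gcongr; linarith
  · -- long middle part
    obtain ⟨m, rfl⟩ : ∃ m, n = m + 2 := ⟨n - 2, by omega⟩
    have hmJ : (J:ℝ) ≤ m + 2 := by
      have : J ≤ m + 2 := by omega
      exact_mod_cast this
    push_cast at *
    obtain ⟨lab1, hlab1⟩ := hLab 1 i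
    obtain ⟨lab2, hlab2⟩ := hLab 1 (i + 1 + m)
    push_cast at hlab1 hlab2
    obtain ⟨b, -, hb⟩ := pigeon (s := E') (t := Finset.univ) (f := fun e => (lab1 e, lab2 e))
      (w := fun e => Real.exp (birkhoff φ pot e ((i:ℝ) + (m + 2) + k)))
      (Q := (L:ℝ) ^ 2 * (L:ℝ) ^ 2) (fun _ _ => Finset.mem_univ _) (fun _ _ => (Real.exp_pos _).le)
      ⟨(lab1 e0, lab2 e0), Finset.mem_univ _⟩ (by simp)
    set X := E'.filter (fun e => (lab1 e, lab2 e) = b) with hX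
    obtain ⟨F1, r1, hr1, hs1⟩ := hpre X (Finset.filter_subset _ _)
    obtain ⟨F3, r3, hr3, hs3⟩ := hsuf X (Finset.filter_subset _ _)
    obtain ⟨F2, hF2, hsep2, r2, hr2⟩ := greedy (dclose φ ((i:ℝ) + 1) (i + 1 + m) (4 * δ)) (fun x y h => h.symm)
      (fun x => dclose.refl (by positivity) x) (fun x => birkhoff φ pot (φ (i + 1) x) m) X
    have hs2 := hC2' (i + 1) m F2 (fun f => p (f, (i:ℝ) + (m + 2) + k)) (fun f => g (f, (i:ℝ) + (m + 2) + k))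
      (fun f hf => by
        obtain ⟨h1, h2, h3, h4, h5, h6, h7⟩ := hE1 f ((Finset.filter_subset _ _) (hF2 hf))
        push_cast
        exact ⟨by linarith [h1.1], h1.2.le⟩)
      (fun f hf => by
        obtain ⟨h1, h2, h3, h4, h5, h6, h7⟩ := hE1 f ((Finset.filter_subset _ _) (hF2 hf))
        push_cast
        exact ⟨by linarith [h2.2], by linarith [h2.1]⟩)
      (fun f hf => by
        obtain ⟨h1, h2, h3, h4, h5, h6, h7⟩ := hE1 f ((Finset.filter_subset _ _) (hF2 hf))
        exact ⟨h6, by linarith [h1.2, h2.2]⟩)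
      (by push_cast; exact hsep2)
    push_cast at hs2
    have hmain := prod3 (X := X) (F1 := F1) (F2 := F2) (F3 := F3) (r1 := r1) (r2 := r2) (r3 := r3)
      (W := fun e => birkhoff φ pot e ((i:ℝ) + (m + 2) + k)) (w1 := fun x => birkhoff φ pot x i)
      (w2 := fun x => birkhoff φ pot (φ (i + 1) x) m)
      (w3 := fun x => birkhoff φ pot (φ (i + (m + 2)) x) k) (c := 2 * B)
      (fun x hx => (hr1 x hx).1) (fun x hx => (hr2 x hx).1) (fun x hx => (hr3 x hx).1)
      (fun x hx y hy h1 h2 h3 => by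
        have hx' := Finset.mem_filter.1 hx
        have hy' := Finset.mem_filter.1 hy
        refine hE x (hsub hx'.1) y (hsub hy'.1) ?_
        have c1 := (hr1 x hx).2.1.trans (h1 ▸ (hr1 y hy).2.1.symm)
        have c2 := (hr2 x hx).2.1.trans (h2 ▸ (hr2 y hy).2.1.symm)
        have c3 := (hr3 x hx).2.1.trans (h3 ▸ (hr3 y hy).2.1.symm)
        have hh := hx'.2.trans hy'.2.symm
        simp only [Prod.mk.injEq] at hh
        have d1 := hlab1 x (mem_univ _) y (mem_univ _) hh.1
        have d2 := hlab2 x (mem_univ _) y (mem_univ _) hh.2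
        have a1 := (c1.mono le_rfl le_rfl (show _ ≤ 10 * δ by linarith)).glue (d1.mono le_rfl le_rfl (by linarith))
        have a2 := a1.glue (c2.mono le_rfl le_rfl (by linarith))
        have a3 := a2.glue (d2.mono le_rfl le_rfl (by linarith))
        exact a3.glue (c3.mono (by linarith) le_rfl (by linarith)))
      (fun x hx => by
        rw [hsplit]
        have e1 : birkhoff φ pot (φ i x) ((m:ℝ) + 2) = birkhoff φ pot (φ i x) 1 + (birkhoff φ pot (φ (i + 1) x) m +
            birkhoff φ pot (φ m (φ (i + 1) x)) 1) := by
          rw [show (m:ℝ) + 2 = 1 + (m + 1) by ring, birkhoff_add hφ hpot, ← flow_add hφ, add_comm (1:ℝ) (i:ℝ),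
            birkhoff_add hφ hpot]
        have b1 := birk_upper (φ := φ) hB (φ i x) (t := 1) zero_le_one
        have b2 := birk_upper (φ := φ) hB (φ m (φ (i + 1) x)) (t := 1) zero_le_one
        linarith [(hr1 x hx).2.2, (hr2 x hx).2.2, (hr3 x hx).2.2])
    have hexpP : Real.exp (i * (P - κ)) * Real.exp (m * P) * Real.exp (k * (P - κ)) ≤
        Real.exp (2 * |P|) * Real.exp (((i:ℝ) + (m + 2) + k) * P - κ * (i + k)) := by
      rw [← Real.exp_add, ← Real.exp_add, ← Real.exp_add, Real.exp_le_exp]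
      nlinarith
    calc _ ≤ _ := hb
      _ ≤ ((L:ℝ) ^ 2 * (L:ℝ) ^ 2) * (Real.exp (2 * B) * ((C1 * Real.exp (i * (P - κ))) * (C2 * Real.exp (m * P)) *
            (C1 * Real.exp (k * (P - κ))))) := by
          gcongr
          refine hmain.trans ?_
          gcongr
      _ = ((L:ℝ) ^ 2 * (L:ℝ) ^ 2) * Real.exp (2 * B) * C1 * C1 * C2 *
          (Real.exp (i * (P - κ)) * Real.exp (m * P) * Real.exp (k * (P - κ))) := by ring
      _ ≤ ((L:ℝ) ^ 2 * (L:ℝ) ^ 2) * Real.exp (2 * B) * C1 * C1 * C2 *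
          (Real.exp (2 * |P|) * Real.exp (((i:ℝ) + (m + 2) + k) * P - κ * (i + k))) := by gcongr
      _ = D2 * Real.exp (((i:ℝ) + (m + 2) + k) * P - κ * (i + k)) := by rw [hD2, Real.exp_add]; ring
      _ ≤ _ := by gcongr; linarith

end LemU
end CT


set_option linter.all false

namespace CT
section LemU2
variable {M : Type*} [MetricSpace M] [CompactSpace M] [MeasurableSpace M] [BorelSpace M]
  {φ : ℝ → M → M} {ε δ : ℝ} {pot : M → ℝ}

open Classical in
theorem lemU2 {𝒟 : Set (M × ℝ)} {p s : M × ℝ → ℝ} {P κ C : ℝ} (hκ : 0 < κ) (hC : 0 < C)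
    (h : ∀ (t : ℕ) (E : Finset M), Sep φ 0 t (10 * δ) E →
      (∑ e ∈ E with (e, (t:ℝ)) ∉ 𝒟, Real.exp (birkhoff φ pot e t) ≤
        C * Real.exp (t * P - κ * t)) ∧
      ∀ i k : ℕ, ∑ e ∈ E with (e, (t:ℝ)) ∈ 𝒟 ∧ ⌊p (e, (t:ℝ))⌋₊ = i ∧ ⌊s (e, (t:ℝ))⌋₊ = k,
        Real.exp (birkhoff φ pot e t) ≤ C * Real.exp (t * P - κ * (i + k))) :
    ∃ S > 0, ∀ (R t : ℕ) (E : Finset M), Sep φ 0 t (10 * δ) E →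
      ∑ e ∈ E with ¬ ((e, (t:ℝ)) ∈ 𝒟 ∧ ⌊p (e, (t:ℝ))⌋₊ + ⌊s (e, (t:ℝ))⌋₊ < R), Real.exp (birkhoff φ pot e t) ≤
        C * (Real.exp (-(κ * t)) + S * Real.exp (-(κ / 2 * R))) * Real.exp (t * P) := by
  set r : ℝ := Real.exp (-(κ / 2)) with hr
  have hr0 : 0 ≤ r := (Real.exp_pos _).le
  have hr1 : r < 1 := by rw [hr, Real.exp_lt_one_iff]; linarith
  have hgeo : ∀ A : Finset ℕ, ∑ i ∈ A, r ^ i ≤ (1 - r)⁻¹ := by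
    intro A
    rw [← tsum_geometric_of_lt_one hr0 hr1]
    exact (summable_geometric_of_lt_one hr0 hr1).sum_le_tsum A (fun i _ => by positivity)
  have hinv : 0 < (1 - r)⁻¹ := inv_pos.2 (by linarith)
  refine ⟨(1 - r)⁻¹ * (1 - r)⁻¹, by positivity, fun R t E hE => ?_⟩
  obtain ⟨h1, h2⟩ := h t E hE
  set w : M → ℝ := fun e => Real.exp (birkhoff φ pot e t) with hw
  set G := E.filter (fun e => (e, (t:ℝ)) ∈ 𝒟 ∧ R ≤ ⌊p (e, (t:ℝ))⌋₊ + ⌊s (e, (t:ℝ))⌋₊) with hG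
  have hsplit : ∑ e ∈ E with ¬ ((e, (t:ℝ)) ∈ 𝒟 ∧ ⌊p (e, (t:ℝ))⌋₊ + ⌊s (e, (t:ℝ))⌋₊ < R), w e ≤
      ∑ e ∈ E with (e, (t:ℝ)) ∉ 𝒟, w e + ∑ e ∈ G, w e := by
    rw [← Finset.sum_union]
    · refine Finset.sum_le_sum_of_subset_of_nonneg ?_ (fun z _ _ => (Real.exp_pos _).le)
      intro e he
      rw [Finset.mem_filter] at he
      rw [Finset.mem_union, Finset.mem_filter, hG, Finset.mem_filter]
      by_cases hD : (e, (t:ℝ)) ∈ 𝒟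
      · right
        refine ⟨he.1, hD, ?_⟩
        by_contra hlt
        exact he.2 ⟨hD, not_le.1 hlt⟩
      · left; exact ⟨he.1, hD⟩
    · rw [Finset.disjoint_left]
      intro e he he'
      exact (Finset.mem_filter.1 he).2 (Finset.mem_filter.1 he').2.1
  set I := G.image (fun e => (⌊p (e, (t:ℝ))⌋₊, ⌊s (e, (t:ℝ))⌋₊)) with hI
  have hGs : ∑ e ∈ G, w e ≤ C * ((1 - r)⁻¹ * (1 - r)⁻¹ * Real.exp (-(κ / 2 * R))) * Real.exp (t * P) := by
    rw [← Finset.sum_fiberwise_of_maps_to (s := G) (t := I) (g := fun e => (⌊p (e, (t:ℝ))⌋₊, ⌊s (e, (t:ℝ))⌋₊))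
      (fun e he => Finset.mem_image_of_mem _ he)]
    have hfib : ∀ z ∈ I, ∑ e ∈ G with (⌊p (e, (t:ℝ))⌋₊, ⌊s (e, (t:ℝ))⌋₊) = z, w e ≤
        C * Real.exp (-(κ / 2 * R)) * Real.exp (t * P) * (r ^ z.1 * r ^ z.2) := by
      intro z hz
      obtain ⟨e0, he0, rfl⟩ := Finset.mem_image.1 hz
      simp only
      set i := ⌊p (e0, (t:ℝ))⌋₊
      set k := ⌊s (e0, (t:ℝ))⌋₊
      have hR : R ≤ i + k := (Finset.mem_filter.1 he0).2.2
      have hR' : (R:ℝ) ≤ i + k := by exact_mod_cast hR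
      calc _ ≤ ∑ e ∈ E with (e, (t:ℝ)) ∈ 𝒟 ∧ ⌊p (e, (t:ℝ))⌋₊ = i ∧ ⌊s (e, (t:ℝ))⌋₊ = k, w e := by
            refine Finset.sum_le_sum_of_subset_of_nonneg ?_ (fun z _ _ => (Real.exp_pos _).le)
            intro e he
            rw [Finset.mem_filter, hG, Finset.mem_filter] at he
            rw [Finset.mem_filter]
            have := he.2
            simp only [Prod.mk.injEq] at this
            exact ⟨he.1.1, he.1.2.1, this⟩
        _ ≤ C * Real.exp (t * P - κ * (i + k)) := h2 i k
        _ ≤ C * (Real.exp (-(κ / 2 * R)) * Real.exp (t * P) * (r ^ i * r ^ k)) := by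
            rw [hr, ← Real.exp_nat_mul, ← Real.exp_nat_mul, ← Real.exp_add, ← Real.exp_add, ← Real.exp_add]
            gcongr
            nlinarith
        _ = _ := by ring
    refine (Finset.sum_le_sum hfib).trans ?_
    rw [← Finset.mul_sum]
    have hprod : ∑ z ∈ I, r ^ z.1 * r ^ z.2 ≤ (1 - r)⁻¹ * (1 - r)⁻¹ := by
      calc ∑ z ∈ I, r ^ z.1 * r ^ z.2 ≤ ∑ z ∈ I.image Prod.fst ×ˢ I.image Prod.snd, r ^ z.1 * r ^ z.2 := by
            refine Finset.sum_le_sum_of_subset_of_nonneg ?_ (fun z _ _ => by positivity)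
            intro z hz
            exact Finset.mem_product.2 ⟨Finset.mem_image_of_mem _ hz, Finset.mem_image_of_mem _ hz⟩
        _ = (∑ i ∈ I.image Prod.fst, r ^ i) * ∑ k ∈ I.image Prod.snd, r ^ k := by
            rw [Finset.sum_mul_sum, ← Finset.sum_product']
        _ ≤ _ := by
            gcongr
            · exact hgeo _
            · exact hgeo _
    calc _ ≤ C * Real.exp (-(κ / 2 * R)) * Real.exp (t * P) * ((1 - r)⁻¹ * (1 - r)⁻¹) := by gcongr
      _ = _ := by ring
  refine hsplit.trans ((add_le_add h1 hGs).trans (le_of_eq ?_))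
  rw [sub_eq_add_neg, Real.exp_add]; ring

open Classical in
/-- packaged upper bounds -/
theorem lemU3 {𝒟 : Set (M × ℝ)} {p s : M × ℝ → ℝ} {P κ C : ℝ} (hκ : 0 < κ) (hC : 0 < C)
    (h : ∀ (t : ℕ) (E : Finset M), Sep φ 0 t (10 * δ) E →
      (∑ e ∈ E with (e, (t:ℝ)) ∉ 𝒟, Real.exp (birkhoff φ pot e t) ≤
        C * Real.exp (t * P - κ * t)) ∧
      ∀ i k : ℕ, ∑ e ∈ E with (e, (t:ℝ)) ∈ 𝒟 ∧ ⌊p (e, (t:ℝ))⌋₊ = i ∧ ⌊s (e, (t:ℝ))⌋₊ = k,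
        Real.exp (birkhoff φ pot e t) ≤ C * Real.exp (t * P - κ * (i + k))) :
    (∃ C' > 0, ∀ (t : ℕ) (E : Finset M), Sep φ 0 t (10 * δ) E →
      ∑ e ∈ E, Real.exp (birkhoff φ pot e t) ≤ C' * Real.exp (t * P)) ∧
    ∀ η > 0, ∃ R t0 : ℕ, ∀ t ≥ t0, ∀ E : Finset M, Sep φ 0 t (10 * δ) E →
      ∑ e ∈ E with ¬ ((e, (t:ℝ)) ∈ 𝒟 ∧ ⌊p (e, (t:ℝ))⌋₊ + ⌊s (e, (t:ℝ))⌋₊ < R), Real.exp (birkhoff φ pot e t) ≤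
        η * Real.exp (t * P) := by
  obtain ⟨S, hS, hU⟩ := lemU2 hκ hC h
  constructor
  · refine ⟨C * (1 + S), by positivity, fun t E hE => ?_⟩
    have := hU 0 t E hE
    simp only [Nat.not_lt_zero, and_false, not_false_eq_true, Finset.filter_true, Nat.cast_zero, mul_zero, neg_zero,
      Real.exp_zero, mul_one] at this
    refine this.trans ?_
    gcongr
    rw [Real.exp_le_one_iff]
    have : 0 ≤ κ * t := by positivity
    linarith
  · intro η hη
    have hlim : ∀ c : ℝ, 0 < c → Tendsto (fun n : ℕ => Real.exp (-(c * n))) atTop (nhds 0) := by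
      intro c hc
      refine Real.tendsto_exp_neg_atTop_nhds_zero.comp ?_
      exact tendsto_natCast_atTop_atTop.const_mul_atTop hc
    obtain ⟨R, hR⟩ := ((hlim (κ / 2) (by positivity)).eventually_lt_const (show 0 < η / (2 * C * S) by positivity)).exists
    obtain ⟨t0, ht0⟩ := eventually_atTop.1 ((hlim κ hκ).eventually_lt_const (show 0 < η / (2 * C) by positivity))
    refine ⟨R, t0, fun t ht E hE => (hU R t E hE).trans ?_⟩
    gcongr
    have h1 := (ht0 t ht).le
    rw [le_div_iff₀ (by positivity)] at h1
    have h2 := hR.le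
    rw [le_div_iff₀ (by positivity)] at h2
    nlinarith
end LemU2
end CT


set_option linter.all false

namespace CT
section LemL
variable {M : Type*} [MetricSpace M] [CompactSpace M] [MeasurableSpace M] [BorelSpace M]
  {φ : ℝ → M → M} {ε δ : ℝ} {pot : M → ℝ}

theorem inv_integrable (hφ : IsCtsFlow φ) (ν : Measure M) [IsProbabilityMeasure ν]
    {t : ℝ} {g : M → ℝ} (hg : Measurable g) {C : ℝ} (hC : ∀ x, |g x| ≤ C) :
    Integrable (Function.uncurry fun (x : M) (s : ℝ) => g (φ s x)) (ν.prod (volume.restrict (Ioc 0 t))) := by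
  refine (integrable_const C).mono' ?_ (Eventually.of_forall fun z => hC _)
  exact (hg.comp ((flow_meas hφ).comp measurable_swap)).aestronglyMeasurable

theorem inv_fubini (hφ : IsCtsFlow φ) (ν : Measure M) [IsProbabilityMeasure ν] (hν : flowInvariant φ ν)
    {t : ℝ} (ht : 0 ≤ t) {g : M → ℝ} (hg : Measurable g) {C : ℝ} (hC : ∀ x, |g x| ≤ C) :
    ∫ x, (∫ s in (0:ℝ)..t, g (φ s x)) ∂ν = t * ∫ x, g x ∂ν := by
  simp only [intervalIntegral.integral_of_le ht]
  rw [integral_integral_swap (inv_integrable hφ ν hg hC)]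
  have : ∀ s, ∫ x, g (φ s x) ∂ν = ∫ x, g x ∂ν := by
    intro s
    conv_rhs => rw [← hν s]
    rw [integral_map (flow_meas_t hφ s).aemeasurable hg.aestronglyMeasurable]
  simp only [this]
  simp [ht]

theorem part_le {α : Type*} (A : Finset α) (a F : α → ℝ) {Z : ℝ} (hZ : 0 < Z) (ha : ∀ e ∈ A, 0 ≤ a e)
    (hAZ : ∑ e ∈ A, Real.exp (F e) ≤ Z) :
    ∑ e ∈ A, (Real.negMulLog (a e) + a e * F e) ≤ (∑ e ∈ A, a e) * Real.log Z + 1 := by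
  have h1 : ∀ e ∈ A, Real.negMulLog (a e) + a e * F e ≤ a e * Real.log Z + Real.exp (F e) / Z := by
    intro e he
    have := negMulLog_le (ha e he) (y := Real.exp (F e) / Z) (by positivity) (fun h => absurd h (by positivity))
    rw [Real.log_div (Real.exp_ne_zero _) hZ.ne', Real.log_exp] at this
    nlinarith [ha e he]
  refine (Finset.sum_le_sum h1).trans ?_
  rw [Finset.sum_add_distrib, ← Finset.sum_mul, ← Finset.sum_div]
  have : (∑ e ∈ A, Real.exp (F e)) / Z ≤ 1 := by rw [div_le_one hZ]; exact hAZ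
  linarith

theorem exists_retract (hφ : IsCtsFlow φ) (hpot : Continuous pot) (hδ : 0 < δ) [Nonempty M] (t : ℕ) :
    ∃ (E : Finset M) (w : M → E), Sep φ 0 t (100 * δ) E ∧ Lm w ∧ (∀ x, dclose φ 0 t (101 * δ) x (w x)) ∧
      ∀ x, birkhoff φ pot x t ≤ birkhoff φ pot (w x) t + 1 := by
  classical
  obtain ⟨θ, hθ, hmod⟩ := exists_pot_mod hpot (show 0 < 1 / ((t:ℝ) + 1) by positivity)
  obtain ⟨k, c, hc, hcc⟩ := exists_cells hφ (t:ℝ) (lt_min hδ hθ)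
  let rep : Fin k → M := fun j => if h : ∃ x, c x = j then h.choose else Classical.arbitrary M
  have hrep : ∀ x, c (rep (c x)) = c x := by
    intro x
    have h : ∃ y, c y = c x := ⟨x, rfl⟩
    simp only [rep, dif_pos h]
    exact h.choose_spec
  obtain ⟨E, -, hsep, r, hr⟩ := greedy (dclose φ 0 t (100 * δ)) (fun x y h => h.symm)
    (fun x => dclose.refl (by positivity) x) (fun x => birkhoff φ pot x t) (Finset.univ.image rep)
  have hr' : ∀ j, _ := fun j => hr (rep j) (Finset.mem_image_of_mem _ (Finset.mem_univ j))
  refine ⟨E, fun x => ⟨r (rep (c x)), (hr' (c x)).1⟩, hsep, ?_, fun x => ?_, fun x => ?_⟩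
  · exact (Lm.of_measurable hc).comp_left (fun j => (⟨r (rep j), (hr' j).1⟩ : E))
  · have h1 := (hcc x (rep (c x)) (hrep x).symm).mono le_rfl le_rfl (min_le_left δ θ)
    have := h1.trans (hr' (c x)).2.1
    exact this.mono le_rfl le_rfl (by linarith)
  · have h1 := (hcc x (rep (c x)) (hrep x).symm).mono le_rfl le_rfl (min_le_right δ θ)
    have h2 := (abs_le.1 (birkhoff_close hφ hpot hmod (Nat.cast_nonneg t) h1)).2
    have h3 : 1 / ((t:ℝ) + 1) * t ≤ 1 := by
      rw [one_div, inv_mul_le_iff₀ (by positivity)]; linarith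
    have h4 := (hr' (c x)).2.2
    simp only at h4 ⊢
    linarith

theorem lemL (hφ : IsCtsFlow φ) (hpot : Continuous pot) (hδ : 0 < δ) (hδε : 202 * δ ≤ ε)
    (hexp : AlmostExpansive φ ε) {C : ℝ} (hC : 0 < C)
    (hU : ∀ (t : ℕ) (E : Finset M), Sep φ 0 t (10 * δ) E →
      ∑ e ∈ E, Real.exp (birkhoff φ pot e t) ≤ C * Real.exp (t * pressureOn φ univ pot)) :
    ∃ c > 0, ∀ ν : Measure M, IsEquilibriumOn φ univ pot ν → ∀ t : ℕ, 1 ≤ t → ∀ X : Set M, 1 / 2 ≤ ν.real X →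
      ∃ E : Finset M, Sep φ 0 t (100 * δ) E ∧ (∀ e ∈ E, ∃ x ∈ X, dclose φ 0 t (101 * δ) x e) ∧
        c * Real.exp (t * pressureOn φ univ pot) ≤ ∑ e ∈ E, Real.exp (birkhoff φ pot e t) := by
  classical
  set P := pressureOn φ univ pot with hP
  refine ⟨Real.exp (-(6 + 2 * |Real.log C|)), Real.exp_pos _, fun ν hν t ht X hX => ?_⟩
  obtain ⟨⟨hprob, hinv, -⟩, heq⟩ := hν
  haveI : Nonempty M := nonempty_of_isProbabilityMeasure ν
  obtain ⟨E, w, hsep, hw, hwc, hwb⟩ := exists_retract hφ hpot hδ t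
  have ht0 : (0:ℝ) ≤ t := Nat.cast_nonneg t
  set F : M → ℝ := fun x => birkhoff φ pot x t with hF
  set a : E → ℝ := fun e => ν.real (w ⁻¹' {e}) with ha
  have ha0 : ∀ e, 0 ≤ a e := fun e => measureReal_nonneg
  have hasum : ∑ e, a e = 1 := by rw [ha, real_fiber_total hw]; simp
  -- entropy
  have hent := ent_le hφ hexp ν hinv ht hw (fun x y hxy => by
    have := (hwc x).trans (hxy ▸ (hwc y).symm)
    exact this.mono le_rfl le_rfl (by linarith))
  -- integral
  obtain ⟨B, hB0, hB⟩ := exists_pot_bound hpot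
  have hIntg : t * ∫ x, pot x ∂ν ≤ ∑ e, a e * (F e + 1) := by
    rw [← inv_fubini hφ ν hinv ht0 hpot.measurable hB]
    have hwm : Measurable w := measurable_to_countable' hw
    have hi : Integrable (fun e : E => F e + 1) (ν.map w) := by
      haveI := Measure.isProbabilityMeasure_map (μ := ν) hwm.aemeasurable
      exact Integrable.of_finite
    have h1 : ∑ e, a e * (F e + 1) = ∫ x, (F (w x) + 1) ∂ν := by
      rw [← integral_map (φ := w) (f := fun e : E => F e + 1) hwm.aemeasurable hi.1, integral_fintype hi]
      refine Finset.sum_congr rfl fun e _ => ?_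
      rw [smul_eq_mul, map_measureReal_apply hwm (measurableSet_singleton e)]
    rw [h1]
    refine integral_mono ?_ ?_ (fun x => hwb x)
    · exact (birkhoff_continuous hφ hpot t).integrable_of_hasCompactSupport (HasCompactSupport.of_compactSpace _)
    · exact hi.comp_measurable hwm
  set E1 : Finset E := Finset.univ.filter (fun e => ∃ x ∈ X, w x = e) with hE1
  set b := ∑ e ∈ E1, a e with hb
  have hbX : 1 / 2 ≤ b := by
    refine hX.trans ?_
    have h1 : b = ν.real (w ⁻¹' (E1 : Set E)) := by
      rw [hb, ha]
      rw [show w ⁻¹' (E1 : Set E) = ⋃ e ∈ E1, w ⁻¹' {e} by ext; simp]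
      rw [measureReal_biUnion_finset]
      · intro e _ e' _ hne
        refine Disjoint.preimage _ ?_
        simpa using hne
      · exact fun e _ => hw e
    rw [h1]
    refine measureReal_mono (fun x hx => ?_)
    simp only [mem_preimage, Finset.mem_coe, hE1, Finset.mem_filter, Finset.mem_univ, true_and]
    exact ⟨x, hx, rfl⟩
  have hb1 : b ≤ 1 := by
    rw [← hasum]
    exact Finset.sum_le_sum_of_subset_of_nonneg (Finset.subset_univ _) (fun e _ _ => ha0 e)
  have hne : E1.Nonempty := by
    by_contra h
    rw [Finset.not_nonempty_iff_eq_empty] at h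
    rw [hb, h] at hbX
    norm_num at hbX
  set Z1 := ∑ e ∈ E1, Real.exp (F e) with hZ1
  have hZ1p : 0 < Z1 := Finset.sum_pos (fun e _ => Real.exp_pos _) hne
  set Z := C * Real.exp (t * P) with hZ
  have hZp : 0 < Z := by positivity
  have hEZ : ∑ e : E, Real.exp (F e) ≤ Z := by
    have := hU t E (hsep.mono le_rfl le_rfl (by linarith))
    rw [← Finset.sum_coe_sort] at this
    exact this
  have p1 := part_le E1 a (fun e => F e) hZ1p (fun e _ => ha0 e) le_rfl
  have p2 := part_le E1ᶜ a (fun e => F e) hZp (fun e _ => ha0 e) ((Finset.sum_le_sum_of_subset_of_nonneg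
    (Finset.subset_univ _) (fun e _ _ => (Real.exp_pos _).le)).trans hEZ)
  have hcomp : ∑ e ∈ E1ᶜ, a e = 1 - b := by
    rw [← hasum, ← Finset.sum_add_sum_compl E1]; ring
  rw [hcomp] at p2
  have htot : t * P - 1 ≤ ∑ e, (Real.negMulLog (a e) + a e * F e) := by
    have h1 : ∑ e, a e * (F e + 1) = ∑ e, a e * F e + 1 := by
      simp only [mul_add, mul_one, Finset.sum_add_distrib, hasum]
    rw [Finset.sum_add_distrib]
    have : t * P = t * metricEntropy ν (φ 1) + t * ∫ x, pot x ∂ν := by rw [hP, ← heq]; ring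
    have h3 : Hm ν w = ∑ e, Real.negMulLog (a e) := rfl
    linarith
  rw [← Finset.sum_add_sum_compl E1] at htot
  have hlogZ : Real.log Z = Real.log C + t * P := by
    rw [hZ, Real.log_mul hC.ne' (Real.exp_ne_zero _), Real.log_exp]
  have hfin : t * P - (6 + 2 * |Real.log C|) ≤ Real.log Z1 := by
    rw [hlogZ] at p2
    have hl := le_abs_self (Real.log C)
    have hl0 := abs_nonneg (Real.log C)
    have h1 : (1 - b) * Real.log C ≤ |Real.log C| := by nlinarith
    have h2 : b * (t * P) - 3 - |Real.log C| ≤ b * Real.log Z1 := by linarith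
    by_contra hcon
    push Not at hcon
    nlinarith
  refine ⟨E1.map (Function.Embedding.subtype _), ?_, ?_, ?_⟩
  · refine hsep.subset fun e he => ?_
    obtain ⟨e', -, rfl⟩ := Finset.mem_map.1 he
    exact e'.2
  · intro e he
    obtain ⟨e', he', rfl⟩ := Finset.mem_map.1 he
    obtain ⟨x, hx, hxe⟩ := (Finset.mem_filter.1 he').2
    exact ⟨x, hx, hxe ▸ hwc x⟩
  · rw [Finset.sum_map, ← Real.exp_add]
    change _ ≤ Z1
    rw [← Real.exp_log hZ1p, Real.exp_le_exp]
    linarith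
end LemL
end CT


set_option linter.all false

namespace CT
section Sing
variable {M : Type*} [MetricSpace M] [CompactSpace M] [MeasurableSpace M] [BorelSpace M]
  {φ : ℝ → M → M} {ε δ : ℝ} {pot : M → ℝ}

theorem exists_hT_near {ι : Type*} [Fintype ι] (μ : Measure M) (T : M → M) (f : M → ι) {η : ℝ} (hη : 0 < η) :
    ∃ n : ℕ, 1 ≤ n ∧ Hm μ (itin T f n) ≤ n * (hT μ T f + η) := by
  by_contra h
  push Not at h
  have := le_hT μ T f (c := hT μ T f + η) (fun n hn => (h n hn).le)
  linarith

theorem hT_mix {ι : Type*} [Fintype ι] {μ κ l : Measure M} [IsProbabilityMeasure μ] [IsProbabilityMeasure κ]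
    [IsProbabilityMeasure l] {T : M → M} (hTm : Measurable T) (hκ : κ.map T = κ) (hl : l.map T = l)
    {f : M → ι} (hf : Lm f) {a : ℝ} (ha : a ∈ Icc (0:ℝ) 1)
    (h : ∀ A, MeasurableSet A → μ.real A = a * κ.real A + (1 - a) * l.real A) :
    hT μ T f ≤ a * hT κ T f + (1 - a) * hT l T f := by
  refine le_of_forall_pos_le_add fun η hη => ?_
  obtain ⟨n1, hn1, h1⟩ := exists_hT_near κ T f hη
  obtain ⟨n2, hn2, h2⟩ := exists_hT_near l T f hη
  have hn : (1:ℝ) ≤ n1 * n2 := by exact_mod_cast Nat.mul_pos hn1 hn2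
  refine le_of_forall_nat (c := 2) fun k hk => ?_
  have hk' : (1:ℝ) ≤ k := by exact_mod_cast hk
  have e0 := hT_le μ T f (n := k * (n1 * n2)) (Nat.mul_pos hk (Nat.mul_pos hn1 hn2))
  have e1 := Hm_mix (hf.itin hTm (k * (n1 * n2))) ha h
  have e2 := Hm_itin_mul hTm hκ hf n1 (k * n2)
  have e3 := Hm_itin_mul hTm hl hf n2 (k * n1)
  rw [show k * n2 * n1 = k * (n1 * n2) by ring] at e2
  rw [show k * n1 * n2 = k * (n1 * n2) by ring] at e3
  push_cast at e0 e2 e3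
  have e4 : Hm κ (itin T f (k * (n1 * n2))) ≤ k * (n1 * n2) * (hT κ T f + η) := by
    refine e2.trans ?_
    calc (k:ℝ) * n2 * Hm κ (itin T f n1) ≤ k * n2 * (n1 * (hT κ T f + η)) := by gcongr
      _ = _ := by ring
  have e5 : Hm l (itin T f (k * (n1 * n2))) ≤ k * (n1 * n2) * (hT l T f + η) := by
    refine e3.trans ?_
    calc (k:ℝ) * n1 * Hm l (itin T f n2) ≤ k * n1 * (n2 * (hT l T f + η)) := by gcongr
      _ = _ := by ring
  have e6 := mul_le_mul_of_nonneg_left e4 ha.1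
  have e7 := mul_le_mul_of_nonneg_left e5 (sub_nonneg.2 ha.2)
  set N : ℝ := n1 * n2 with hN
  have e8 : k * N * hT μ T f ≤ k * N * (a * hT κ T f + (1 - a) * hT l T f + η) + 2 := by
    have : a * (k * N * (hT κ T f + η)) + (1 - a) * (k * N * (hT l T f + η)) =
      k * N * (a * hT κ T f + (1 - a) * hT l T f + η) := by ring
    linarith
  by_contra hcon
  push Not at hcon
  have hpos : 0 < k * (hT μ T f - (a * hT κ T f + (1 - a) * hT l T f + η)) := by linarith
  nlinarith

theorem inv_sub (hφ : IsCtsFlow φ) {ν1 ν2 : Measure M} [IsProbabilityMeasure ν1] [IsProbabilityMeasure ν2]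
    (h1 : flowInvariant φ ν1) (h2 : flowInvariant φ ν2) : flowInvariant φ (ν1 - ν2) := by
  intro t
  have hm := flow_meas_t hφ t
  have hle : ν1 - ν2 ≤ (ν1 - ν2).map (φ t) := by
    refine Measure.sub_le_of_le_add ?_
    have hx : ν1 ≤ (ν1 - ν2) + ν2 := Measure.sub_le_iff_le_add.1 le_rfl
    have := Measure.map_mono hx hm
    rw [Measure.map_add _ _ hm, h1 t, h2 t] at this
    exact this
  refine (Measure.eq_of_le_of_measure_univ_eq hle ?_).symm
  rw [Measure.map_apply hm MeasurableSet.univ, preimage_univ]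

theorem flowInv_smul {κ : Measure M} (hκ : flowInvariant φ κ) (c : ℝ≥0∞) : flowInvariant φ (c • κ) := by
  intro t
  rw [Measure.map_smul, hκ t]

theorem equil_part (hφ : IsCtsFlow φ) (hpot : Continuous pot) (hε : 0 < ε) (hexp : AlmostExpansive φ ε)
    {ν κ : Measure M} (hν : IsEquilibriumOn φ univ pot ν) (hκ : flowInvariant φ κ) (hle : κ ≤ ν) (h0 : κ ≠ 0) :
    IsEquilibriumOn φ univ pot ((κ univ)⁻¹ • κ) := by
  obtain ⟨hνi, heq⟩ := hν
  obtain ⟨hp, hinv⟩ := inv_on_univ.1 hνi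
  haveI : IsFiniteMeasure κ := isFiniteMeasure_of_le ν hle
  haveI : NeZero κ := ⟨h0⟩
  set κ' := (κ univ)⁻¹ • κ with hκ'
  haveI : IsProbabilityMeasure κ' := isProbabilityMeasureSMul
  have hκi : flowInvariant φ κ' := flowInv_smul hκ _
  refine ⟨inv_on_univ.2 ⟨inferInstance, hκi⟩, ?_⟩
  set lam := ν - κ with hlam
  have hadd : lam + κ = ν := Measure.sub_add_cancel_of_le hle
  have hlami : flowInvariant φ lam := by
    intro t
    have hm := flow_meas_t hφ t
    have hx : lam.map (φ t) + κ = lam + κ := by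
      rw [hadd]
      conv_lhs => rw [← hκ t]
      rw [← Measure.map_add _ _ hm, hadd, hinv t]
    refine le_antisymm ?_ ?_
    · refine Measure.le_of_add_le_add_left (μ := κ) ?_
      rw [add_comm, hx, add_comm]
    · refine Measure.le_of_add_le_add_left (μ := κ) ?_
      rw [add_comm, ← hx, add_comm]
  by_cases hl0 : lam = 0
  · rw [hl0, zero_add] at hadd
    have : κ' = ν := by rw [hκ', hadd]; simp
    rw [this]; exact heq
  haveI : NeZero lam := ⟨hl0⟩
  set l' := (lam univ)⁻¹ • lam with hl'
  haveI : IsProbabilityMeasure l' := isProbabilityMeasureSMul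
  have hli : flowInvariant φ l' := flowInv_smul hlami _
  set a := κ.real univ with ha
  have hsum : lam.real univ + a = 1 := by
    rw [ha, ← measureReal_add_apply, hadd]; simp
  have ha0 : 0 < a := by
    rw [ha, measureReal_def]
    exact ENNReal.toReal_pos (by simpa using h0) (measure_ne_top _ _)
  have hl0' : 0 < lam.real univ := by
    rw [measureReal_def]
    exact ENNReal.toReal_pos (by simpa using hl0) (measure_ne_top _ _)
  have hκr : ∀ A, a * κ'.real A = κ.real A := by
    intro A
    rw [hκ', measureReal_ennreal_smul_apply, ENNReal.toReal_inv, ← measureReal_def, ← mul_assoc, ← ha,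
      mul_inv_cancel₀ ha0.ne', one_mul]
  have hlr : ∀ A, (1 - a) * l'.real A = lam.real A := by
    intro A
    rw [hl', measureReal_ennreal_smul_apply, ENNReal.toReal_inv, ← measureReal_def, ← mul_assoc,
      show 1 - a = lam.real univ by linarith, mul_inv_cancel₀ hl0'.ne', one_mul]
  have hmix : ∀ A, MeasurableSet A → ν.real A = a * κ'.real A + (1 - a) * l'.real A := by
    intro A hA
    rw [hκr, hlr, ← hadd, measureReal_add_apply, add_comm]
  have haI : a ∈ Icc (0:ℝ) 1 := ⟨ha0.le, by linarith⟩
  have hent : metricEntropy ν (φ 1) ≤ a * metricEntropy κ' (φ 1) + (1 - a) * metricEntropy l' (φ 1) := by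
    refine metricEntropy_le fun k f hf => ?_
    refine (hT_mix (flow_meas_t hφ 1) (hκi 1) (hli 1) hf haI hmix).trans ?_
    have h1 := le_ent hφ hε hexp κ' hκi hf
    have h2 := le_ent hφ hε hexp l' hli hf
    have := sub_nonneg.2 haI.2
    have := haI.1
    gcongr
  have hIntg : ∫ y, pot y ∂ν = a * ∫ y, pot y ∂κ' + (1 - a) * ∫ y, pot y ∂l' := by
    have hi : ∀ m : Measure M, IsFiniteMeasure m → Integrable pot m := fun m _ =>
      hpot.integrable_of_hasCompactSupport (HasCompactSupport.of_compactSpace _)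
    rw [hκ', hl', integral_smul_measure, integral_smul_measure, ENNReal.toReal_inv, ENNReal.toReal_inv,
      ← measureReal_def, ← measureReal_def, ← ha, show lam.real univ = 1 - a by linarith, smul_eq_mul, smul_eq_mul,
      ← mul_assoc, ← mul_assoc, mul_inv_cancel₀ ha0.ne', mul_inv_cancel₀ (by linarith), one_mul, one_mul,
      ← integral_add_measure (hi _ inferInstance) (hi _ inferInstance), add_comm κ, hadd]
  have p1 := le_pressure hφ hpot hε hexp κ' hκi
  have p2 := le_pressure hφ hpot hε hexp l' hli
  refine le_antisymm p1 ?_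
  set P := pressureOn φ univ pot
  have q1 : P ≤ a * (metricEntropy κ' (φ 1) + ∫ y, pot y ∂κ') + (1 - a) * (metricEntropy l' (φ 1) + ∫ y, pot y ∂l') := by
    linarith
  have q2 := mul_le_mul_of_nonneg_left p2 (sub_nonneg.2 haI.2)
  have q3 : a * P ≤ a * (metricEntropy κ' (φ 1) + ∫ y, pot y ∂κ') := by linarith
  exact le_of_mul_le_mul_left q3 ha0

theorem exists_singular (hφ : IsCtsFlow φ) (hpot : Continuous pot) (hε : 0 < ε) (hexp : AlmostExpansive φ ε)
    {ν1 ν2 : Measure M} (h1 : IsEquilibriumOn φ univ pot ν1) (h2 : IsEquilibriumOn φ univ pot ν2) (hne : ν1 ≠ ν2) :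
    ∃ κ1 κ2 : Measure M, IsEquilibriumOn φ univ pot κ1 ∧ IsEquilibriumOn φ univ pot κ2 ∧ κ1.MutuallySingular κ2 := by
  obtain ⟨hp1, hi1⟩ := inv_on_univ.1 h1.1
  obtain ⟨hp2, hi2⟩ := inv_on_univ.1 h2.1
  have n1 : ν1 - ν2 ≠ 0 := by
    intro h
    have hx : ν1 ≤ (ν1 - ν2) + ν2 := Measure.sub_le_iff_le_add.1 le_rfl
    rw [h, zero_add] at hx
    exact hne (Measure.eq_of_le_of_isProbabilityMeasure hx)
  have n2 : ν2 - ν1 ≠ 0 := by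
    intro h
    have hx : ν2 ≤ (ν2 - ν1) + ν1 := Measure.sub_le_iff_le_add.1 le_rfl
    rw [h, zero_add] at hx
    exact hne (Measure.eq_of_le_of_isProbabilityMeasure hx).symm
  refine ⟨_, _, equil_part hφ hpot hε hexp h1 (inv_sub hφ hi1 hi2) Measure.sub_le n1,
    equil_part hφ hpot hε hexp h2 (inv_sub hφ hi2 hi1) Measure.sub_le n2, ?_⟩
  exact (Measure.mutually_singular_measure_sub.smul _).symm.smul _ |>.symm

end Sing
end CT


set_option linter.all false

namespace CT
section Nbhd
variable {M : Type*} [MetricSpace M] [CompactSpace M] [MeasurableSpace M] [BorelSpace M]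
  {φ : ℝ → M → M} {ε δ : ℝ} {pot : M → ℝ}

theorem flow_null_set (hφ : IsCtsFlow φ) {A : Set M} (hA : MeasurableSet A) (ν : Measure M)
    [IsProbabilityMeasure ν] (hν : flowInvariant φ ν) (h0 : ν A = 0) :
    MeasurableSet {x | volume {s : ℝ | φ s x ∈ A} = 0} ∧ ν {x | volume {s : ℝ | φ s x ∈ A} = 0} = 1 ∧
      ∀ x ∈ {x | volume {s : ℝ | φ s x ∈ A} = 0}, ∀ t, φ t x ∈ {x | volume {s : ℝ | φ s x ∈ A} = 0} := by
  have hS : MeasurableSet {z : M × ℝ | φ z.2 z.1 ∈ A} :=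
    ((flow_meas hφ).comp measurable_swap) hA
  have hm : MeasurableSet {x | volume {s : ℝ | φ s x ∈ A} = 0} :=
    (measurable_measure_prodMk_left hS) (measurableSet_singleton 0)
  refine ⟨hm, ?_, ?_⟩
  · have hz : (ν.prod volume) {z : M × ℝ | φ z.2 z.1 ∈ A} = 0 := by
      rw [Measure.prod_apply_symm hS]
      have : ∀ s : ℝ, ν ((fun x => (x, s)) ⁻¹' {z : M × ℝ | φ z.2 z.1 ∈ A}) = 0 := by
        intro s
        have := congrArg (fun m : Measure M => m A) (hν s)
        rw [Measure.map_apply (flow_meas_t hφ s) hA, h0] at this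
        exact this
      simp only [this, lintegral_zero]
    rw [Measure.measure_prod_null hS] at hz
    rw [prob_compl_eq_zero_iff hm |>.symm]
    exact hz
  · intro x hx t
    have hx' : volume {s : ℝ | φ s x ∈ A} = 0 := hx
    change volume {s : ℝ | φ s (φ t x) ∈ A} = 0
    have : {s : ℝ | φ s (φ t x) ∈ A} = (fun s => s + t) ⁻¹' {s : ℝ | φ s x ∈ A} := by
      ext s
      simp [flow_add hφ]
    rw [this, measure_preimage_add_right]
    exact hx'

theorem exists_inv_sets (hφ : IsCtsFlow φ) {ν1 ν2 : Measure M} [IsProbabilityMeasure ν1] [IsProbabilityMeasure ν2]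
    (h1 : flowInvariant φ ν1) (h2 : flowInvariant φ ν2) (hs : ν1.MutuallySingular ν2) :
    ∃ A1 A2 : Set M, MeasurableSet A1 ∧ MeasurableSet A2 ∧ ν1 A1 = 1 ∧ ν2 A2 = 1 ∧
      (∀ x ∈ A1, ∀ t, φ t x ∈ A1) ∧ (∀ x ∈ A2, ∀ t, φ t x ∈ A2) ∧ ∀ x ∈ A1, x ∉ A2 := by
  obtain ⟨A, hA, a1, a2⟩ := hs
  obtain ⟨b1, b2, b3⟩ := flow_null_set hφ hA ν1 h1 a1
  obtain ⟨c1, c2, c3⟩ := flow_null_set hφ hA.compl ν2 h2 a2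
  refine ⟨_, _, b1, c1, b2, c2, b3, c3, ?_⟩
  intro x hx hx'
  have hx1 : volume {s : ℝ | φ s x ∈ A} = 0 := hx
  have hx2 : volume {s : ℝ | φ s x ∈ Aᶜ} = 0 := hx'
  have := measure_union_null hx1 hx2
  rw [show {s : ℝ | φ s x ∈ A} ∪ {s : ℝ | φ s x ∈ Aᶜ} = univ by
    ext s; simp [em]] at this
  simp at this

theorem exists_sep_nbhd (hφ : IsCtsFlow φ) {A1 A2 K1 K2 : Set M} {s1 s2 : ℝ}
    (hi1 : ∀ x ∈ A1, ∀ t, φ t x ∈ A1) (hi2 : ∀ x ∈ A2, ∀ t, φ t x ∈ A2) (hd : ∀ x ∈ A1, x ∉ A2)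
    (hK1 : IsCompact K1) (hK2 : IsCompact K2) (k1 : K1 ⊆ A1 ∩ ExpS φ ε s1) (k2 : K2 ⊆ A2 ∩ ExpS φ ε s2) :
    ∃ m : ℕ, ∀ x ∈ K1, ∀ y ∈ K2, ∀ w, dclose φ (-m) m ε x w → dclose φ (-m) m ε y w → False := by
  by_contra hcon
  push Not at hcon
  choose x hx y hy w hxw hyw using hcon
  have hc : IsCompact (K1 ×ˢ K2 ×ˢ (univ : Set M)) := hK1.prod (hK2.prod isCompact_univ)
  obtain ⟨⟨x0, y0, w0⟩, h0, ψ, hψ, hlim⟩ := hc.tendsto_subseq (x := fun m => (x m, y m, w m))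
    (fun m => ⟨hx m, hy m, mem_univ _⟩)
  have lx : Tendsto (fun m => x (ψ m)) atTop (nhds x0) := (continuous_fst.tendsto _).comp hlim
  have ly : Tendsto (fun m => y (ψ m)) atTop (nhds y0) := ((continuous_fst.comp continuous_snd).tendsto _).comp hlim
  have lw : Tendsto (fun m => w (ψ m)) atTop (nhds w0) := ((continuous_snd.comp continuous_snd).tendsto _).comp hlim
  have key : ∀ (z : ℕ → M) (z0 : M), Tendsto (fun m => z (ψ m)) atTop (nhds z0) →
      (∀ m : ℕ, dclose φ (-m) m ε (z m) (w m)) → w0 ∈ biBowenBall φ ε z0 := by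
    intro z z0 lz hz t
    have l1 := ((flow_cont hφ t).tendsto z0).comp lz
    have l2 := ((flow_cont hφ t).tendsto w0).comp lw
    refine le_of_tendsto (l1.dist l2) ?_
    filter_upwards [eventually_ge_atTop ⌈|t|⌉₊] with m hm
    have h1 : |t| ≤ (ψ m : ℝ) := (Nat.le_ceil _).trans (by exact_mod_cast hm.trans (hψ.id_le m))
    exact hz (ψ m) t ⟨by linarith [neg_abs_le t], (le_abs_self t).trans h1⟩
  have hw1 := (k1 h0.1).2 (key x x0 lx hxw)
  have hw2 := (k2 h0.2.1).2 (key y y0 ly (fun m => (hyw m).1))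
  obtain ⟨u, -, hu⟩ := hw1
  obtain ⟨v, -, hv⟩ := hw2
  have e1 : w0 ∈ A1 := hu ▸ hi1 _ (k1 h0.1).1 u
  have e2 : w0 ∈ A2 := hv ▸ hi2 _ (k2 h0.2.1).1 v
  exact hd _ e1 e2

theorem markov_set (hφ : IsCtsFlow φ) (ν : Measure M) [IsProbabilityMeasure ν] (hν : flowInvariant φ ν)
    {K : Set M} (hK : MeasurableSet K) {η : ℝ} (hη : 0 < η) (h : 1 - η / 2 < ν.real K) {t : ℝ} (ht : 0 < t) :
    1 / 2 ≤ ν.real {x | volume {s ∈ Icc (0:ℝ) t | φ s x ∉ K} ≤ ENNReal.ofReal (η * t)} := by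
  set g : M → ℝ := Kᶜ.indicator (fun _ => (1:ℝ)) with hg
  have hgm : Measurable g := measurable_const.indicator hK.compl
  have hgb : ∀ x, |g x| ≤ 1 := by
    intro x
    rw [hg]
    by_cases hx : x ∈ Kᶜ
    · simp [indicator_of_mem hx]
    · simp [indicator_of_notMem hx]
  have hg0 : ∀ x, 0 ≤ g x := fun x => indicator_nonneg (fun _ _ => zero_le_one) x
  have hF := inv_fubini hφ ν hν ht.le hgm hgb
  have hgi : ∫ x, g x ∂ν = ν.real Kᶜ := by
    rw [hg, integral_indicator_const _ hK.compl]; simp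
  rw [hgi, probReal_compl_eq_one_sub hK] at hF
  set f : M → ℝ := fun x => ∫ s in (0:ℝ)..t, g (φ s x) with hf
  have hfv : ∀ x, volume {s ∈ Icc (0:ℝ) t | φ s x ∉ K} = ENNReal.ofReal (f x) := by
    intro x
    have hms : MeasurableSet {s : ℝ | φ s x ∉ K} :=
      ((flow_meas hφ).comp (measurable_id.prodMk measurable_const)) hK.compl
    have e1 : (fun s => g (φ s x)) = {s : ℝ | φ s x ∉ K}.indicator (fun _ => (1:ℝ)) := by
      funext s
      by_cases hs : φ s x ∈ K <;> simp [hg, indicator, hs]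
    rw [hf]
    simp only [intervalIntegral.integral_of_le ht.le]
    rw [← integral_Icc_eq_integral_Ioc, e1, integral_indicator_const _ hms, smul_eq_mul, mul_one, measureReal_restrict_apply hms,
      measureReal_def, ENNReal.ofReal_toReal]
    · congr 1
      ext s
      simp [and_comm]
    · refine ne_top_of_le_ne_top ?_ (measure_mono inter_subset_right)
      simp
  have hfint : Integrable f ν := by
    have := (inv_integrable hφ ν (t := t) hgm hgb).integral_prod_left
    refine this.congr (Eventually.of_forall fun x => ?_)
    simp [hf, intervalIntegral.integral_of_le ht.le]
  have hf0 : 0 ≤ᵐ[ν] f := Eventually.of_forall fun x =>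
    intervalIntegral.integral_nonneg ht.le (fun s _ => hg0 _)
  have hM := mul_meas_ge_le_integral_of_nonneg hf0 hfint (η * t)
  rw [hF] at hM
  have hsub : {x | η * t ≤ f x}ᶜ ⊆ {x | volume {s ∈ Icc (0:ℝ) t | φ s x ∉ K} ≤ ENNReal.ofReal (η * t)} := by
    intro x hx
    have : f x < η * t := not_le.1 hx
    simp only [mem_setOf_eq, hfv]
    exact ENNReal.ofReal_le_ofReal this.le
  have hr : 1 - ν.real {x | η * t ≤ f x} ≤ ν.real {x | η * t ≤ f x}ᶜ := by
    have := measureReal_union_le (μ := ν) {x | η * t ≤ f x} {x | η * t ≤ f x}ᶜ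
    rw [union_compl_self, probReal_univ] at this
    linarith
  have := measureReal_mono (μ := ν) hsub
  have h2 : ν.real {x | η * t ≤ f x} ≤ 1 / 2 := by
    have h3 : t * (1 - ν.real K) ≤ t * (η / 2) := by gcongr; linarith
    have h4 : η * t * ν.real {x | η * t ≤ f x} ≤ η * t * (1 / 2) := by
      refine hM.trans (h3.trans (le_of_eq (by ring)))
    exact le_of_mul_le_mul_left h4 (by positivity)
  linarith

end Nbhd
end CT


set_option linter.all false

namespace CT
section Glue
variable {M : Type*} [MetricSpace M] [CompactSpace M] [MeasurableSpace M] [BorelSpace M]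
  {φ : ℝ → M → M} {ε δ : ℝ} {pot : M → ℝ}

open Classical in
theorem lemGood {𝒟 : Set (M × ℝ)} {p s : M × ℝ → ℝ} {P c : ℝ} (hδ : 0 < δ) (hc : 0 < c)
    (hU : ∀ η > 0, ∃ R t0 : ℕ, ∀ t ≥ t0, ∀ E : Finset M, Sep φ 0 t (10 * δ) E →
      ∑ e ∈ E with ¬ ((e, (t:ℝ)) ∈ 𝒟 ∧ ⌊p (e, (t:ℝ))⌋₊ + ⌊s (e, (t:ℝ))⌋₊ < R), Real.exp (birkhoff φ pot e t) ≤
        η * Real.exp (t * P))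
    (hL : ∀ ν : Measure M, IsEquilibriumOn φ univ pot ν → ∀ t : ℕ, 1 ≤ t → ∀ X : Set M, 1 / 2 ≤ ν.real X →
      ∃ E : Finset M, Sep φ 0 t (100 * δ) E ∧ (∀ e ∈ E, ∃ x ∈ X, dclose φ 0 t (101 * δ) x e) ∧
        c * Real.exp (t * P) ≤ ∑ e ∈ E, Real.exp (birkhoff φ pot e t)) :
    ∃ R t0 : ℕ, ∀ ν : Measure M, IsEquilibriumOn φ univ pot ν → ∀ t : ℕ, t0 ≤ t → ∀ X : Set M, 1 / 2 ≤ ν.real X →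
      ∃ E : Finset M, Sep φ 0 t (100 * δ) E ∧ (∀ e ∈ E, (e, (t:ℝ)) ∈ 𝒟 ∧ p (e, (t:ℝ)) ≤ R ∧ s (e, (t:ℝ)) ≤ R) ∧
        (∀ e ∈ E, ∃ x ∈ X, dclose φ 0 t (101 * δ) x e) ∧
        c / 2 * Real.exp (t * P) ≤ ∑ e ∈ E, Real.exp (birkhoff φ pot e t) := by
  obtain ⟨R, t0, hR⟩ := hU (c / 2) (by positivity)
  refine ⟨R, t0 + 1, fun ν hν t ht X hX => ?_⟩
  obtain ⟨E, h1, h2, h3⟩ := hL ν hν t (by omega) X hX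
  have h4 := hR t (by omega) E (h1.mono le_rfl le_rfl (by linarith))
  refine ⟨E.filter (fun e => (e, (t:ℝ)) ∈ 𝒟 ∧ ⌊p (e, (t:ℝ))⌋₊ + ⌊s (e, (t:ℝ))⌋₊ < R),
    h1.subset (Finset.filter_subset _ _), ?_, ?_, ?_⟩
  · intro e he
    obtain ⟨-, h5, h6⟩ := Finset.mem_filter.1 he
    refine ⟨h5, ?_, ?_⟩
    · have := Nat.lt_floor_add_one (p (e, (t:ℝ)))
      have h7 : (⌊p (e, (t:ℝ))⌋₊ : ℝ) + 1 ≤ R := by exact_mod_cast (by omega)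
      linarith
    · have := Nat.lt_floor_add_one (s (e, (t:ℝ)))
      have h7 : (⌊s (e, (t:ℝ))⌋₊ : ℝ) + 1 ≤ R := by exact_mod_cast (by omega)
      linarith
  · exact fun e he => h2 e (Finset.mem_filter.1 he).1
  · have := Finset.sum_filter_add_sum_filter_not E
      (fun e => (e, (t:ℝ)) ∈ 𝒟 ∧ ⌊p (e, (t:ℝ))⌋₊ + ⌊s (e, (t:ℝ))⌋₊ < R) (fun e => Real.exp (birkhoff φ pot e t))
    linarith

theorem spec2 {𝒢 : Set (M × ℝ)} {T : ℝ} (hspec : SpecT φ 𝒢 δ T) {x1 x2 : M} {g1 g2 : ℝ}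
    (h1 : (x1, g1) ∈ 𝒢) (h2 : (x2, g2) ∈ 𝒢) (t1 : T ≤ g1) (t2 : T ≤ g2) :
    ∃ y, ∃ τ ∈ Icc (0:ℝ) T, (∀ u ∈ Icc (0:ℝ) g1, dist (φ u y) (φ u x1) ≤ δ) ∧
      ∀ u ∈ Icc (0:ℝ) g2, dist (φ (g1 + τ + u) y) (φ u x2) ≤ δ := by
  obtain ⟨y, τ, hτ, hy⟩ := hspec 2 (fun i => if i = 0 then x1 else x2) (fun i => if i = 0 then g1 else g2) (by
    intro i hi
    rcases (by omega : i = 0 ∨ i = 1) with rfl | rfl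
    · exact ⟨h1, t1⟩
    · exact ⟨h2, t2⟩)
  refine ⟨y, τ 0, hτ 0, fun u hu => ?_, fun u hu => ?_⟩
  · simpa using hy 0 (by norm_num) u (by simpa using hu)
  · simpa using hy 1 (by norm_num) u (by simpa using hu)

theorem weight_split (hφ : IsCtsFlow φ) (hpot : Continuous pot) {B : ℝ} (hB : ∀ x, |pot x| ≤ B)
    (hB0 : 0 < B) {R : ℝ} (e : M) {t p g s : ℝ} (h : t = p + g + s) (hp : 0 ≤ p) (hpR : p ≤ R) (hs : 0 ≤ s) (hsR : s ≤ R) :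
    birkhoff φ pot e t ≤ 2 * R * B + birkhoff φ pot (φ p e) g := by
  rw [h, birkhoff_add hφ hpot, birkhoff_add hφ hpot]
  have h1 := birk_upper (φ := φ) hB e hp
  have h2 := birk_upper (φ := φ) hB (φ (p + g) e) hs
  nlinarith

theorem glue_pair (hφ : IsCtsFlow φ) (hpot : Continuous pot) (hδε : δ ≤ ε) {𝒟 Pc 𝒢 𝒮 : Set (M × ℝ)}
    {p g s : M × ℝ → ℝ} (hdec : IsDecomposition φ 𝒟 Pc 𝒢 𝒮 p g s) {T K B : ℝ} (hT : 0 < T) (hK : 0 < K)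
    (hspec : SpecT φ 𝒢 δ T) (hbow : BowK φ pot ε 𝒢 K) (hB0 : 0 < B) (hB : ∀ x, |pot x| ≤ B)
    {R : ℝ} {t1 t2 N' : ℝ} (ht1 : 2 * R + T ≤ t1) (ht2 : 2 * R + T ≤ t2)
    (hN : t1 + t2 + T ≤ N') (hN2 : N' ≤ t1 + t2 + T + 1) {e1 e2 : M}
    (h1 : (e1, t1) ∈ 𝒟 ∧ p (e1, t1) ≤ R ∧ s (e1, t1) ≤ R) (h2 : (e2, t2) ∈ 𝒟 ∧ p (e2, t2) ≤ R ∧ s (e2, t2) ≤ R) :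
    ∃ y, ∃ S ∈ Icc (t1 - 2 * R) (t1 + T),
      (∀ v ∈ Icc (p (e1, t1)) (t1 - s (e1, t1)), dist (φ (-p (e1, t1) + v) y) (φ v e1) ≤ δ) ∧
      (∀ v ∈ Icc (p (e2, t2)) (t2 - s (e2, t2)), dist (φ ((S - p (e2, t2)) + v) y) (φ v e2) ≤ δ) ∧
      birkhoff φ pot e1 t1 + birkhoff φ pot e2 t2 ≤ birkhoff φ pot y N' +
        (4 * R * B + 2 * K + B * T + B * (4 * R + T + 1)) := by
  obtain ⟨d1, pR1, sR1⟩ := h1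
  obtain ⟨d2, pR2, sR2⟩ := h2
  obtain ⟨a1, a2, a3, a4, -, a5, -⟩ := hdec _ d1
  obtain ⟨b1, b2, b3, b4, -, b5, -⟩ := hdec _ d2
  set p1 := p (e1, t1)
  set g1 := g (e1, t1)
  set s1 := s (e1, t1)
  set p2 := p (e2, t2)
  set g2 := g (e2, t2)
  set s2 := s (e2, t2)
  simp only at a4 b4
  obtain ⟨y, τ, hτ, hy1, hy2⟩ := spec2 hspec a5 b5 (by linarith) (by linarith)
  refine ⟨y, g1 + τ, ⟨by linarith [hτ.1], by linarith [hτ.2]⟩, ?_, ?_, ?_⟩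
  · intro v hv
    have := hy1 (-p1 + v) ⟨by linarith [hv.1], by linarith [hv.2]⟩
    rw [← flow_add hφ] at this
    rwa [show -p1 + v + p1 = v by ring] at this
  · intro v hv
    have := hy2 (-p2 + v) ⟨by linarith [hv.1], by linarith [hv.2]⟩
    rw [← flow_add hφ] at this
    rw [show -p2 + v + p2 = v by ring] at this
    rwa [show g1 + τ + (-p2 + v) = g1 + τ - p2 + v by ring] at this
  · have w1 := weight_split hφ hpot hB hB0 e1 a4 a1 pR1 a3 sR1
    have w2 := weight_split hφ hpot hB hB0 e2 b4 b1 pR2 b3 sR2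
    have k1 := hbow _ _ a5 y (fun u hu => by rw [dist_comm]; exact (hy1 u hu).trans hδε)
    have k2 := hbow _ _ b5 (φ (g1 + τ) y) (fun u hu => by
      rw [dist_comm, ← flow_add hφ, add_comm u]; exact (hy2 u hu).trans hδε)
    have e : N' = g1 + τ + g2 + (N' - (g1 + τ + g2)) := by ring
    rw [e, birkhoff_add hφ hpot, birkhoff_add hφ hpot, birkhoff_add hφ hpot]
    have l1 := birk_lower (φ := φ) hB (φ g1 y) hτ.1
    have l2 := birk_lower (φ := φ) hB (φ (g1 + τ + g2) y) (t := N' - (g1 + τ + g2)) (by linarith [hτ.2])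
    have l3 : B * τ ≤ B * T := by gcongr; exact hτ.2
    have l4 : B * (N' - (g1 + τ + g2)) ≤ B * (4 * R + T + 1) := by gcongr; linarith [hτ.1]
    linarith [abs_le.1 k1, abs_le.1 k2, (abs_le.1 k1).2, (abs_le.1 k2).2]

theorem seg_inj (hφ : IsCtsFlow φ) (hδ : 0 < δ) {ζ : ℝ} (hζ' : ∀ u : ℝ, |u| ≤ ζ → ∀ x : M, dist (φ u x) x ≤ δ)
    {R t N' a a' : ℝ} {p p' s s' : ℝ} {e e' y y' : M}
    (hc : dclose φ 0 R δ e e') (hc' : dclose φ 0 R δ (φ (t - R) e) (φ (t - R) e'))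
    (hp : p ≤ R) (hp' : p' ≤ R) (hs : s ≤ R) (hs' : s' ≤ R) (ha : |a - a'| ≤ ζ)
    (hr : ∀ v ∈ Icc R (t - R), a + v ∈ Icc 0 N')
    (h1 : ∀ v ∈ Icc p (t - s), dist (φ (a + v) y) (φ v e) ≤ δ)
    (h2 : ∀ v ∈ Icc p' (t - s'), dist (φ (a' + v) y') (φ v e') ≤ δ)
    (hy : dclose φ 0 N' (22 * δ) y y') : dclose φ 0 t (100 * δ) e e' := by
  intro v hv
  by_cases hv1 : v ≤ R
  · exact (hc v ⟨hv.1, hv1⟩).trans (by linarith)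
  by_cases hv2 : t - R ≤ v
  · have := hc' (v - (t - R)) ⟨by linarith, by linarith [hv.2]⟩
    rw [← flow_add hφ, ← flow_add hφ, show v - (t - R) + (t - R) = v by ring] at this
    exact this.trans (by linarith)
  push Not at hv1 hv2
  have q1 := h1 v ⟨by linarith, by linarith⟩
  have q2 := h2 v ⟨by linarith, by linarith⟩
  have q3 := hy (a + v) (hr v ⟨hv1.le, hv2.le⟩)
  have q4 := hζ' _ ha (φ (a' + v) y')
  rw [← flow_add hφ, show a - a' + (a' + v) = a + v by ring] at q4
  have r1 := dist_triangle (φ v e) (φ (a + v) y) (φ v e')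
  have r2 := dist_triangle (φ (a + v) y) (φ (a + v) y') (φ v e')
  have r3 := dist_triangle (φ (a + v) y') (φ (a' + v) y') (φ v e')
  rw [dist_comm (φ v e) (φ (a + v) y)] at r1
  linarith

end Glue
end CT


set_option linter.all false

namespace CT
section Glue2
variable {M : Type*} [MetricSpace M] [CompactSpace M] [MeasurableSpace M] [BorelSpace M]
  {φ : ℝ → M → M} {ε δ : ℝ} {pot : M → ℝ}

theorem nfloor_close {a b ζ : ℝ} (hζ : 0 < ζ) (ha : 0 ≤ a) (hb : 0 ≤ b) (h : ⌊a / ζ⌋₊ = ⌊b / ζ⌋₊) : |a - b| ≤ ζ := by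
  have a1 := Nat.floor_le (div_nonneg ha hζ.le)
  have a2 := Nat.lt_floor_add_one (a / ζ)
  have b1 := Nat.floor_le (div_nonneg hb hζ.le)
  have b2 := Nat.lt_floor_add_one (b / ζ)
  rw [h] at a1 a2
  rw [le_div_iff₀ hζ] at a1 b1
  rw [div_lt_iff₀ hζ] at a2 b2
  rw [abs_le]
  constructor <;> linarith

theorem nfloor_mem {a b ζ : ℝ} (hζ : 0 < ζ) (h : a ≤ b) : ⌊a / ζ⌋₊ ∈ Finset.range (⌊b / ζ⌋₊ + 1) := by
  rw [Finset.mem_range, Nat.lt_succ_iff]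
  exact Nat.floor_le_floor (by gcongr)

set_option maxHeartbeats 1000000 in
open Classical in
theorem glue2 (hφ : IsCtsFlow φ) (hpot : Continuous pot) (hδ : 0 < δ) (hδε : δ ≤ ε) {𝒟 Pc 𝒢 𝒮 : Set (M × ℝ)}
    {p g s : M × ℝ → ℝ} (hdec : IsDecomposition φ 𝒟 Pc 𝒢 𝒮 p g s) {T K : ℝ} (hT : 0 < T) (hK : 0 < K)
    (hspec : SpecT φ 𝒢 δ T) (hbow : BowK φ pot ε 𝒢 K) (R : ℕ) :
    ∃ Q > 0, ∀ t1 t2 : ℕ, 2 * (R:ℝ) + T ≤ t1 → 2 * (R:ℝ) + T ≤ t2 → ∀ E1 E2 : Finset M,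
      Sep φ 0 t1 (100 * δ) E1 → Sep φ 0 t2 (100 * δ) E2 →
      (∀ e ∈ E1, (e, (t1:ℝ)) ∈ 𝒟 ∧ p (e, (t1:ℝ)) ≤ R ∧ s (e, (t1:ℝ)) ≤ R) →
      (∀ e ∈ E2, (e, (t2:ℝ)) ∈ 𝒟 ∧ p (e, (t2:ℝ)) ≤ R ∧ s (e, (t2:ℝ)) ≤ R) →
      ∀ N' : ℝ, t1 + t2 + T ≤ N' → N' ≤ t1 + t2 + T + 1 →
      ∀ (Z : Finset M) (r : M → M), (∀ y, r y ∈ Z ∧ dclose φ 0 N' (11 * δ) y (r y) ∧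
        birkhoff φ pot y N' ≤ birkhoff φ pot (r y) N' + 1) →
      ∃ Z' ⊆ Z, (∀ z ∈ Z', ∃ e1 ∈ E1, ∃ e2 ∈ E2, ∃ S ∈ Icc ((t1:ℝ) - 2 * R) (t1 + T),
          ∃ p1 ∈ Icc (0:ℝ) R, ∃ p2 ∈ Icc (0:ℝ) R,
          (∀ v ∈ Icc (0:ℝ) (t1 - 2 * R), dist (φ (p1 + v) e1) (φ v z) ≤ 12 * δ) ∧
          (∀ v ∈ Icc (0:ℝ) (t2 - 2 * R), dist (φ (p2 + v) e2) (φ (S + v) z) ≤ 12 * δ)) ∧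
        (∑ e ∈ E1, Real.exp (birkhoff φ pot e t1)) * (∑ e ∈ E2, Real.exp (birkhoff φ pot e t2)) ≤
          Q * ∑ z ∈ Z', Real.exp (birkhoff φ pot z N') := by
  obtain ⟨B, hB0, hB⟩ := exists_pot_bound hpot
  obtain ⟨ζ, hζ, hζ'⟩ := exists_small_time hφ hδ
  obtain ⟨k, c, -, hcc⟩ := exists_cells hφ (R:ℝ) hδ
  set Tg : Finset (ℕ × ℕ × Fin k × Fin k × Fin k × Fin k) :=
    Finset.range (⌊(4 * R + T) / ζ⌋₊ + 1) ×ˢ Finset.range (⌊(4 * R + T) / ζ⌋₊ + 1) ×ˢ Finset.univ with hTg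
  set D : ℝ := 4 * R * B + 2 * K + B * T + B * (4 * R + T + 1) with hD
  refine ⟨(Tg.card + 1 : ℝ) * Real.exp (D + 1), by positivity, ?_⟩
  intro t1 t2 ht1 ht2 E1 E2 hs1 hs2 hE1 hE2 N' hN hN2 Z r hr
  have hR0 : (0:ℝ) ≤ R := Nat.cast_nonneg R
  rcases (E1 ×ˢ E2).eq_empty_or_nonempty with hemp | hne
  · refine ⟨∅, Finset.empty_subset _, by simp, ?_⟩
    rw [Finset.sum_mul_sum, ← Finset.sum_product', hemp]
    simp
  obtain ⟨e0, he0⟩ := hne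
  haveI : Nonempty M := ⟨e0.1⟩
  have hpair : ∀ e ∈ E1 ×ˢ E2, _ := fun e he =>
    glue_pair hφ hpot hδε hdec hT hK hspec hbow hB0 hB ht1 ht2 hN hN2 (hE1 e.1 (Finset.mem_product.1 he).1)
      (hE2 e.2 (Finset.mem_product.1 he).2)
  choose! Y S hS hY1 hY2 hYw using hpair
  let code : M × M → ℕ × ℕ × Fin k × Fin k × Fin k × Fin k := fun e =>
    (⌊p (e.1, (t1:ℝ)) / ζ⌋₊, ⌊(S e - p (e.2, (t2:ℝ)) - (t1 - 3 * R)) / ζ⌋₊, c e.1, c (φ (t1 - R) e.1), c e.2, c (φ (t2 - R) e.2))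
  have hb1 : ∀ e ∈ E1 ×ˢ E2, 0 ≤ p (e.1, (t1:ℝ)) ∧ p (e.1, (t1:ℝ)) ≤ R ∧ 0 ≤ s (e.1, (t1:ℝ)) ∧ s (e.1, (t1:ℝ)) ≤ R := by
    intro e he
    have h1 := hE1 e.1 (Finset.mem_product.1 he).1
    have h2 := hdec _ h1.1
    exact ⟨h2.1, h1.2.1, h2.2.2.1, h1.2.2⟩
  have hb2 : ∀ e ∈ E1 ×ˢ E2, 0 ≤ p (e.2, (t2:ℝ)) ∧ p (e.2, (t2:ℝ)) ≤ R ∧ 0 ≤ s (e.2, (t2:ℝ)) ∧ s (e.2, (t2:ℝ)) ≤ R := by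
    intro e he
    have h1 := hE2 e.2 (Finset.mem_product.1 he).2
    have h2 := hdec _ h1.1
    exact ⟨h2.1, h1.2.1, h2.2.2.1, h1.2.2⟩
  have hcode : ∀ e ∈ E1 ×ˢ E2, code e ∈ Tg := by
    intro e he
    obtain ⟨a1, a2, a3, a4⟩ := hb1 e he
    obtain ⟨b1, b2, b3, b4⟩ := hb2 e he
    have hSe := hS e he
    refine Finset.mem_product.2 ⟨nfloor_mem hζ (by linarith), Finset.mem_product.2 ⟨nfloor_mem hζ (by linarith [hSe.2]),
      Finset.mem_univ _⟩⟩
  obtain ⟨b, -, hpig⟩ := pigeon (w := fun e : M × M => Real.exp (birkhoff φ pot e.1 t1) * Real.exp (birkhoff φ pot e.2 t2))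
    hcode (fun e _ => by positivity) ⟨_, hcode e0 he0⟩ (Q := Tg.card + 1) (by linarith)
  set W := (E1 ×ˢ E2).filter (fun e => code e = b) with hW
  have hinj : ∀ e ∈ W, ∀ e' ∈ W, r (Y e) = r (Y e') → e = e' := by
    intro e he e' he' hrr
    obtain ⟨m1, c1⟩ := Finset.mem_filter.1 he
    obtain ⟨m2, c2⟩ := Finset.mem_filter.1 he'
    have hcl : dclose φ 0 N' (22 * δ) (Y e) (Y e') := by
      have := (hr (Y e)).2.1.trans (hrr ▸ (hr (Y e')).2.1.symm)
      exact this.mono le_rfl le_rfl (by linarith)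
    have hceq : code e = code e' := c1.trans c2.symm
    simp only [code, Prod.mk.injEq] at hceq
    obtain ⟨q1, q2, q3, q4, q5, q6⟩ := hceq
    obtain ⟨a1, a2, a3, a4⟩ := hb1 e m1
    obtain ⟨b1, b2, b3, b4⟩ := hb2 e m1
    obtain ⟨a1', a2', a3', a4'⟩ := hb1 e' m2
    obtain ⟨b1', b2', b3', b4'⟩ := hb2 e' m2
    have s1 := hS e m1
    have s2 := hS e' m2
    have f1 : e.1 = e'.1 := by
      refine hs1 _ (Finset.mem_product.1 m1).1 _ (Finset.mem_product.1 m2).1 ?_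
      refine seg_inj hφ hδ hζ' (hcc _ _ q3) (hcc _ _ q4) a2 a2' a4 a4' ?_ ?_ (hY1 e m1) (hY1 e' m2) hcl
      · have := nfloor_close hζ a1 a1' q1
        rw [abs_sub_comm] at this
        convert this using 2; ring
      · intro v hv
        constructor
        · linarith [hv.1]
        · have : (0:ℝ) ≤ t2 := Nat.cast_nonneg _
          linarith [hv.2]
    have f2 : e.2 = e'.2 := by
      refine hs2 _ (Finset.mem_product.1 m1).2 _ (Finset.mem_product.1 m2).2 ?_
      refine seg_inj hφ hδ hζ' (hcc _ _ q5) (hcc _ _ q6) b2 b2' b4 b4' ?_ ?_ (hY2 e m1) (hY2 e' m2) hcl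
      · have := nfloor_close hζ (by linarith [s1.1]) (by linarith [s2.1]) q2
        convert this using 2; ring
      · intro v hv
        constructor
        · linarith [hv.1, s1.1]
        · linarith [hv.2, s1.2]
    exact Prod.ext f1 f2
  refine ⟨W.image (fun e => r (Y e)), ?_, ?_, ?_⟩
  · intro z hz
    obtain ⟨e, -, rfl⟩ := Finset.mem_image.1 hz
    exact (hr _).1
  · intro z hz
    obtain ⟨e, he, rfl⟩ := Finset.mem_image.1 hz
    obtain ⟨m1, -⟩ := Finset.mem_filter.1 he
    obtain ⟨a1, a2, a3, a4⟩ := hb1 e m1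
    obtain ⟨b1, b2, b3, b4⟩ := hb2 e m1
    have s1 := hS e m1
    have hc := (hr (Y e)).2.1
    refine ⟨e.1, (Finset.mem_product.1 m1).1, e.2, (Finset.mem_product.1 m1).2, S e, s1, p (e.1, (t1:ℝ)), ⟨a1, a2⟩,
      p (e.2, (t2:ℝ)), ⟨b1, b2⟩, ?_, ?_⟩
    · intro v hv
      have h1 := hY1 e m1 (p (e.1, (t1:ℝ)) + v) ⟨by linarith [hv.1], by linarith [hv.2]⟩
      have h2 := hc v ⟨hv.1, by
        have : (0:ℝ) ≤ t2 := Nat.cast_nonneg _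
        linarith [hv.2]⟩
      rw [show -p (e.1, (t1:ℝ)) + (p (e.1, (t1:ℝ)) + v) = v by ring, dist_comm] at h1
      have := dist_triangle (φ (p (e.1, (t1:ℝ)) + v) e.1) (φ v (Y e)) (φ v (r (Y e)))
      linarith
    · intro v hv
      have h1 := hY2 e m1 (p (e.2, (t2:ℝ)) + v) ⟨by linarith [hv.1], by linarith [hv.2]⟩
      have h2 := hc (S e + v) ⟨by linarith [hv.1, s1.1], by linarith [hv.2, s1.2]⟩
      rw [show S e - p (e.2, (t2:ℝ)) + (p (e.2, (t2:ℝ)) + v) = S e + v by ring, dist_comm] at h1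
      have := dist_triangle (φ (p (e.2, (t2:ℝ)) + v) e.2) (φ (S e + v) (Y e)) (φ (S e + v) (r (Y e)))
      linarith
  · rw [Finset.sum_image (fun e he e' he' h => hinj e he e' he' h), Finset.sum_mul_sum, ← Finset.sum_product']
    refine hpig.trans ?_
    rw [mul_assoc]
    gcongr
    rw [Finset.mul_sum]
    refine Finset.sum_le_sum fun e he => ?_
    obtain ⟨m1, -⟩ := Finset.mem_filter.1 he
    rw [← Real.exp_add, ← Real.exp_add, Real.exp_le_exp]
    have h1 := hYw e m1
    have h2 := (hr (Y e)).2.2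
    linarith

end Glue2
end CT


set_option linter.all false

namespace CT
section Final
variable {M : Type*} [MetricSpace M] [CompactSpace M] [MeasurableSpace M] [BorelSpace M]
  {φ : ℝ → M → M} {ε δ : ℝ} {pot : M → ℝ}

theorem bad_times (hφ : IsCtsFlow φ) (hδε : 113 * δ ≤ ε) {K : Set M} {η t R S p1 : ℝ} {m : ℕ} {x e z : M}
    (hx : volume {s ∈ Icc (0:ℝ) t | φ s x ∉ K} ≤ ENNReal.ofReal (η * t)) (hxe : dclose φ 0 t (101 * δ) x e)
    (hp : p1 ∈ Icc (0:ℝ) R)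
    (hz : ∀ v ∈ Icc (0:ℝ) (t - 2 * R), dist (φ (p1 + v) e) (φ (S + v) z) ≤ 12 * δ) :
    ∃ Bd : Set ℝ, volume Bd ≤ ENNReal.ofReal (η * t) ∧ ∀ v ∈ Icc (S + m) (S + (t - 2 * R) - m), v ∉ Bd →
      ∃ x' ∈ K, dclose φ (-m) m ε x' (φ v z) := by
  have hm0 : (0:ℝ) ≤ m := Nat.cast_nonneg m
  refine ⟨(fun v => v + (p1 - S)) ⁻¹' {s ∈ Icc (0:ℝ) t | φ s x ∉ K}, ?_, ?_⟩
  · rw [measure_preimage_add_right]; exact hx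
  · intro v hv hvB
    refine ⟨φ (v + (p1 - S)) x, ?_, ?_⟩
    · by_contra hK
      exact hvB ⟨⟨by linarith [hv.1, hp.1], by linarith [hv.2, hp.2, hp.1]⟩, hK⟩
    · intro u hu
      have hI : u + v - S ∈ Icc (0:ℝ) (t - 2 * R) := ⟨by linarith [hu.1, hv.1], by linarith [hu.2, hv.2]⟩
      have h1 := hz _ hI
      have h2 := hxe (p1 + (u + v - S)) ⟨by linarith [hI.1, hp.1], by linarith [hI.2, hp.2, hp.1]⟩
      rw [← flow_add hφ, ← flow_add hφ, show u + (v + (p1 - S)) = p1 + (u + v - S) by ring,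
        show u + v = S + (u + v - S) by ring]
      have := dist_triangle (φ (p1 + (u + v - S)) x) (φ (p1 + (u + v - S)) e) (φ (S + (u + v - S)) z)
      rw [show S + (u + v - S) - S = u + v - S by ring]
      linarith

theorem interval_cover {a b α β : ℝ} {B1 B2 : Set ℝ} (hα : 0 ≤ α) (hβ : 0 ≤ β) (h1 : volume B1 ≤ ENNReal.ofReal α)
    (h2 : volume B2 ≤ ENNReal.ofReal β) (h : ∀ v ∈ Icc a b, v ∉ B1 → v ∉ B2 → False) : b - a ≤ α + β := by
  have hs : Icc a b ⊆ B1 ∪ B2 := by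
    intro v hv
    by_contra hc
    rw [mem_union, not_or] at hc
    exact h v hv hc.1 hc.2
  have := (measure_mono (μ := volume) hs).trans ((measure_union_le _ _).trans (add_le_add h1 h2))
  rw [Real.volume_Icc, ← ENNReal.ofReal_add hα hβ] at this
  exact (ENNReal.ofReal_le_ofReal_iff (by positivity)).1 this

set_option maxHeartbeats 1000000 in
open Classical in
theorem no_singular (hφ : IsCtsFlow φ) (hpot : Continuous pot) (hε : 0 < ε) (hδ : 0 < δ) (hδε : 1000 * δ ≤ ε)
    (hexp : AlmostExpansive φ ε) {𝒟 Pc 𝒢 𝒮 : Set (M × ℝ)}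
    {p g s : M × ℝ → ℝ} (hdec : IsDecomposition φ 𝒟 Pc 𝒢 𝒮 p g s) {T K : ℝ} (hT : 0 < T) (hK : 0 < K)
    (hspec : SpecT φ 𝒢 δ T) (hbow : BowK φ pot ε 𝒢 K) {P c C : ℝ} (hc : 0 < c) (hC : 0 < C) {R t0 : ℕ}
    (hU : ∀ (t : ℕ) (E : Finset M), Sep φ 0 t (10 * δ) E →
      ∑ e ∈ E, Real.exp (birkhoff φ pot e t) ≤ C * Real.exp (t * P))
    (hGood : ∀ ν : Measure M, IsEquilibriumOn φ univ pot ν → ∀ t : ℕ, t0 ≤ t → ∀ X : Set M, 1 / 2 ≤ ν.real X →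
      ∃ E : Finset M, Sep φ 0 t (100 * δ) E ∧ (∀ e ∈ E, (e, (t:ℝ)) ∈ 𝒟 ∧ p (e, (t:ℝ)) ≤ R ∧ s (e, (t:ℝ)) ≤ R) ∧
        (∀ e ∈ E, ∃ x ∈ X, dclose φ 0 t (101 * δ) x e) ∧
        c * Real.exp (t * P) ≤ ∑ e ∈ E, Real.exp (birkhoff φ pot e t))
    {κ1 κ2 : Measure M} (hκ1 : IsEquilibriumOn φ univ pot κ1) (hκ2 : IsEquilibriumOn φ univ pot κ2)
    (hsing : κ1.MutuallySingular κ2) : False := by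
  obtain ⟨hp1, hi1⟩ := inv_on_univ.1 hκ1.1
  obtain ⟨hp2, hi2⟩ := inv_on_univ.1 hκ2.1
  haveI : Nonempty M := by
    by_contra h
    rw [not_nonempty_iff] at h
    have := measure_univ (μ := κ1)
    rw [univ_eq_empty_iff.2 h] at this
    simp at this
  obtain ⟨Q, hQ, hglue⟩ := glue2 hφ hpot hδ (by linarith) hdec hT hK hspec hbow R
  obtain ⟨q, hq⟩ := exists_nat_gt (C * Real.exp (⌈T⌉₊ * P) * Q / c ^ 2)
  set η : ℝ := 1 / (4 * (q + 1)) with hη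
  have hη0 : 0 < η := by positivity
  obtain ⟨A1, A2, mA1, mA2, fA1, fA2, iA1, iA2, dA⟩ := exists_inv_sets hφ hi1 hi2 hsing
  obtain ⟨s1, -, K1, hK1, cK1, rK1⟩ := exists_compact_exp hφ hexp κ1 hi1 mA1 fA1 (show 0 < η / 2 by positivity)
  obtain ⟨s2, -, K2, hK2, cK2, rK2⟩ := exists_compact_exp hφ hexp κ2 hi2 mA2 fA2 (show 0 < η / 2 by positivity)
  obtain ⟨m, hm⟩ := exists_sep_nbhd hφ iA1 iA2 dA cK1 cK2 hK1 hK2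
  obtain ⟨n, hn⟩ := exists_nat_gt (t0 + (2 * R + T) + 2 * (4 * R + 2 * m + T) : ℝ)
  have hR0 : (0:ℝ) ≤ R := Nat.cast_nonneg R
  have hm0 : (0:ℝ) ≤ m := Nat.cast_nonneg m
  have ht00 : (0:ℝ) ≤ t0 := Nat.cast_nonneg t0
  have hn0 : (0:ℝ) < n := by linarith
  have hnt : t0 ≤ n := by
    have : (t0:ℝ) ≤ n := by linarith
    exact_mod_cast this
  set N' : ℕ := (q + 1) * n + ⌈T⌉₊ with hN'
  obtain ⟨Z, w, hZs, -, hwc, hwb⟩ := exists_retract hφ hpot (show 0 < δ / 10 by positivity) N'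
  have hZs' : Sep φ 0 N' (10 * δ) Z := hZs.mono le_rfl le_rfl (by linarith)
  have hZtot := hU N' Z hZs'
  have key : ∀ j : ℕ, j < q → ∃ Zj ⊆ Z,
      (∀ z ∈ Zj, ∃ Bd : Set ℝ, volume Bd ≤ ENNReal.ofReal (η * ((j + 1) * n)) ∧
        ∀ v ∈ Icc (m : ℝ) ((j + 1) * n - 2 * R - m), v ∉ Bd → ∃ x' ∈ K1, dclose φ (-m) m ε x' (φ v z)) ∧
      (∀ z ∈ Zj, ∃ Bd : Set ℝ, volume Bd ≤ ENNReal.ofReal (η * ((q - j) * n)) ∧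
        ∀ v ∈ Icc ((j + 1) * n + T + m : ℝ) ((q + 1) * n - 4 * R - m), v ∉ Bd →
          ∃ x' ∈ K2, dclose φ (-m) m ε x' (φ v z)) ∧
      c ^ 2 / Q * Real.exp (((q:ℝ) + 1) * n * P) ≤ ∑ z ∈ Zj, Real.exp (birkhoff φ pot z N') := by
    intro j hj
    set t1 : ℕ := (j + 1) * n with ht1
    set t2 : ℕ := (q - j) * n with ht2
    have ct1 : (t1:ℝ) = (j + 1) * n := by rw [ht1]; push_cast; ring
    have ct2 : (t2:ℝ) = (q - j) * n := by rw [ht2]; push_cast [Nat.cast_sub hj.le]; ring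
    have hj0 : (0:ℝ) ≤ j := Nat.cast_nonneg j
    have hj1 : (j:ℝ) + 1 ≤ q := by exact_mod_cast hj
    have n1 : n ≤ t1 := Nat.le_mul_of_pos_left n (by omega)
    have n2 : n ≤ t2 := Nat.le_mul_of_pos_left n (by omega)
    have n1' : (n:ℝ) ≤ t1 := by exact_mod_cast n1
    have n2' : (n:ℝ) ≤ t2 := by exact_mod_cast n2
    have m1 := markov_set hφ κ1 hi1 cK1.measurableSet hη0 rK1 (t := t1) (by linarith)
    have m2 := markov_set hφ κ2 hi2 cK2.measurableSet hη0 rK2 (t := t2) (by linarith)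
    obtain ⟨E1, a1, a2, a3, a4⟩ := hGood κ1 hκ1 t1 (hnt.trans n1) _ m1
    obtain ⟨E2, b1, b2, b3, b4⟩ := hGood κ2 hκ2 t2 (hnt.trans n2) _ m2
    have cN : (N':ℝ) = (q + 1) * n + ⌈T⌉₊ := by rw [hN']; push_cast; ring
    have ceil1 := Nat.le_ceil T
    have ceil2 := Nat.ceil_lt_add_one hT.le
    obtain ⟨Zj, z1, z2, z3⟩ := hglue t1 t2 (by linarith) (by linarith) E1 E2 a1 b1 a2 b2 N'
      (by rw [ct1, ct2, cN]; linarith) (by rw [ct1, ct2, cN]; linarith) Z (fun y => w y)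
      (fun y => ⟨(w y).2, (hwc y).mono le_rfl le_rfl (by linarith), hwb y⟩)
    refine ⟨Zj, z1, ?_, ?_, ?_⟩
    · intro z hz
      obtain ⟨e1, he1, e2, he2, S, hS, p1, hp1, p2, hp2, f1, f2⟩ := z2 z hz
      obtain ⟨x, hx, hxe⟩ := a3 e1 he1
      obtain ⟨Bd, g1, g2⟩ := bad_times hφ (show 113 * δ ≤ ε by linarith) (S := 0) (m := m) (z := z) hx hxe hp1
        (fun v hv => by rw [zero_add]; exact f1 v hv)
      refine ⟨Bd, by rw [← ct1]; exact g1, fun v hv hvB => g2 v ⟨by linarith [hv.1], ?_⟩ hvB⟩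
      rw [ct1]; linarith [hv.2]
    · intro z hz
      obtain ⟨e1, he1, e2, he2, S, hS, p1, hp1, p2, hp2, f1, f2⟩ := z2 z hz
      obtain ⟨x, hx, hxe⟩ := b3 e2 he2
      obtain ⟨Bd, g1, g2⟩ := bad_times hφ (show 113 * δ ≤ ε by linarith) (S := S) (m := m) (z := z) hx hxe hp2 f2
      rw [ct1] at hS
      refine ⟨Bd, by rw [← ct2]; exact g1, fun v hv hvB => g2 v ⟨by linarith [hv.1, hS.2], ?_⟩ hvB⟩
      rw [ct2]; linarith [hv.2, hS.1]
    · have hmul := mul_le_mul a4 b4 (by positivity) ((by positivity : 0 ≤ c * Real.exp (t1 * P)).trans a4)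
      have := hmul.trans z3
      rw [div_mul_eq_mul_div, div_le_iff₀ hQ]
      refine le_trans (le_of_eq ?_) (this.trans (le_of_eq (mul_comm _ _)))
      rw [show c * Real.exp (t1 * P) * (c * Real.exp (t2 * P)) = c ^ 2 * (Real.exp (t1 * P) * Real.exp (t2 * P)) by ring,
        ← Real.exp_add, ct1, ct2]
      congr 2; ring
  choose! Zj k1 k2 k3 k4 using key
  have hdisj : ∀ j j' : ℕ, j < q → j' < q → j < j' → Disjoint (Zj j) (Zj j') := by
    intro j j' hj hj' hjj
    rw [Finset.disjoint_left]
    intro z hz hz'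
    obtain ⟨B1, v1, w1⟩ := k2 j' hj' z hz'
    obtain ⟨B2, v2, w2⟩ := k3 j hj z hz
    have hj0 : (0:ℝ) ≤ j := Nat.cast_nonneg j
    have hj1 : (j:ℝ) + 1 ≤ j' := by exact_mod_cast hjj
    have hj2 : (j':ℝ) + 1 ≤ q := by exact_mod_cast hj'
    have u1 : ((j':ℝ) + 1) * n ≤ (q + 1) * n := by nlinarith [Nat.cast_nonneg (α := ℝ) n]
    have u2 : ((q:ℝ) - j) * n ≤ (q + 1) * n := by nlinarith [Nat.cast_nonneg (α := ℝ) n]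
    have u3 : ((j:ℝ) + 1) * n + n ≤ (j' + 1) * n := by nlinarith
    have u0 : (0:ℝ) ≤ (j + 1) * n := by positivity
    have u5 : (0:ℝ) ≤ (q - j) * n := mul_nonneg (by linarith) hn0.le
    have hcov := interval_cover (a := (j + 1) * n + T + m) (b := (j' + 1) * n - 4 * R - m)
      (by positivity) (mul_nonneg hη0.le u5) v1 v2 (by
        intro v hv h1 h2
        obtain ⟨x, hx, hxd⟩ := w1 v ⟨by linarith [hv.1], by linarith [hv.2]⟩ h1
        obtain ⟨y, hy, hyd⟩ := w2 v ⟨hv.1, by linarith [hv.2]⟩ h2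
        exact hm x hx y hy _ hxd hyd)
    have v3 : η * ((j' + 1) * n) ≤ η * ((q + 1) * n) := by gcongr
    have v4 : η * (((q:ℝ) - j) * n) ≤ η * ((q + 1) * n) := by gcongr
    have v5 : η * (((q:ℝ) + 1) * n) = n / 4 := by rw [hη]; field_simp
    linarith
  have hpd : ((Finset.range q : Finset ℕ) : Set ℕ).PairwiseDisjoint Zj := by
    intro j hj j' hj' hne
    have a := Finset.mem_range.1 (Finset.mem_coe.1 hj)
    have b := Finset.mem_range.1 (Finset.mem_coe.1 hj')
    rcases lt_or_gt_of_ne hne with h | h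
    · exact hdisj j j' a b h
    · exact (hdisj j' j b a h).symm
  have hsum : ∑ j ∈ Finset.range q, ∑ z ∈ Zj j, Real.exp (birkhoff φ pot z N') ≤ ∑ z ∈ Z, Real.exp (birkhoff φ pot z N') := by
    rw [← Finset.sum_biUnion hpd]
    refine Finset.sum_le_sum_of_subset_of_nonneg ?_ (fun z _ _ => (Real.exp_pos _).le)
    intro z hz
    obtain ⟨j, hj, hz⟩ := Finset.mem_biUnion.1 hz
    exact k1 j (Finset.mem_range.1 hj) hz
  have hlow : (q:ℝ) * (c ^ 2 / Q * Real.exp (((q:ℝ) + 1) * n * P)) ≤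
      ∑ j ∈ Finset.range q, ∑ z ∈ Zj j, Real.exp (birkhoff φ pot z N') := by
    have := Finset.sum_le_sum (fun j (hj : j ∈ Finset.range q) => k4 j (Finset.mem_range.1 hj))
    simpa using this
  have hfin := hlow.trans (hsum.trans hZtot)
  have hexpN : Real.exp (N' * P) = Real.exp (⌈T⌉₊ * P) * Real.exp (((q:ℝ) + 1) * n * P) := by
    rw [← Real.exp_add, hN']; push_cast; congr 1; ring
  rw [hexpN, ← mul_assoc, ← mul_assoc] at hfin
  have hfin2 := le_of_mul_le_mul_right hfin (Real.exp_pos _)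
  rw [div_lt_iff₀ (by positivity)] at hq
  rw [mul_div_assoc', div_le_iff₀ hQ] at hfin2
  linarith

end Final
end CT




/-- **Revised Climenhaga–Thompson criterion.** For a Lipschitz flow on a compact metric
space, a continuous potential, scales `ε ≥ 1000 L_X δ` with almost expansivity at scale
`ε`, and a collection `𝒟 ⊆ M × ℝ⁺` admitting a decomposition `(Pc, 𝒢, 𝒮)` such that
(I) `𝒢` has tail (W)-specification at scale `δ`, (II) the potential has the Bowen
property at scale `ε` on `𝒢`, and (III) `P(𝒟ᶜ ∪ [Pc] ∪ [𝒮], pot, δ, ε) < P(pot)`,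
there is a unique equilibrium state. -/
theorem revised_climenhaga_thompson_criterion
    {M : Type*} [MetricSpace M] [CompactSpace M] [MeasurableSpace M] [BorelSpace M]
    (φ : ℝ → M → M) (hφ : IsLipschitzFlow φ)
    (pot : M → ℝ) (hpot : Continuous pot)
    (ε δ : ℝ) (hε : 0 < ε) (hδ : 0 < δ)
    (hscale : 1000 * flowLipBound φ * δ ≤ ε)
    (hexp : AlmostExpansive φ ε)
    (𝒟 Pc 𝒢 𝒮 : Set (M × ℝ)) (p g s : M × ℝ → ℝ)
    (h𝒟 : 𝒟 ⊆ {q : M × ℝ | 0 ≤ q.2})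
    (hdec : IsDecomposition φ 𝒟 Pc 𝒢 𝒮 p g s)
    (hspec : HasTailSpecification φ 𝒢 δ)
    (hbowen : HasBowenProperty φ pot ε 𝒢)
    (hgap : ctPressure φ pot (segComplement 𝒟 ∪ discretize φ Pc ∪ discretize φ 𝒮) δ ε <
      pressureOn φ Set.univ pot) :
    ∃! μ : Measure M, IsEquilibriumOn φ Set.univ pot μ := by
  have hφ' := hφ.1
  have hL : (1:ℝ) ≤ flowLipBound φ := le_max_left _ _
  have hδε : 1000 * δ ≤ ε := by nlinarith
  have hne : Nonempty M := by
    by_contra hM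
    rw [not_nonempty_iff] at hM
    have h1 : pressureOn φ Set.univ pot = 0 := by
      unfold pressureOn
      convert Real.sSup_empty using 2
      ext r
      simp only [Set.mem_setOf_eq, Set.mem_empty_iff_false, iff_false]
      rintro ⟨μ, hμ, -⟩
      have h3 := (CT.inv_on_univ.1 hμ).1
      have h4 : μ Set.univ = 1 := h3.measure_univ
      rw [Set.univ_eq_empty_iff.2 hM, measure_empty] at h4
      exact zero_ne_one h4
    have h2 : ∀ 𝒞 : Set (M × ℝ), ctPressure φ pot 𝒞 δ ε = 0 := by
      intro 𝒞
      have h5 : ∀ t, partitionSum φ pot 𝒞 δ ε t = 0 := by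
        intro t
        unfold partitionSum
        apply le_antisymm
        · refine Real.sSup_le ?_ le_rfl
          rintro r ⟨E, -, -, rfl⟩
          rw [Finset.eq_empty_of_isEmpty E, Finset.sum_empty]
        · refine Real.sSup_nonneg ?_
          rintro r ⟨E, -, -, rfl⟩
          rw [Finset.eq_empty_of_isEmpty E, Finset.sum_empty]
      unfold ctPressure
      simp only [h5, Real.log_zero, zero_div]
      exact Filter.limsup_const 0
    rw [h1, h2] at hgap
    exact lt_irrefl _ hgap
  obtain ⟨T, hT, hspecT⟩ := CT.exists_specT hspec
  obtain ⟨K, hK, hbowK⟩ := CT.exists_bowK hφ' hpot hbowen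
  obtain ⟨κ, hκ, C0, hC0, hU1⟩ := CT.lemU1 hφ' hpot hε hδ (by linarith) hexp hdec hT hK hspecT hbowK hgap
  obtain ⟨⟨C, hC, hU⟩, hR⟩ := CT.lemU3 hκ hC0 hU1
  obtain ⟨c, hc, hLow⟩ := CT.lemL hφ' hpot hδ (by linarith) hexp hC hU
  obtain ⟨R, t0, hGood⟩ := CT.lemGood hδ hc hR hLow
  obtain ⟨μ, hμ⟩ := CT.exists_equilibrium hφ' hpot hε hexp
  refine ⟨μ, hμ, fun ν hν => ?_⟩
  by_contra hneq
  obtain ⟨κ1, κ2, hκ1, hκ2, hsing⟩ := CT.exists_singular hφ' hpot hε hexp hν hμ hneq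
  exact CT.no_singular hφ' hpot hε hδ hδε hexp hdec hT hK hspecT hbowK (half_pos hc) hC hU hGood hκ1 hκ2 hsing
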